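/- Let (a_ℓ)_{ℓ≥1} be a sequence of positive integers, let α = [0; a_1, a_2, …] be the value of the corresponding infinite continued fraction, and let (p_ℓ/q_ℓ)_{ℓ≥1} denote its convergents. Assume that the sequence (q_ℓ^{1/ℓ})_{ℓ≥1} converges. Let w and w' be non-negative real numbers with w > w' + 1. If (a_ℓ)_{ℓ≥1} satisfies Condition (**)_{w,w'}, then α is transcendental. -/

import Mathlib

open Filter Topology

/-- Denominators of the convergents of the continued fraction `[0; a 0, a 1, ...]`,
where `a i` denotes the `(i+1)`-st partial quotient `a_{i+1}` of the paper:
`q_0 = 1`, `q_1 = a_1`, `q_{ℓ+1} = a_{ℓ+1} q_ℓ + q_{ℓ-1}`. -/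
def cfQ (a : ℕ → ℕ) : ℕ → ℕ
  | 0 => 1
  | 1 => a 0
  | n + 2 => a (n + 1) * cfQ a (n + 1) + cfQ a n

/-- Numerators of the convergents of the continued fraction `[0; a 0, a 1, ...]`:
`p_0 = 0`, `p_1 = 1`, `p_{ℓ+1} = a_{ℓ+1} p_ℓ + p_{ℓ-1}`. -/
def cfP (a : ℕ → ℕ) : ℕ → ℕ
  | 0 => 0
  | 1 => 1
  | n + 2 => a (n + 1) * cfP a (n + 1) + cfP a n

/-- An infinite word is eventually periodic. -/
def EventuallyPeriodic {A : Type*} (x : ℕ → A) : Prop :=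
  ∃ k p : ℕ, 0 < p ∧ ∀ n, k ≤ n → x (n + p) = x n

/-- The infinite word `x` begins with `V^w`: its prefix of length `⌈w·|V|⌉`
coincides with the prefix of the same length of the periodic word `VVV⋯`. -/
def BeginsWithPow {A : Type*} (x : ℕ → A) (V : List A) (w : ℝ) : Prop :=
  ∀ i < ⌈w * V.length⌉₊, V[i % V.length]? = some (x i)

/-- Condition `(*)_w`: `x` is not eventually periodic and there is a sequence of
nonempty finite words `V n` with strictly increasing lengths such that `x` begins
with `(V n)^w` for every `n`. -/
def ConditionStar {A : Type*} (x : ℕ → A) (w : ℝ) : Prop :=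
  ¬ EventuallyPeriodic x ∧
    ∃ V : ℕ → List A, (∀ n, V n ≠ []) ∧
      (StrictMono fun n => (V n).length) ∧
      ∀ n, BeginsWithPow x (V n) w

/-- Condition `(**)_{w,w'}`: `x` is not eventually periodic and there are
sequences of finite words `U n` and nonempty words `V n`, with `(|V n|)` strictly
increasing and `|U n|/|V n| ≤ w'`, such that `U n` followed by the prefix of
length `⌈w·|V n|⌉` of the periodic word `(V n)(V n)(V n)⋯` is a prefix of `x`. -/
def ConditionStarStar {A : Type*} (x : ℕ → A) (w w' : ℝ) : Prop :=
  ¬ EventuallyPeriodic x ∧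
    ∃ U V : ℕ → List A, (∀ n, V n ≠ []) ∧
      (StrictMono fun n => (V n).length) ∧
      (∀ n, ((U n).length : ℝ) ≤ w' * ((V n).length : ℝ)) ∧
      ∀ n, (∀ i < (U n).length, (U n)[i]? = some (x i)) ∧
        BeginsWithPow (fun i => x ((U n).length + i)) (V n) w



noncomputable section

namespace SubsThm

section Norms
variable {σ : Type*} {R : Type*} [NormedCommRing R]

/-- the weight of a monomial -/
def wt (w : σ → ℝ) (e : σ →₀ ℕ) : ℝ := e.prod fun i n => w i ^ n

/-- weighted l1 norm of a polynomial -/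
def nrm (w : σ → ℝ) (P : MvPolynomial σ R) : ℝ :=
  ∑ e ∈ P.support, ‖P.coeff e‖ * wt w e

lemma wt_zero (w : σ → ℝ) : wt w 0 = 1 := by simp [wt]

lemma wt_add (w : σ → ℝ) (e f : σ →₀ ℕ) : wt w (e + f) = wt w e * wt w f := by
  classical
  exact Finsupp.prod_add_index' (by simp) (by intros; rw [pow_add])

lemma wt_nonneg {w : σ → ℝ} (hw : ∀ i, 0 ≤ w i) (e : σ →₀ ℕ) : 0 ≤ wt w e :=
  Finset.prod_nonneg fun i _ => pow_nonneg (hw i) _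

lemma wt_single (w : σ → ℝ) (i : σ) (n : ℕ) : wt w (Finsupp.single i n) = w i ^ n := by
  simp [wt]

lemma wt_one (e : σ →₀ ℕ) : wt (fun _ => (1 : ℝ)) e = 1 := by simp [wt, Finsupp.prod]

lemma nrm_nonneg {w : σ → ℝ} (hw : ∀ i, 0 ≤ w i) (P : MvPolynomial σ R) : 0 ≤ nrm w P :=
  Finset.sum_nonneg fun e _ => mul_nonneg (norm_nonneg _) (wt_nonneg hw e)

lemma nrm_eq_of_subset (w : σ → ℝ) (P : MvPolynomial σ R) {s : Finset (σ →₀ ℕ)}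
    (h : P.support ⊆ s) : nrm w P = ∑ e ∈ s, ‖P.coeff e‖ * wt w e := by
  apply Finset.sum_subset h
  intro e _ he
  rw [MvPolynomial.notMem_support_iff.1 he]; simp

lemma nrm_zero (w : σ → ℝ) : nrm w (0 : MvPolynomial σ R) = 0 := by simp [nrm]

lemma nrm_add_le {w : σ → ℝ} (hw : ∀ i, 0 ≤ w i) (P Q : MvPolynomial σ R) :
    nrm w (P + Q) ≤ nrm w P + nrm w Q := by
  classical
  rw [nrm_eq_of_subset w (P + Q) (s := P.support ∪ Q.support) MvPolynomial.support_add,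
    nrm_eq_of_subset w P (s := P.support ∪ Q.support) Finset.subset_union_left,
    nrm_eq_of_subset w Q (s := P.support ∪ Q.support) Finset.subset_union_right,
    ← Finset.sum_add_distrib]
  apply Finset.sum_le_sum
  intro e _
  rw [← add_mul, MvPolynomial.coeff_add]
  exact mul_le_mul_of_nonneg_right (norm_add_le _ _) (wt_nonneg hw e)

lemma nrm_sum_le {w : σ → ℝ} (hw : ∀ i, 0 ≤ w i) {κ : Type*} (s : Finset κ)
    (f : κ → MvPolynomial σ R) : nrm w (∑ k ∈ s, f k) ≤ ∑ k ∈ s, nrm w (f k) := by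
  classical
  induction s using Finset.induction_on with
  | empty => simp [nrm_zero]
  | insert a s ha ih =>
    rw [Finset.sum_insert ha, Finset.sum_insert ha]
    exact (nrm_add_le hw _ _).trans (by linarith)

lemma nrm_monomial (w : σ → ℝ) (e : σ →₀ ℕ) (c : R) :
    nrm w (MvPolynomial.monomial e c) = ‖c‖ * wt w e := by
  classical
  rw [nrm_eq_of_subset w _ (s := {e}) MvPolynomial.support_monomial_subset]
  simp

lemma nrm_monomial_mul_le {w : σ → ℝ} (hw : ∀ i, 0 ≤ w i) (e : σ →₀ ℕ) (c : R)
    (Q : MvPolynomial σ R) :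
    nrm w (MvPolynomial.monomial e c * Q) ≤ ‖c‖ * wt w e * nrm w Q := by
  classical
  conv_lhs => rw [Q.as_sum, Finset.mul_sum]
  refine (nrm_sum_le hw _ _).trans ?_
  rw [nrm, Finset.mul_sum]
  apply Finset.sum_le_sum
  intro f _
  rw [MvPolynomial.monomial_mul, nrm_monomial, wt_add]
  calc ‖c * Q.coeff f‖ * (wt w e * wt w f) ≤ ‖c‖ * ‖Q.coeff f‖ * (wt w e * wt w f) :=
        mul_le_mul_of_nonneg_right (norm_mul_le _ _)
          (mul_nonneg (wt_nonneg hw _) (wt_nonneg hw _))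
    _ = _ := by ring

lemma nrm_mul_le {w : σ → ℝ} (hw : ∀ i, 0 ≤ w i) (P Q : MvPolynomial σ R) :
    nrm w (P * Q) ≤ nrm w P * nrm w Q := by
  classical
  conv_lhs => rw [P.as_sum, Finset.sum_mul]
  refine (nrm_sum_le hw _ _).trans ?_
  rw [nrm, Finset.sum_mul]
  exact Finset.sum_le_sum fun e _ => nrm_monomial_mul_le hw e _ Q

lemma nrm_C (w : σ → ℝ) (c : R) : nrm w (MvPolynomial.C c : MvPolynomial σ R) = ‖c‖ := by
  rw [MvPolynomial.C_apply, nrm_monomial, wt_zero, mul_one]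

lemma nrm_neg (w : σ → ℝ) (P : MvPolynomial σ R) : nrm w (-P) = nrm w P := by
  unfold nrm
  rw [MvPolynomial.support_neg]
  simp

lemma coeff_le_nrm {w : σ → ℝ} (hw : ∀ i, 0 ≤ w i) (P : MvPolynomial σ R) (e : σ →₀ ℕ) :
    ‖P.coeff e‖ * wt w e ≤ nrm w P := by
  classical
  by_cases he : e ∈ P.support
  · exact Finset.single_le_sum (f := fun e => ‖P.coeff e‖ * wt w e)
      (fun e _ => mul_nonneg (norm_nonneg _) (wt_nonneg hw e)) he
  · rw [MvPolynomial.notMem_support_iff.1 he]; simp [nrm_nonneg hw]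

variable [NormOneClass R]

lemma nrm_one (w : σ → ℝ) : nrm w (1 : MvPolynomial σ R) = 1 := by
  rw [← MvPolynomial.C_1, nrm_C, norm_one]

lemma nrm_X (w : σ → ℝ) (i : σ) : nrm w (MvPolynomial.X i : MvPolynomial σ R) = w i := by
  rw [MvPolynomial.X, nrm_monomial, wt_single]; simp

lemma nrm_pow_le {w : σ → ℝ} (hw : ∀ i, 0 ≤ w i) (P : MvPolynomial σ R) (n : ℕ) :
    nrm w (P ^ n) ≤ nrm w P ^ n := by
  induction n with
  | zero => simp [nrm_one]
  | succ n ih =>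
    rw [pow_succ, pow_succ]
    exact (nrm_mul_le hw _ _).trans (mul_le_mul_of_nonneg_right ih (nrm_nonneg hw _))

lemma nrm_prod_le {w : σ → ℝ} (hw : ∀ i, 0 ≤ w i) {κ : Type*} (s : Finset κ)
    (f : κ → MvPolynomial σ R) : nrm w (∏ k ∈ s, f k) ≤ ∏ k ∈ s, nrm w (f k) := by
  classical
  induction s using Finset.induction_on with
  | empty => simp [nrm_one]
  | insert a s ha ih =>
    rw [Finset.prod_insert ha, Finset.prod_insert ha]
    exact (nrm_mul_le hw _ _).trans (mul_le_mul_of_nonneg_left ih (nrm_nonneg hw _))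

end Norms

lemma nrm_map_intCast {σ : Type*} (w : σ → ℝ) (P : MvPolynomial σ ℤ) :
    nrm w (MvPolynomial.map (Int.castRingHom ℝ) P) = nrm w P := by
  classical
  rw [nrm_eq_of_subset w _ (s := P.support) (MvPolynomial.support_map_subset _ _)]
  simp [nrm, MvPolynomial.coeff_map, Int.norm_eq_abs]

end SubsThm
end


set_option linter.unusedSectionVars false

noncomputable section

namespace SubsThm

/-- iterated derivations along a word -/
def wd {ι R : Type*} [CommRing R] [Algebra ℚ R] (D : ι → Derivation ℚ R R) (w : List ι) (x : R) : R :=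
  w.foldr (fun i y => D i y) x

section GW
variable {ι R : Type*} [CommRing R] [IsDomain R] [Algebra ℚ R] (D : ι → Derivation ℚ R R)

lemma wd_cons (i : ι) (w : List ι) (x : R) : wd D (i :: w) x = D i (wd D w x) := rfl
lemma wd_nil (x : R) : wd D [] x = x := rfl

theorem gw (H : ∀ u v : R, u ≠ 0 → (∀ i, u * D i v = v * D i u) → ∃ l : ℚ, v = l • u) (k : ℕ) :
    ∀ φ : Fin k → R, LinearIndependent ℚ φ →
      ∃ w : Fin k → List ι, (∀ a, (w a).length ≤ a) ∧
        (Matrix.of fun a j => wd D (w a) (φ j)).det ≠ 0 := by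
  induction k with
  | zero => intro φ _; exact ⟨fun _ => [], by simp, by simp⟩
  | succ k ih =>
    intro φ hφ
    obtain ⟨w, hw, hd⟩ := ih (φ ∘ Fin.castSucc) (hφ.comp _ (Fin.castSucc_injective k))
    by_contra hcon
    push Not at hcon
    set c : Fin (k+1) → R := fun j =>
      (-1) ^ ((Fin.last k : Fin (k+1)) + j : ℕ) * (Matrix.of fun a b => wd D (w a) (φ (j.succAbove b))).det
      with hc
    set d := (Matrix.of fun a j => wd D (w a) ((φ ∘ Fin.castSucc) j)).det with hdd
    have hcl : c (Fin.last k) = d := by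
      simp only [hc, Fin.succAbove_last, hdd]
      rw [Even.neg_one_pow ⟨_, rfl⟩, one_mul]; rfl
    have rel : ∀ u : List ι, u.length ≤ k → ∑ j, wd D u (φ j) * c j = 0 := by
      intro u hu
      have := hcon (Fin.snoc w u) (by
        intro a
        refine Fin.lastCases ?_ (fun a => ?_) a
        · simpa using hu
        · simpa using hw a)
      rw [Matrix.det_succ_row _ (Fin.last k)] at this
      rw [← this]
      apply Finset.sum_congr rfl
      intro j _
      simp only [hc, Matrix.of_apply, Fin.snoc_last]
      have e : (Matrix.of fun a j => wd D (Fin.snoc (α := fun _ => List ι) w u a) (φ j)).submatrix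
          (Fin.last k).succAbove j.succAbove = Matrix.of fun a b => wd D (w a) (φ (j.succAbove b)) := by
        ext a b
        simp [Fin.succAbove_last]
      rw [e]; ring
    clear_value c
    have rel2 : ∀ i, ∀ u : List ι, u.length + 1 ≤ k → ∑ j, wd D u (φ j) * D i (c j) = 0 := by
      intro i u hu
      have h1 := congrArg (D i) (rel u (by omega))
      rw [map_sum, map_zero] at h1
      have h2 := rel (i :: u) (by simpa using hu)
      have h3 : ∑ j, wd D u (φ j) * D i (c j) + ∑ j, wd D (i :: u) (φ j) * c j = 0 := by
        rw [← h1, ← Finset.sum_add_distrib]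
        apply Finset.sum_congr rfl
        intro j _
        rw [Derivation.leibniz, wd_cons]
        simp only [smul_eq_mul]; ring
      rwa [h2, add_zero] at h3
    have key : ∀ i, ∀ j : Fin k, d * D i (c j.castSucc) = c j.castSucc * D i d := by
      intro i
      have hv : (Matrix.of fun a j => wd D (w a) ((φ ∘ Fin.castSucc) j)).mulVec
          (fun j => d * D i (c j.castSucc) - c j.castSucc * D i d) = 0 := by
        ext a
        simp only [Matrix.mulVec, dotProduct, Matrix.of_apply, Function.comp, Pi.zero_apply]
        have hl : (w a).length + 1 ≤ k := by have := hw a; have := a.2; omega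
        have e1 := rel2 i (w a) hl
        have e2 := rel (w a) (by omega)
        rw [Fin.sum_univ_castSucc] at e1 e2
        rw [hcl] at e1 e2
        have : ∑ x : Fin k, wd D (w a) (φ x.castSucc) * (d * D i (c x.castSucc) - c x.castSucc * D i d)
            = d * (∑ x : Fin k, wd D (w a) (φ x.castSucc) * D i (c x.castSucc))
              - D i d * (∑ x : Fin k, wd D (w a) (φ x.castSucc) * c x.castSucc) := by
          rw [Finset.mul_sum, Finset.mul_sum, ← Finset.sum_sub_distrib]
          apply Finset.sum_congr rfl
          intro x _; ring
        rw [this]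
        linear_combination d * e1 - D i d * e2
      have := Matrix.eq_zero_of_mulVec_eq_zero hd hv
      intro j
      have := congrFun this j
      simpa [sub_eq_zero] using this
    have hl : ∀ j : Fin (k+1), ∃ l : ℚ, c j = l • d := by
      intro j
      refine Fin.lastCases ?_ (fun j => ?_) j
      · exact ⟨1, by rw [hcl, one_smul]⟩
      · exact H _ _ hd fun i => key i j
    choose l hl using hl
    have e := rel [] (by simp)
    simp only [wd_nil, hl] at e
    have e' : (∑ j, l j • φ j) * d = 0 := by
      rw [← e, Finset.sum_mul]
      apply Finset.sum_congr rfl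
      intro j _
      rw [smul_mul_assoc, mul_smul_comm]
    have e2 := (mul_eq_zero.1 e').resolve_right hd
    have e3 := Fintype.linearIndependent_iff.1 hφ l e2 (Fin.last k)
    have e4 := hl (Fin.last k)
    rw [hcl, e3, zero_smul] at e4
    exact hd e4
end GW

section HMv
open MvPolynomial

lemma coeff_euler {n : ℕ} (i : Fin n) (p : MvPolynomial (Fin n) ℚ) (e : Fin n →₀ ℕ) :
    coeff e (X i * pderiv i p) = e i * coeff e p := by
  induction p using MvPolynomial.induction_on' with
  | monomial u a =>
    rw [X_mul_pderiv_monomial, coeff_smul, coeff_monomial]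
    split_ifs with h <;> simp [h]
  | add p q hp hq => rw [map_add, mul_add, coeff_add, hp, hq, coeff_add]; ring

theorem H_mv {n : ℕ} (u v : MvPolynomial (Fin n) ℚ) (hu : u ≠ 0)
    (h : ∀ i, u * pderiv i v = v * pderiv i u) : ∃ l : ℚ, v = l • u := by
  set M : MonomialOrder (Fin n) := MonomialOrder.lex
  have hua : coeff (M.degree u) u ≠ 0 := by rwa [MonomialOrder.coeff_degree_ne_zero_iff]
  refine ⟨coeff (M.degree u) v / coeff (M.degree u) u, ?_⟩
  set l := coeff (M.degree u) v / coeff (M.degree u) u with hl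
  by_contra hne
  set w := v - l • u with hw
  have hw0 : w ≠ 0 := by rwa [hw, sub_ne_zero]
  have hwb : coeff (M.degree w) w ≠ 0 := by rwa [MonomialOrder.coeff_degree_ne_zero_iff]
  have hwa : coeff (M.degree u) w = 0 := by
    rw [hw, coeff_sub, coeff_smul, hl, smul_eq_mul]; field_simp; ring
  have hdeg : ∀ (i : Fin n) (p : MvPolynomial (Fin n) ℚ), M.toSyn (M.degree (X i * pderiv i p)) ≤ M.toSyn (M.degree p) := by
    intro i p
    rw [MonomialOrder.degree_le_iff]
    intro b hb
    apply MonomialOrder.le_degree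
    rw [mem_support_iff] at hb ⊢
    rw [coeff_euler] at hb
    exact right_ne_zero_of_mul hb
  have hab : M.degree u = M.degree w := by
    ext i
    have e1 : u * (X i * pderiv i w) = w * (X i * pderiv i u) := by
      rw [hw, map_sub, Derivation.map_smul]
      simp only [smul_eq_C_mul]
      linear_combination X i * h i
    have e2 := congrArg (coeff (M.degree u + M.degree w)) e1
    rw [MonomialOrder.coeff_mul_of_add_of_degree_le le_rfl (hdeg i w),
      add_comm, MonomialOrder.coeff_mul_of_add_of_degree_le le_rfl (hdeg i u), coeff_euler, coeff_euler] at e2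
    have e3 : coeff (M.degree u) u * coeff (M.degree w) w * ((M.degree u i : ℚ) - M.degree w i) = 0 := by
      linear_combination -e2
    have e4 := (mul_eq_zero.1 e3).resolve_left (mul_ne_zero hua hwb)
    rw [sub_eq_zero] at e4
    exact_mod_cast e4
  rw [← hab] at hwb
  exact hwb hwa

end HMv
end SubsThm
end


set_option linter.unusedSectionVars false

noncomputable section

namespace SubsThm

section OneVar
open Polynomial

theorem H_poly (u v : ℚ[X]) (hu : u ≠ 0)
    (h : u * derivative v = v * derivative u) : ∃ l : ℚ, v = l • u := by
  have hE : ∀ (p : ℚ[X]) (e : ℕ), coeff (X * derivative p) e = e * coeff p e := by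
    intro p e
    cases e with
    | zero => simp
    | succ e => rw [coeff_X_mul, coeff_derivative]; push_cast; ring
  have hua : coeff u u.natDegree ≠ 0 := by simpa using hu
  refine ⟨coeff v u.natDegree / coeff u u.natDegree, ?_⟩
  set l := coeff v u.natDegree / coeff u u.natDegree with hl
  by_contra hne
  set w := v - l • u with hw
  have hw0 : w ≠ 0 := by rwa [hw, sub_ne_zero]
  have hwb : coeff w w.natDegree ≠ 0 := by simpa using hw0
  have hwa : coeff w u.natDegree = 0 := by
    rw [hw, coeff_sub, coeff_smul, hl, smul_eq_mul]; field_simp; ring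
  have hdeg : ∀ p : ℚ[X], (X * derivative p).natDegree ≤ p.natDegree := by
    intro p
    rw [natDegree_le_iff_coeff_eq_zero]
    intro N hN
    rw [hE, coeff_eq_zero_of_natDegree_lt hN, mul_zero]
  have hab : u.natDegree = w.natDegree := by
    have e1 : u * (X * derivative w) = w * (X * derivative u) := by
      rw [hw, derivative_sub, derivative_smul]
      simp only [smul_eq_C_mul]
      linear_combination X * h
    have e2 := congrArg (fun p => coeff p (u.natDegree + w.natDegree)) e1
    rw [coeff_mul_add_eq_of_natDegree_le le_rfl (hdeg w),
      add_comm, coeff_mul_add_eq_of_natDegree_le le_rfl (hdeg u), hE, hE] at e2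
    have e3 : coeff u u.natDegree * coeff w w.natDegree * ((u.natDegree : ℚ) - w.natDegree) = 0 := by
      linear_combination -e2
    have e4 := (mul_eq_zero.1 e3).resolve_left (mul_ne_zero hua hwb)
    rw [sub_eq_zero] at e4
    exact_mod_cast e4
  rw [← hab] at hwb
  exact hwb hwa

/-- one variable lemma: high order vanishing at a rational point forces large coefficients. -/
theorem one_var (V : ℤ[X]) (hV : V ≠ 0) (u v : ℤ) (huv : IsCoprime u v) (hv : v ≠ 0) (τ : ℕ)
    (h : (X - C (u / v : ℚ)) ^ τ ∣ V.map (Int.castRingHom ℚ)) (B : ℝ)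
    (hB : ∀ i, |(V.coeff i : ℝ)| ≤ B) :
    ((max |u| |v| : ℤ) : ℝ) ^ τ ≤ B := by
  have hvq : (v : ℚ) ≠ 0 := by exact_mod_cast hv
  set p : ℤ[X] := C v * X - C u with hp
  have hpprim : p.IsPrimitive := by
    intro r hr
    have h0 : r ∣ p.coeff 0 := (C_dvd_iff_dvd_coeff _ _).1 hr 0
    have h1 : r ∣ p.coeff 1 := (C_dvd_iff_dvd_coeff _ _).1 hr 1
    simp only [hp, coeff_sub, coeff_C_mul, coeff_X, coeff_C] at h0 h1
    norm_num at h0 h1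
    obtain ⟨a, b, hab⟩ := huv
    exact isUnit_of_dvd_one (hab ▸ dvd_add (h0.mul_left a) (h1.mul_left b))
  have hdvd : p ^ τ ∣ V := by
    have hpow : (p ^ τ).IsPrimitive := by
      clear h
      induction τ with
      | zero => simp
      | succ n ih => rw [pow_succ]; exact ih.mul hpprim
    rw [IsPrimitive.Int.dvd_iff_map_cast_dvd_map_cast _ _ hpow, Polynomial.map_pow]
    have : p.map (Int.castRingHom ℚ) = C (v:ℚ) * (X - C (u / v : ℚ)) := by
      rw [mul_sub, ← C_mul, mul_div_cancel₀ _ hvq, hp]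
      simp
    rw [this, mul_pow]
    have hu : IsUnit (C (v:ℚ) ^ τ) := (isUnit_C.2 (isUnit_iff_ne_zero.2 hvq)).pow τ
    exact (hu.mul_left_dvd).2 h
  obtain ⟨G, hG⟩ := hdvd
  have hG0 : G ≠ 0 := by rintro rfl; simp [hG] at hV
  have habs : ∀ x y z : ℤ, z ≠ 0 → y = x ^ τ * z → |(y:ℝ)| ≤ B → |(x : ℝ)| ^ τ ≤ B := by
    intro x y z hz hy hB
    refine le_trans ?_ hB
    rw [hy]; push_cast
    rw [abs_mul, abs_pow]
    have : (1:ℝ) ≤ |(z:ℝ)| := by exact_mod_cast Int.one_le_abs hz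
    exact le_mul_of_one_le_right (by positivity) this
  have hlv : |(v:ℝ)| ^ τ ≤ B := by
    refine habs v V.leadingCoeff G.leadingCoeff (leadingCoeff_ne_zero.2 hG0) ?_ (hB _)
    rw [hG, leadingCoeff_mul, leadingCoeff_pow, hp, leadingCoeff_sub_of_degree_lt, leadingCoeff_C_mul_X]
    rw [degree_C_mul_X hv]
    exact lt_of_le_of_lt degree_C_le (by norm_num)
  have hlu : |(u:ℝ)| ^ τ ≤ B := by
    by_cases hu : u = 0
    · have hv1 : IsUnit v := by rw [hu, isCoprime_zero_left] at huv; exact huv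
      have : |(v:ℝ)| = 1 := by exact_mod_cast Int.isUnit_iff_abs_eq.1 hv1
      rw [this] at hlv
      refine le_trans ?_ hlv
      rw [hu]; exact pow_le_pow_left₀ (by positivity) (by simp) _
    · rw [← abs_neg]
      have := habs (-u) V.trailingCoeff G.trailingCoeff (trailingCoeff_nonzero_iff_nonzero.2 hG0) ?_ (hB _)
      · simpa using this
      · have hpt : p.trailingCoeff = -u := by
          rw [trailingCoeff_eq_coeff_zero] <;> simp [hp, hu]
        have : ∀ n : ℕ, (p ^ n).trailingCoeff = p.trailingCoeff ^ n := by
          intro n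
          induction n with
          | zero => simp [trailingCoeff]
          | succ n ih => rw [pow_succ, pow_succ, trailingCoeff_mul, ih]
        rw [hG, trailingCoeff_mul, this, hpt]
  push_cast
  rcases max_cases |(u:ℝ)| |(v:ℝ)| with h | h <;> rw [h.1] <;> assumption
end OneVar
end SubsThm
end


set_option linter.unusedSectionVars false

noncomputable section

namespace SubsThm

section MinTensor
variable {M N Z : Type*} [AddCommGroup M] [AddCommGroup N] [AddCommGroup Z]
  [Module ℚ M] [Module ℚ N] [Module ℚ Z]

lemma min_tensor_aux (B : M →ₗ[ℚ] N →ₗ[ℚ] Z) (z : Z) (k : ℕ) (φ : Fin k → M) (ψ : Fin k → N)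
    (h : z = ∑ j, B (φ j) (ψ j)) (hn : ¬ LinearIndependent ℚ φ) :
    ∃ k' < k, ∃ (φ' : Fin k' → M) (ψ' : Fin k' → N), z = ∑ j, B (φ' j) (ψ' j) := by
  obtain ⟨g, hg, i, hi⟩ := Fintype.not_linearIndependent_iff.1 hn
  cases k with
  | zero => exact i.elim0
  | succ k =>
    refine ⟨k, Nat.lt_succ_self k, fun j => φ (i.succAbove j),
      fun j => ψ (i.succAbove j) - (g (i.succAbove j) / g i) • ψ i, ?_⟩
    rw [h, Fin.sum_univ_succAbove _ i]
    rw [Fin.sum_univ_succAbove _ i] at hg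
    have hφ : φ i = - ∑ j, (g (i.succAbove j) / g i) • φ (i.succAbove j) := by
      have : φ i = (g i)⁻¹ • (g i • φ i) := by rw [smul_smul, inv_mul_cancel₀ hi, one_smul]
      rw [this, eq_neg_of_add_eq_zero_left hg, smul_neg, Finset.smul_sum]
      congr 1
      apply Finset.sum_congr rfl
      intro j _
      rw [smul_smul]; congr 1; field_simp
    conv_lhs => rw [hφ]
    simp only [map_neg, map_sum, LinearMap.neg_apply, LinearMap.sum_apply, map_smul,
      LinearMap.smul_apply, map_sub, Finset.sum_sub_distrib]
    abel

theorem min_tensor (B : M →ₗ[ℚ] N →ₗ[ℚ] Z) (z : Z) (k : ℕ) : ∀ (φ : Fin k → M) (ψ : Fin k → N),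
    z = ∑ j, B (φ j) (ψ j) → ∃ k' ≤ k, ∃ (φ' : Fin k' → M) (ψ' : Fin k' → N),
      z = ∑ j, B (φ' j) (ψ' j) ∧ LinearIndependent ℚ φ' ∧ LinearIndependent ℚ ψ' := by
  induction k using Nat.strong_induction_on with
  | _ k ih =>
    intro φ ψ h
    by_cases h1 : LinearIndependent ℚ φ
    · by_cases h2 : LinearIndependent ℚ ψ
      · exact ⟨k, le_rfl, φ, ψ, h, h1, h2⟩
      · obtain ⟨k', hk', ψ', φ', h'⟩ := min_tensor_aux B.flip z k ψ φ (by simpa using h) h2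
        obtain ⟨k2, hk2, H⟩ := ih k' hk' φ' ψ' (by simpa using h')
        exact ⟨k2, by omega, H⟩
    · obtain ⟨k', hk', φ', ψ', h'⟩ := min_tensor_aux B z k φ ψ h h1
      obtain ⟨k2, hk2, H⟩ := ih k' hk' φ' ψ' h'
      exact ⟨k2, by omega, H⟩
end MinTensor

section TP
open MvPolynomial
variable {n : ℕ}

/-- embed in the variables `1..n` -/
def emb1 (n : ℕ) : MvPolynomial (Fin n) ℚ →ₐ[ℚ] MvPolynomial (Fin (n+1)) ℚ := rename Fin.succ
/-- embed in the variable `0` -/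
def emb0 (n : ℕ) : Polynomial ℚ →ₐ[ℚ] MvPolynomial (Fin (n+1)) ℚ := Polynomial.aeval (X 0)

/-- external product -/
def tp : MvPolynomial (Fin n) ℚ →ₗ[ℚ] Polynomial ℚ →ₗ[ℚ] MvPolynomial (Fin (n+1)) ℚ :=
  LinearMap.mk₂ ℚ (fun A B => emb1 n A * emb0 n B)
    (by intros; rw [map_add, add_mul]) (by intros; rw [map_smul, smul_mul_assoc])
    (by intros; rw [map_add, mul_add]) (by intros; rw [map_smul, mul_smul_comm])

lemma tp_apply (A : MvPolynomial (Fin n) ℚ) (B : Polynomial ℚ) : tp A B = emb1 n A * emb0 n B := rfl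

lemma coeff_tp (A : MvPolynomial (Fin n) ℚ) (B : Polynomial ℚ) (i : ℕ) (e : Fin n →₀ ℕ) :
    coeff (e.cons i) (tp A B) = coeff e A * B.coeff i := by
  rw [← finSuccEquiv_coeff_coeff, tp_apply, map_mul]
  have h1 : finSuccEquiv ℚ n (emb1 n A) = Polynomial.C A := by
    rw [emb1]
    induction A using MvPolynomial.induction_on with
    | C a => rw [rename_C]; exact (finSuccEquiv ℚ n).commutes a
    | add p q hp hq => rw [map_add, map_add, hp, hq, map_add]
    | mul_X p i hp => rw [map_mul, map_mul, hp, rename_X, finSuccEquiv_X_succ, map_mul]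
  have h0 : finSuccEquiv ℚ n (emb0 n B) = B.map MvPolynomial.C := by
    rw [emb0]
    induction B using Polynomial.induction_on' with
    | add p q hp hq => rw [map_add, map_add, hp, hq, Polynomial.map_add]
    | monomial k a =>
      rw [Polynomial.aeval_monomial, map_mul, map_pow, finSuccEquiv_X_zero, Polynomial.map_monomial,
        ← Polynomial.C_mul_X_pow_eq_monomial]
      congr 1
      exact (finSuccEquiv ℚ n).commutes a
  rw [h1, h0, Polynomial.coeff_C_mul, Polynomial.coeff_map, mul_comm, coeff_C_mul, mul_comm]

lemma tp_decomp (P : MvPolynomial (Fin (n+1)) ℚ) (r : ℕ) (hr : ∀ e ∈ P.support, e 0 ≤ r) :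
    ∃ (φ : Fin (r+1) → MvPolynomial (Fin n) ℚ) (ψ : Fin (r+1) → Polynomial ℚ),
      P = ∑ j, tp (φ j) (ψ j) := by
  refine ⟨fun j => (finSuccEquiv ℚ n P).coeff j, fun j => Polynomial.X ^ (j:ℕ), ?_⟩
  ext m
  rw [← Finsupp.cons_tail m, coeff_sum]
  simp only [coeff_tp, finSuccEquiv_coeff_coeff, Polynomial.coeff_X_pow]
  by_cases h : m 0 ≤ r
  · rw [Finset.sum_eq_single (⟨m 0, by omega⟩ : Fin (r+1))]
    · simp
    · intro b _ hb
      rw [if_neg, mul_zero]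
      intro h'
      exact hb (Fin.ext h'.symm)
    · simp
  · rw [Finset.sum_eq_zero]
    · by_contra h'
      rw [← Ne, Finsupp.cons_tail, ← mem_support_iff] at h'
      exact h (hr _ h')
    · intro b _
      rw [if_neg, mul_zero]
      have := b.2
      omega

lemma pderiv_zero_tp (A : MvPolynomial (Fin n) ℚ) (B : Polynomial ℚ) :
    pderiv 0 (tp A B) = tp A (Polynomial.derivative B) := by
  rw [tp_apply, tp_apply, Derivation.leibniz]
  have h1 : pderiv 0 (emb1 n A) = 0 := by
    rw [emb1]
    induction A using MvPolynomial.induction_on with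
    | C a => simp
    | add p q hp hq => rw [map_add, map_add, hp, hq, add_zero]
    | mul_X p i hp =>
      rw [map_mul, Derivation.leibniz, hp, rename_X, pderiv_X_of_ne (Fin.succ_ne_zero i).symm.symm]
      simp
  have h0 : pderiv 0 (emb0 n B) = emb0 n (Polynomial.derivative B) := by
    rw [emb0]
    induction B using Polynomial.induction_on' with
    | add p q hp hq => rw [map_add, map_add, hp, hq, Polynomial.derivative_add, map_add]
    | monomial k a =>
      rw [Polynomial.derivative_monomial, Polynomial.aeval_monomial, Polynomial.aeval_monomial,
        MvPolynomial.algebraMap_eq, pderiv_C_mul, pderiv_pow, pderiv_X_self]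
      simp; ring
  rw [h1, h0]; simp

lemma pderiv_succ_tp (i : Fin n) (A : MvPolynomial (Fin n) ℚ) (B : Polynomial ℚ) :
    pderiv i.succ (tp A B) = tp (pderiv i A) B := by
  rw [tp_apply, tp_apply, Derivation.leibniz]
  have h1 : pderiv i.succ (emb1 n A) = emb1 n (pderiv i A) := by
    rw [emb1, pderiv_rename (Fin.succ_injective n)]
  have h0 : pderiv i.succ (emb0 n B) = 0 := by
    rw [emb0]
    induction B using Polynomial.induction_on' with
    | add p q hp hq => rw [map_add, map_add, hp, hq, add_zero]
    | monomial k a =>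
      rw [Polynomial.aeval_monomial,
        MvPolynomial.algebraMap_eq, pderiv_C_mul, pderiv_pow, pderiv_X_of_ne (Fin.succ_ne_zero i).symm]
      simp
  rw [h1, h0]; simp [mul_comm]

/-- the derivation of `ℚ[X]` -/
def Dpoly : Unit → Derivation ℚ (Polynomial ℚ) (Polynomial ℚ) := fun _ => Polynomial.derivative'

lemma wd_append {ι R : Type*} [CommRing R] [Algebra ℚ R] (D : ι → Derivation ℚ R R) (w w' : List ι) (x : R) :
    wd D (w ++ w') x = wd D w (wd D w' x) := by
  rw [wd, wd, wd, List.foldr_append]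

lemma wd_add {ι R : Type*} [CommRing R] [Algebra ℚ R] (D : ι → Derivation ℚ R R) (w : List ι) (x y : R) :
    wd D w (x + y) = wd D w x + wd D w y := by
  induction w with
  | nil => rfl
  | cons i w ih => rw [wd, List.foldr_cons]; change D i (wd D w (x+y)) = D i (wd D w x) + D i (wd D w y)
                   rw [ih, map_add]

lemma wd_zero {ι R : Type*} [CommRing R] [Algebra ℚ R] (D : ι → Derivation ℚ R R) (w : List ι) :
    wd D w 0 = 0 := by
  induction w with
  | nil => rfl
  | cons i w ih => change D i (wd D w 0) = 0; rw [ih, map_zero]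

lemma wd_sum {ι R : Type*} [CommRing R] [Algebra ℚ R] (D : ι → Derivation ℚ R R) (w : List ι)
    {κ : Type*} (s : Finset κ) (f : κ → R) : wd D w (∑ k ∈ s, f k) = ∑ k ∈ s, wd D w (f k) := by
  classical
  induction s using Finset.induction_on with
  | empty => simp [wd_zero]
  | insert a s ha ih => rw [Finset.sum_insert ha, Finset.sum_insert ha, wd_add, ih]

/-- combine words -/
def cw (w : List (Fin n)) (σ : List Unit) : List (Fin (n+1)) :=
  w.map Fin.succ ++ σ.map (fun _ => 0)

lemma wd_tp (w : List (Fin n)) (σ : List Unit) (A : MvPolynomial (Fin n) ℚ) (B : Polynomial ℚ) :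
    wd pderiv (cw w σ) (tp A B) = tp (wd pderiv w A) (wd Dpoly σ B) := by
  rw [cw, wd_append]
  have h1 : wd pderiv (σ.map (fun _ => (0 : Fin (n+1)))) (tp A B) = tp A (wd Dpoly σ B) := by
    induction σ with
    | nil => rfl
    | cons i σ ih =>
      rw [List.map_cons, wd, List.foldr_cons]
      change pderiv 0 (wd pderiv (σ.map _) (tp A B)) = tp A (Polynomial.derivative' (wd Dpoly σ B))
      rw [ih, pderiv_zero_tp]; rfl
  rw [h1]
  induction w with
  | nil => rfl
  | cons i w ih =>
    rw [List.map_cons, wd, List.foldr_cons]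
    change pderiv i.succ (wd pderiv (w.map _) _) = tp (pderiv i (wd pderiv w A)) _
    rw [ih, pderiv_succ_tp]

lemma det_tp (k : ℕ) (A : Fin k → Fin k → MvPolynomial (Fin n) ℚ) (B : Fin k → Fin k → Polynomial ℚ) :
    (Matrix.of fun a b => ∑ j, tp (A a j) (B b j)).det
      = tp (Matrix.of A).det (Matrix.of B).det := by
  have : (Matrix.of fun a b => ∑ j, tp (A a j) (B b j))
      = (emb1 n).toRingHom.mapMatrix (Matrix.of A) * ((emb0 n).toRingHom.mapMatrix (Matrix.of B)).transpose := by
    ext1 a b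
    simp [Matrix.mul_apply, tp_apply]
  rw [this, Matrix.det_mul, Matrix.det_transpose, ← RingHom.map_det, ← RingHom.map_det, tp_apply]
  rfl
end TP
end SubsThm
end


set_option linter.unusedSectionVars false

noncomputable section

namespace SubsThm
open MvPolynomial

section Taylor
variable {σ : Type*} 

/-- translation -/
def tay (ξ : σ → ℚ) : MvPolynomial σ ℚ →ₐ[ℚ] MvPolynomial σ ℚ := aeval fun h => X h + C (ξ h)

lemma tay_pderiv (ξ : σ → ℚ) (i : σ) (p : MvPolynomial σ ℚ) :
    tay ξ (pderiv i p) = pderiv i (tay ξ p) := by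
  classical
  induction p using MvPolynomial.induction_on with
  | C a => simp [tay]
  | add p q hp hq => simp only [map_add, hp, hq]
  | mul_X p j hp =>
    have e : tay ξ (X j) = X j + C (ξ j) := by simp [tay]
    rw [Derivation.leibniz, map_add, map_mul, Derivation.leibniz, smul_eq_mul, smul_eq_mul, map_mul,
      map_mul, hp, e, map_add, pderiv_C, add_zero, smul_eq_mul, smul_eq_mul]
    congr 2
    rw [pderiv_X]
    by_cases h : j = i
    · subst h; simp
    · simp [h]

lemma tay_wd (ξ : σ → ℚ) (w : List σ) (p : MvPolynomial σ ℚ) :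
    tay ξ (wd pderiv w p) = wd pderiv w (tay ξ p) := by
  induction w with
  | nil => rfl
  | cons i w ih =>
    change tay ξ (pderiv i (wd pderiv w p)) = pderiv i (wd pderiv w (tay ξ p))
    rw [tay_pderiv, ih]

lemma tay_tp {n : ℕ} (ξ : Fin (n+1) → ℚ) (A : MvPolynomial (Fin n) ℚ) (B : Polynomial ℚ) :
    tay ξ (tp A B) = tp (tay (fun h => ξ h.succ) A) (B.comp (Polynomial.X + Polynomial.C (ξ 0))) := by
  rw [tp_apply, tp_apply, map_mul]
  congr 1
  · rw [emb1, tay, aeval_rename]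
    have : ((rename Fin.succ : MvPolynomial (Fin n) ℚ →ₐ[ℚ] MvPolynomial (Fin (n+1)) ℚ).comp (tay (fun h => ξ h.succ)))
       = aeval (fun h : Fin n => (X h.succ + C (ξ h.succ) : MvPolynomial (Fin (n+1)) ℚ)) := by
      apply MvPolynomial.algHom_ext
      intro i
      simp [tay]
    exact (congrArg (fun f => f A) this).symm
  · rw [emb0, Polynomial.aeval_comp]
    rw [← Polynomial.aeval_algHom_apply]
    congr 2
    simp [tay, MvPolynomial.algebraMap_eq]

variable [Fintype σ]

/-- the weighted order of vanishing at the origin is at least `t` -/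
def idxGE (r : σ → ℕ) (p : MvPolynomial σ ℚ) (t : ℝ) : Prop :=
  ∀ e ∈ p.support, t ≤ ∑ h, (e h : ℝ) / r h

lemma idxGE.mono {r : σ → ℕ} {p : MvPolynomial σ ℚ} {t s : ℝ} (h : idxGE r p t) (hs : s ≤ t) :
    idxGE r p s := fun e he => hs.trans (h e he)

lemma idxGE_zero_le (r : σ → ℕ) (p : MvPolynomial σ ℚ) : idxGE r p 0 := fun e _ => by positivity

lemma idxGE_mul {r : σ → ℕ} {p q : MvPolynomial σ ℚ} {s t : ℝ} (hp : idxGE r p s) (hq : idxGE r q t) :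
    idxGE r (p * q) (s + t) := by
  classical
  intro e he
  obtain ⟨a, ha, b, hb, rfl⟩ := Finset.mem_add.1 (support_mul p q he)
  have := add_le_add (hp a ha) (hq b hb)
  rw [← Finset.sum_add_distrib] at this
  refine this.trans (le_of_eq (Finset.sum_congr rfl fun h _ => ?_))
  simp; ring

lemma idxGE_sum {r : σ → ℕ} {κ : Type*} (S : Finset κ) (f : κ → MvPolynomial σ ℚ) {t : ℝ}
    (h : ∀ k ∈ S, idxGE r (f k) t) : idxGE r (∑ k ∈ S, f k) t := by
  classical
  intro e he
  rw [mem_support_iff, coeff_sum] at he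
  obtain ⟨k, hk, hk'⟩ := Finset.exists_ne_zero_of_sum_ne_zero he
  exact h k hk e (mem_support_iff.2 hk')

lemma idxGE_prod {r : σ → ℕ} {κ : Type*} (S : Finset κ) (f : κ → MvPolynomial σ ℚ) (t : κ → ℝ)
    (h : ∀ k ∈ S, idxGE r (f k) (t k)) : idxGE r (∏ k ∈ S, f k) (∑ k ∈ S, t k) := by
  classical
  induction S using Finset.induction_on with
  | empty => simpa using idxGE_zero_le r 1
  | insert a s ha ih =>
    rw [Finset.prod_insert ha, Finset.sum_insert ha]
    exact idxGE_mul (h a (Finset.mem_insert_self _ _)) (ih fun k hk => h k (Finset.mem_insert_of_mem hk))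

lemma idxGE_det {r : σ → ℕ} {k : ℕ} (M : Matrix (Fin k) (Fin k) (MvPolynomial σ ℚ)) (t : Fin k → ℝ)
    (h : ∀ a b, idxGE r (M a b) (t b)) : idxGE r M.det (∑ b, t b) := by
  rw [Matrix.det_apply']
  apply idxGE_sum
  intro s _
  rw [← zero_add (∑ b, t b)]
  exact idxGE_mul (idxGE_zero_le _ _) (idxGE_prod _ _ _ fun b _ => h _ _)

lemma idxGE_pderiv {r : σ → ℕ} {p : MvPolynomial σ ℚ} {t : ℝ} (i : σ) (hp : idxGE r p t) :
    idxGE r (pderiv i p) (t - 1 / r i) := by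
  classical
  intro e he
  rw [mem_support_iff, coeff_pderiv] at he
  have := hp _ (mem_support_iff.2 (left_ne_zero_of_mul he))
  have e2 : ∑ h, (((e + Finsupp.single i 1 : σ →₀ ℕ) h : ℕ) : ℝ) / r h = ∑ h, (e h : ℝ) / r h + 1 / r i := by
    have : ∀ h, (((e + Finsupp.single i 1 : σ →₀ ℕ) h : ℕ) : ℝ) / r h = (e h : ℝ) / r h + if i = h then (1:ℝ) / r i else 0 := by
      intro h
      rw [Finsupp.add_apply, Finsupp.single_apply]
      split_ifs with hh
      · subst hh; push_cast; ring
      · simp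
    rw [Finset.sum_congr rfl fun h _ => this h, Finset.sum_add_distrib]
    simp
  linarith

lemma idxGE_wd {r : σ → ℕ} {p : MvPolynomial σ ℚ} {t : ℝ} (w : List σ) (hp : idxGE r p t) :
    idxGE r (wd pderiv w p) (t - (w.map fun i => 1 / (r i : ℝ)).sum) := by
  induction w with
  | nil => simpa [wd] using hp
  | cons i w ih =>
    rw [List.map_cons, List.sum_cons]
    refine (idxGE_pderiv i ih).mono ?_
    linarith
end Taylor

section Hasse
variable {σ : Type*} [Fintype σ] [DecidableEq σ]

/-- the exponent of a word -/
def wcnt (w : List σ) : σ →₀ ℕ := Finsupp.equivFunOnFinite.symm fun i => w.count i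

lemma wcnt_apply (w : List σ) (i : σ) : wcnt w i = w.count i := rfl

/-- Hasse derivative -/
def hD (τ : σ →₀ ℕ) (P : MvPolynomial σ ℤ) : MvPolynomial σ ℤ :=
  ∑ e ∈ P.support, monomial (e - τ) (P.coeff e * ∏ i, ((e i).choose (τ i) : ℤ))

lemma wd_monomial (w : List σ) (e : σ →₀ ℕ) (c : ℚ) :
    wd pderiv w (monomial e c) = monomial (e - wcnt w) (c * ∏ i, ((e i).descFactorial (wcnt w i) : ℚ)) := by
  induction w with
  | nil =>
    have : wcnt ([] : List σ) = 0 := by ext; simp [wcnt_apply]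
    simp [wd, this]
  | cons j w ih =>
    change pderiv j (wd pderiv w (monomial e c)) = _
    rw [ih, pderiv_monomial]
    have h1 : wcnt (j :: w) = wcnt w + Finsupp.single j 1 := by
      ext i
      rw [Finsupp.add_apply, wcnt_apply, wcnt_apply, List.count_cons, Finsupp.single_apply]
      simp
    congr 1
    · rw [h1, tsub_add_eq_tsub_tsub]
    · rw [mul_assoc]; congr 1
      rw [← Finset.mul_prod_erase _ _ (Finset.mem_univ j), ← Finset.mul_prod_erase _ (fun i => ((e i).descFactorial (wcnt (j :: w) i) : ℚ)) (Finset.mem_univ j)]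
      have h2 : ∏ x ∈ Finset.univ.erase j, ((e x).descFactorial (wcnt (j :: w) x) : ℚ)
         = ∏ x ∈ Finset.univ.erase j, ((e x).descFactorial (wcnt w x) : ℚ) := by
        apply Finset.prod_congr rfl
        intro x hx
        rw [h1, Finsupp.add_apply, Finsupp.single_eq_of_ne (Finset.ne_of_mem_erase hx), add_zero]
      rw [h2, h1, Finsupp.add_apply, Finsupp.single_eq_same, Nat.descFactorial_succ]
      push_cast
      rw [Pi.sub_apply]; push_cast; ring

/-- factorial of a word -/
def wfac (w : List σ) : ℚ := ∏ i, ((w.count i).factorial : ℚ)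

lemma wfac_ne_zero (w : List σ) : wfac w ≠ 0 :=
  Finset.prod_ne_zero_iff.2 fun i _ => by exact_mod_cast (Nat.factorial_ne_zero _)

lemma wd_eq_hD (w : List σ) (P : MvPolynomial σ ℤ) :
    wd pderiv w (map (Int.castRingHom ℚ) P) = wfac w • map (Int.castRingHom ℚ) (hD (wcnt w) P) := by
  conv_lhs => rw [P.as_sum]
  rw [map_sum, wd_sum, hD, map_sum, Finset.smul_sum]
  apply Finset.sum_congr rfl
  intro e _
  rw [map_monomial, wd_monomial, map_monomial, smul_monomial]
  congr 1
  simp only [map_mul, map_prod, smul_eq_mul, wfac]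
  rw [mul_left_comm, ← Finset.prod_mul_distrib]
  congr 1
  apply Finset.prod_congr rfl
  intro i _
  rw [Nat.descFactorial_eq_factorial_mul_choose]
  simp [wcnt_apply]

/-- degree bound in each variable -/
def degLE {R : Type*} [CommSemiring R] (r : σ → ℕ) (P : MvPolynomial σ R) : Prop := ∀ e ∈ P.support, ∀ h, e h ≤ r h

lemma degLE_sum {R : Type*} [CommSemiring R] {r : σ → ℕ} {κ : Type*} (S : Finset κ) (f : κ → MvPolynomial σ R)
    (h : ∀ k ∈ S, degLE r (f k)) : degLE r (∑ k ∈ S, f k) := by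
  intro e he
  rw [mem_support_iff, coeff_sum] at he
  obtain ⟨k, hk, hk'⟩ := Finset.exists_ne_zero_of_sum_ne_zero he
  exact h k hk e (mem_support_iff.2 hk')

lemma degLE_mul {R : Type*} [CommSemiring R] {r s : σ → ℕ} {p q : MvPolynomial σ R} (hp : degLE r p) (hq : degLE s q) :
    degLE (r + s) (p * q) := by
  intro e he h
  obtain ⟨a, ha, b, hb, rfl⟩ := Finset.mem_add.1 (support_mul p q he)
  exact add_le_add (hp a ha h) (hq b hb h)

lemma degLE_C {R : Type*} [CommSemiring R] (r : σ → ℕ) (c : R) : degLE r (C c : MvPolynomial σ R) := by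
  intro e he h
  rw [mem_support_iff, coeff_C] at he
  have : e = 0 := by by_contra h; exact he (if_neg (Ne.symm h))
  simp [this]

lemma degLE_prod {R : Type*} [CommSemiring R] {r : σ → ℕ} {κ : Type*} (S : Finset κ) (f : κ → MvPolynomial σ R)
    (h : ∀ k ∈ S, degLE r (f k)) : degLE (fun h => S.card * r h) (∏ k ∈ S, f k) := by
  classical
  induction S using Finset.induction_on with
  | empty => rw [Finset.prod_empty, ← C_1]; exact degLE_C _ 1
  | insert a s ha ih =>
    rw [Finset.prod_insert ha, Finset.card_insert_of_notMem ha]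
    intro e he i
    have := degLE_mul (h a (Finset.mem_insert_self _ _)) (ih fun k hk => h k (Finset.mem_insert_of_mem hk)) e he i
    rw [Pi.add_apply] at this
    linarith

lemma degLE_det {r : σ → ℕ} {k : ℕ} (M : Matrix (Fin k) (Fin k) (MvPolynomial σ ℤ))
    (h : ∀ a b, degLE r (M a b)) : degLE (fun h => k * r h) M.det := by
  rw [Matrix.det_apply']
  apply degLE_sum
  intro s _ e he i
  have h1 := degLE_mul (r := 0) (s := fun h => k * r h) (p := C (((Equiv.Perm.sign s : ℤˣ) : ℤ))) (degLE_C 0 _)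
    (by simpa using degLE_prod Finset.univ (fun i => M (s i) i) fun i _ => h _ _)
  have := h1 e (by simpa using he) i
  simpa using this

lemma nrm_det {k : ℕ} (M : Matrix (Fin k) (Fin k) (MvPolynomial σ ℤ)) (B : ℝ)
    (h : ∀ a b, nrm (fun _ => 1) (M a b) ≤ B) : nrm (fun _ => 1) M.det ≤ k.factorial * B ^ k := by
  have h1 : ∀ i : σ, (0:ℝ) ≤ (fun _ => 1) i := fun _ => zero_le_one
  rw [Matrix.det_apply']
  refine (nrm_sum_le h1 _ _).trans ?_
  have : ∀ s ∈ (Finset.univ : Finset (Equiv.Perm (Fin k))),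
      nrm (fun _ => 1) (((Equiv.Perm.sign s : ℤˣ) : ℤ) * ∏ i, M (s i) i : MvPolynomial σ ℤ) ≤ B ^ k := by
    intro s _
    have h2 : nrm (fun _ => 1) (∏ i, M (s i) i : MvPolynomial σ ℤ) ≤ B ^ k := by
      refine (nrm_prod_le h1 _ _).trans ?_
      calc _ ≤ ∏ i : Fin k, B := Finset.prod_le_prod (fun i _ => nrm_nonneg h1 _) fun i _ => h _ _
        _ = B ^ k := by simp
    rcases Int.units_eq_one_or (Equiv.Perm.sign s) with h | h
    · rw [h]; simpa using h2
    · rw [h]; simpa [nrm_neg] using h2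
  refine (Finset.sum_le_card_nsmul _ _ _ this).trans ?_
  simp [Fintype.card_perm]

lemma degLE_hD {r : σ → ℕ} (τ : σ →₀ ℕ) {P : MvPolynomial σ ℤ} (h : degLE r P) : degLE r (hD τ P) := by
  apply degLE_sum
  intro e he f hf i
  have := Finset.mem_singleton.1 (support_monomial_subset hf)
  rw [this, Finsupp.tsub_apply]
  exact (Nat.sub_le _ _).trans (h e he i)

lemma nrm_hD {r : σ → ℕ} {E : ℕ} (hr : ∀ h, r h ≤ E) (τ : σ →₀ ℕ) {P : MvPolynomial σ ℤ} (h : degLE r P) :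
    nrm (fun _ => 1) (hD τ P) ≤ 2 ^ (Fintype.card σ * E) * nrm (fun _ => 1) P := by
  have h1 : ∀ i : σ, (0:ℝ) ≤ (fun _ => 1) i := fun _ => zero_le_one
  refine (nrm_sum_le h1 _ _).trans ?_
  rw [nrm, Finset.mul_sum]
  apply Finset.sum_le_sum
  intro e he
  rw [nrm_monomial, wt_one, wt_one, mul_one, mul_one, norm_mul, mul_comm]
  apply mul_le_mul_of_nonneg_right _ (norm_nonneg _)
  rw [pow_mul', ← Finset.card_univ, ← Finset.prod_const]
  rw [Int.norm_eq_abs]; push_cast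
  rw [Finset.abs_prod]
  apply Finset.prod_le_prod (fun i _ => abs_nonneg _)
  intro i _
  rw [Nat.abs_cast]
  calc (((e i).choose (τ i) : ℕ) : ℝ) ≤ ((2 ^ (e i) : ℕ) : ℝ) := by exact_mod_cast Nat.choose_le_two_pow _ _
    _ = 2 ^ (e i) := by push_cast; rfl
    _ ≤ 2 ^ E := pow_le_pow_right₀ (by norm_num) ((h e he i).trans (hr i))
end Hasse
end SubsThm
end


set_option linter.unusedSectionVars false

noncomputable section

namespace SubsThm
open MvPolynomial

lemma idxGE_smul {σ : Type*} [Fintype σ] {r : σ → ℕ} {p : MvPolynomial σ ℚ} {t : ℝ} (c : ℚ) (h : idxGE r p t) :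
    idxGE r (c • p) t := fun e he => h e (support_smul he)

lemma wfac_cw {n : ℕ} (w : List (Fin n)) (s : List Unit) :
    wfac (cw w s) = wfac w * (s.length.factorial : ℚ) := by
  rw [wfac, Fin.prod_univ_succ, mul_comm, wfac]
  congr 1
  · apply Finset.prod_congr rfl
    intro i _
    congr 2
    rw [cw, List.count_append, List.count_map_of_injective _ _ (Fin.succ_injective n)]
    rw [Nat.add_eq_left, List.count_eq_zero]
    simp [Fin.succ_ne_zero]
  · congr 2
    rw [cw, List.count_append]
    have h1 : List.count 0 (List.map Fin.succ w) = 0 := by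
      rw [List.count_eq_zero]; simp [Fin.succ_ne_zero]
    rw [h1, zero_add]
    simp

lemma rescale_det {n k : ℕ} (f g : Fin k → ℚ) (M : Matrix (Fin k) (Fin k) (MvPolynomial (Fin n) ℚ)) :
    (Matrix.of fun a b => (f a * g b) • M a b).det = ((∏ a, f a) * ∏ b, g b) • M.det := by
  have h1 : (Matrix.of fun a b => (f a * g b) • M a b)
      = Matrix.of fun a b => C (f a) * ((Matrix.of fun a b => C (g b) * M a b) a b) := by
    ext1 a b
    simp only [Matrix.of_apply, smul_eq_C_mul, C_mul]; ring
  rw [h1, Matrix.det_mul_column, Matrix.det_mul_row, smul_eq_C_mul, C_mul, map_prod, map_prod]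
  ring

theorem wronskian {n : ℕ} (P : MvPolynomial (Fin (n+1)) ℤ) (hP : P ≠ 0) (r : Fin (n+1) → ℕ) (E : ℕ)
    (hdeg : degLE r P) (hr0 : ∀ h, 0 < r h) (hE : ∀ h, r h ≤ E) :
    ∃ (k : ℕ) (W : MvPolynomial (Fin (n+1)) ℤ) (U : MvPolynomial (Fin n) ℚ) (V : Polynomial ℚ),
      0 < k ∧ k ≤ r 0 + 1 ∧ U ≠ 0 ∧ V ≠ 0 ∧ map (Int.castRingHom ℚ) W = tp U V ∧
      degLE (fun h => k * r h) W ∧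
      nrm (fun _ => 1) W ≤ (2 ^ ((n + 2) * E) * nrm (fun _ => 1) P) ^ k ∧
      ∀ (ξ : Fin (n+1) → ℚ) (t δ : ℝ), 0 ≤ δ → (∀ h : Fin n, (r 0 : ℝ) ≤ δ * r h.succ) →
        idxGE r (tay ξ (map (Int.castRingHom ℚ) P)) t →
        idxGE r (tay ξ (map (Int.castRingHom ℚ) W)) (∑ b : Fin k, max 0 (t - δ - (b : ℕ) / r 0)) := by
  classical
  set PQ := map (Int.castRingHom ℚ) P with hPQ
  have hPQ0 : PQ ≠ 0 := by
    rw [hPQ, Ne, map_eq_zero_iff _ (map_injective _ Int.cast_injective)]; exact hP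
  obtain ⟨φ0, ψ0, h0⟩ := tp_decomp PQ (r 0) (fun e he => hdeg e (support_map_subset _ _ he) 0)
  obtain ⟨k, hk, φ, ψ, hdec, hφ, hψ⟩ := min_tensor tp PQ _ φ0 ψ0 h0
  have hkpos : 0 < k := by
    rcases Nat.eq_zero_or_pos k with h | h
    · subst h; simp at hdec; exact absurd hdec hPQ0
    · exact h
  obtain ⟨w, hw, hdA⟩ := gw pderiv H_mv k φ hφ
  obtain ⟨s, hs, hdB⟩ := gw Dpoly (fun u v hu h => H_poly u v hu (h ())) k ψ hψ
  set W : MvPolynomial (Fin (n+1)) ℤ := (Matrix.of fun a b => hD (wcnt (cw (w a) (s b))) P).det with hW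
  set c : ℚ := (∏ a, wfac (w a)) * ∏ b, ((s b).length.factorial : ℚ) with hc
  have hc0 : c ≠ 0 := by
    refine mul_ne_zero (Finset.prod_ne_zero_iff.2 fun a _ => wfac_ne_zero _)
      (Finset.prod_ne_zero_iff.2 fun b _ => ?_)
    exact_mod_cast Nat.factorial_ne_zero _
  have hmapW : map (Int.castRingHom ℚ) W
      = (Matrix.of fun a b => map (Int.castRingHom ℚ) (hD (wcnt (cw (w a) (s b))) P)).det := by
    rw [hW, RingHom.map_det]; rfl
  have hprod : c • map (Int.castRingHom ℚ) W = tp (Matrix.of fun a j => wd pderiv (w a) (φ j)).det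
      (Matrix.of fun a j => wd Dpoly (s a) (ψ j)).det := by
    rw [hmapW, hc, ← rescale_det]
    rw [← det_tp]
    congr 1
    ext1 a b
    simp only [Matrix.of_apply]
    rw [← wfac_cw, ← wd_eq_hD, ← hPQ]
    conv_lhs => rw [hdec]
    rw [wd_sum]
    exact Finset.sum_congr rfl fun j _ => wd_tp _ _ _ _
  have h1 : ∀ i : Fin (n+1), (0:ℝ) ≤ (fun _ => 1) i := fun _ => zero_le_one
  refine ⟨k, W, c⁻¹ • (Matrix.of fun a j => wd pderiv (w a) (φ j)).det, _, hkpos, hk,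
    smul_ne_zero (inv_ne_zero hc0) hdA, hdB, ?_, degLE_det _ fun a b => degLE_hD _ hdeg, ?_, ?_⟩
  · rw [map_smul, LinearMap.smul_apply, ← hprod, smul_smul, inv_mul_cancel₀ hc0, one_smul]
  · refine (nrm_det _ (2 ^ ((n+1) * E) * nrm (fun _ => 1) P) fun a b => ?_).trans ?_
    · simpa using nrm_hD hE (wcnt (cw (w a) (s b))) hdeg
    · have hk2 : (k.factorial : ℝ) ≤ (2 ^ E) ^ k := by
        have h2 : k ≤ 2 ^ E := by
          have := hE 0
          have h3 : E < 2 ^ E := Nat.lt_two_pow_self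
          omega
        calc (k.factorial : ℝ) ≤ ((k ^ k : ℕ) : ℝ) := by exact_mod_cast Nat.factorial_le_pow k
          _ ≤ (((2 ^ E) ^ k : ℕ) : ℝ) := by exact_mod_cast Nat.pow_le_pow_left h2 k
          _ = _ := by push_cast; rfl
      have h3 : (2:ℝ) ^ ((n+2) * E) = 2 ^ E * 2 ^ ((n+1) * E) := by rw [← pow_add]; congr 1; ring
      rw [h3, mul_assoc, mul_pow (2 ^ E)]
      have := nrm_nonneg h1 P
      exact mul_le_mul_of_nonneg_right hk2 (by positivity)
  · intro ξ t δ hδ hδr ht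
    rw [hmapW, AlgHom.map_det]
    apply idxGE_det
    intro a b
    simp only [AlgHom.mapMatrix_apply, Matrix.map_apply, Matrix.of_apply]
    rcases max_cases (0:ℝ) (t - δ - (b : ℕ) / r 0) with h | h
    · rw [h.1]; exact idxGE_zero_le _ _
    · rw [h.1]
      have e1 : map (Int.castRingHom ℚ) (hD (wcnt (cw (w a) (s b))) P) = (wfac (cw (w a) (s b)))⁻¹ •
          wd pderiv (cw (w a) (s b)) PQ := by
        rw [hPQ, wd_eq_hD, smul_smul, inv_mul_cancel₀ (wfac_ne_zero _), one_smul]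
      rw [e1, map_smul, tay_wd]
      apply idxGE_smul
      refine (idxGE_wd _ ht).mono ?_
      rw [cw, List.map_append, List.sum_append, List.map_map, List.map_map]
      have hr : (0:ℝ) < r 0 := by exact_mod_cast hr0 0
      have e2 : (List.map ((fun i => 1 / (r i : ℝ)) ∘ Fin.succ) (w a)).sum ≤ δ := by
        have : ∀ x ∈ (List.map ((fun i => 1 / (r i : ℝ)) ∘ Fin.succ) (w a)), x ≤ δ / r 0 := by
          intro x hx
          obtain ⟨i, _, rfl⟩ := List.mem_map.1 hx
          have : (0:ℝ) < r i.succ := by exact_mod_cast hr0 _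
          simp only [Function.comp]
          rw [div_le_div_iff₀ this hr]
          linarith [hδr i]
        have := List.sum_le_card_nsmul _ _ this
        refine this.trans ?_
        rw [List.length_map, nsmul_eq_mul]
        have hl : ((w a).length : ℝ) ≤ r 0 := by
          have := hw a; have := a.2
          have : (w a).length ≤ r 0 := by omega
          exact_mod_cast this
        calc ((w a).length : ℝ) * (δ / r 0) ≤ r 0 * (δ / r 0) := by
              apply mul_le_mul_of_nonneg_right hl; positivity
          _ = δ := by field_simp
      have e3 : (List.map ((fun i => 1 / (r i : ℝ)) ∘ fun _ : Unit => (0 : Fin (n+1))) (s b)).sum ≤ (b : ℕ) / r 0 := by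
        have : (List.map ((fun i => 1 / (r i : ℝ)) ∘ fun _ : Unit => (0 : Fin (n+1))) (s b)).sum
            = (s b).length * (1 / (r 0 : ℝ)) := by
          rw [show ((fun i => 1 / (r i : ℝ)) ∘ fun _ : Unit => (0 : Fin (n+1))) = fun _ => 1 / (r 0 : ℝ) from rfl,
            List.map_const', List.sum_replicate, nsmul_eq_mul]
        rw [this, mul_one_div]
        have := hs b
        gcongr
      linarith

theorem extract1 {n : ℕ} (W : MvPolynomial (Fin (n+1)) ℤ) (U : MvPolynomial (Fin n) ℚ) (V : Polynomial ℚ)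
    (hU : U ≠ 0) (hV : V ≠ 0) (h : map (Int.castRingHom ℚ) W = tp U V) :
    ∃ (U' : MvPolynomial (Fin n) ℤ) (c : ℚ), c ≠ 0 ∧ map (Int.castRingHom ℚ) U' = c • U ∧
      (∀ r : Fin (n+1) → ℕ, degLE r W → degLE (fun h => r h.succ) U') ∧
      nrm (fun _ => 1) U' ≤ nrm (fun _ => 1) W := by
  classical
  set i := V.natDegree
  have hc : V.coeff i ≠ 0 := by simpa [i] using hV
  set U' := (finSuccEquiv ℤ n W).coeff i with hU'
  have hco : ∀ e, U'.coeff e = W.coeff (e.cons i) := fun e => finSuccEquiv_coeff_coeff _ _ _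
  refine ⟨U', V.coeff i, hc, ?_, ?_, ?_⟩
  · ext e
    rw [coeff_map, hco, ← coeff_map, h, coeff_tp, coeff_smul, smul_eq_mul, mul_comm]
  · intro r hr e he j
    rw [mem_support_iff, hco] at he
    have := hr _ (mem_support_iff.2 he) j.succ
    simpa using this
  · rw [nrm, nrm]
    have hinj : Function.Injective (fun e : Fin n →₀ ℕ => e.cons i) := Finsupp.cons_right_injective i
    calc _ = ∑ e ∈ U'.support.image (fun e : Fin n →₀ ℕ => e.cons i), ‖W.coeff e‖ * wt (fun _ => 1) e := by
          rw [Finset.sum_image (fun _ _ _ _ h => hinj h)]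
          exact Finset.sum_congr rfl fun e _ => by rw [hco, wt_one, wt_one]
      _ ≤ _ := by
          apply Finset.sum_le_sum_of_subset_of_nonneg
          · intro f hf
            obtain ⟨e, he, rfl⟩ := Finset.mem_image.1 hf
            rw [mem_support_iff, hco] at he
            exact mem_support_iff.2 he
          · intro e _ _
            rw [wt_one]; positivity

theorem extract0 {n : ℕ} (W : MvPolynomial (Fin (n+1)) ℤ) (U : MvPolynomial (Fin n) ℚ) (V : Polynomial ℚ)
    (hU : U ≠ 0) (hV : V ≠ 0) (h : map (Int.castRingHom ℚ) W = tp U V) :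
    ∃ (V' : Polynomial ℤ) (c : ℚ), c ≠ 0 ∧ V'.map (Int.castRingHom ℚ) = c • V ∧
      ∀ i, |(V'.coeff i : ℝ)| ≤ nrm (fun _ => 1) W := by
  classical
  obtain ⟨e, he⟩ := ne_zero_iff.1 hU
  set V' : Polynomial ℤ := ∑ i ∈ Finset.range (V.natDegree + 1), Polynomial.monomial i (W.coeff (e.cons i))
  have hco : ∀ i, V'.coeff i = if i ≤ V.natDegree then W.coeff (e.cons i) else 0 := by
    intro i
    simp [V', Polynomial.finset_sum_coeff, Polynomial.coeff_monomial, Nat.lt_succ_iff]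
  have hW : ∀ i, ((W.coeff (e.cons i) : ℤ) : ℚ) = U.coeff e * V.coeff i := by
    intro i
    rw [← coeff_tp, ← h, coeff_map]; simp
  refine ⟨V', U.coeff e, he, ?_, ?_⟩
  · ext i
    rw [Polynomial.coeff_map, hco, Polynomial.coeff_smul, smul_eq_mul]
    split_ifs with hi
    · exact hW i
    · rw [Polynomial.coeff_eq_zero_of_natDegree_lt (by omega)]; simp
  · intro i
    have h1 : ∀ i : Fin (n+1), (0:ℝ) ≤ (fun _ => 1) i := fun _ => zero_le_one
    rw [hco]
    split_ifs with hi
    · have := coeff_le_nrm h1 W (e.cons i)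
      rwa [wt_one, mul_one, Int.norm_eq_abs] at this
    · simpa using nrm_nonneg h1 W

lemma one_le_nrm {σ : Type*} (P : MvPolynomial σ ℤ) (hP : P ≠ 0) : 1 ≤ nrm (fun _ => 1) P := by
  obtain ⟨e, he⟩ := ne_zero_iff.1 hP
  have := coeff_le_nrm (w := fun _ => 1) (fun _ => zero_le_one) P e
  rw [wt_one, mul_one, Int.norm_eq_abs] at this
  refine le_trans ?_ this
  exact_mod_cast Int.one_le_abs he

lemma sum_max_bound (t : ℝ) (ht0 : 0 < t) (ht1 : t ≤ 1) (k r : ℕ) (hr : 0 < r) (hkr : k ≤ r + 1) :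
    t ^ 2 * k / 8 ≤ ∑ b : Fin k, max 0 (t - (b : ℕ) / r) := by
  rw [Fin.sum_univ_eq_sum_range (fun b => max 0 (t - (b : ℕ) / (r:ℝ))) k]
  have hr' : (0:ℝ) < r := by exact_mod_cast hr
  set m := min k (⌊r * t / 2⌋₊ + 1)
  have hsub : Finset.range m ⊆ Finset.range k := Finset.range_subset_range.2 (min_le_left _ _)
  have h1 : (m : ℝ) * (t / 2) ≤ ∑ b ∈ Finset.range m, max 0 (t - (b : ℕ) / (r:ℝ)) := by
    rw [← nsmul_eq_mul]
    have := Finset.card_nsmul_le_sum (Finset.range m) (fun b : ℕ => max 0 (t - (b : ℕ) / (r:ℝ))) (t / 2) ?_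
    · simpa using this
    · intro b hb
      refine le_trans ?_ (le_max_right _ _)
      have hb' : b ≤ ⌊r * t / 2⌋₊ := by
        have := Finset.mem_range.1 hb
        have h2 : m ≤ ⌊r * t / 2⌋₊ + 1 := min_le_right _ _
        omega
      have h3 : (b:ℝ) ≤ r * t / 2 := (Nat.le_floor_iff (by positivity)).1 hb'
      have : (b:ℝ) / r ≤ t / 2 := by rw [div_le_iff₀ hr']; linarith
      linarith
  have h2 : (k:ℝ) * t / 4 ≤ m := by
    have hk' : (k:ℝ) ≤ 2 * r := by exact_mod_cast (by omega : k ≤ 2 * r)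
    rcases min_cases k (⌊r * t / 2⌋₊ + 1) with h | h
    · change _ ≤ ((min k (⌊r * t / 2⌋₊ + 1) : ℕ) : ℝ)
      rw [h.1]; nlinarith [Nat.cast_nonneg (α := ℝ) k]
    · change _ ≤ ((min k (⌊r * t / 2⌋₊ + 1) : ℕ) : ℝ)
      rw [h.1]
      have := Nat.lt_floor_add_one (r * t / 2)
      push_cast
      nlinarith
  have h3 := Finset.sum_le_sum_of_subset_of_nonneg (f := fun b : ℕ => max 0 (t - (b : ℕ) / (r:ℝ))) hsub
    (fun _ _ _ => le_max_left _ _)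
  nlinarith

end SubsThm
end


set_option linter.unusedSectionVars false

noncomputable section

namespace SubsThm
open MvPolynomial

/-- logarithmic height -/
def lH (u v : ℤ) : ℝ := Real.log ((max |u| |v| : ℤ) : ℝ)

theorem roth (n : ℕ) : ∀ ε : ℝ, 0 < ε → ∃ ω : ℝ, 0 < ω ∧ ∀ (r : Fin n → ℕ) (E : ℕ) (u v : Fin n → ℤ)
    (P : MvPolynomial (Fin n) ℤ), (∀ h, 0 < r h) → (∀ h, r h ≤ E) →
    (∀ i j, i < j → (r i : ℝ) ≤ ω * r j) → (∀ h, IsCoprime (u h) (v h)) → (∀ h, v h ≠ 0) →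
    P ≠ 0 → degLE r P →
    (∀ h, Real.log (nrm (fun _ => 1) P) + E ≤ ω * r h * lH (u h) (v h)) →
    ¬ idxGE r (tay (fun h => (u h / v h : ℚ)) (map (Int.castRingHom ℚ) P)) ε := by
  induction n with
  | zero =>
    intro ε hε
    refine ⟨1, one_pos, ?_⟩
    intro r E u v P _ _ _ _ _ hP _ _ hidx
    set Q := tay (fun h => (u h / v h : ℚ)) (map (Int.castRingHom ℚ) P) with hQ
    have hQ0 : Q ≠ 0 := by
      have : tay (fun h : Fin 0 => (u h / v h : ℚ)) = AlgHom.id ℚ _ := by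
        apply MvPolynomial.algHom_ext
        intro i; exact i.elim0
      rw [hQ, this, AlgHom.id_apply, Ne, map_eq_zero_iff _ (map_injective _ Int.cast_injective)]; exact hP
    obtain ⟨e, he⟩ := ne_zero_iff.1 hQ0
    have := hidx e (mem_support_iff.2 he)
    simp at this
    linarith
  | succ n ih =>
    intro ε hε
    set ε0 := min ε 1 with hε0
    have hε0p : 0 < ε0 := lt_min hε one_pos
    have hε01 : ε0 ≤ 1 := min_le_right _ _
    set ε' := ε0 ^ 2 / 64 with hε'
    have hε'p : 0 < ε' := by positivity
    obtain ⟨ω', hω', IH⟩ := ih ε' hε'p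
    set N : ℝ := (n : ℝ) + 3 with hN
    have hNp : 0 < N := by positivity
    set ω := min (ω' / N) (min (ε0 / 2) (ε' / (2 * N))) with hω
    have hωp : 0 < ω := by apply lt_min; positivity; apply lt_min <;> positivity
    have hω1 : N * ω ≤ ω' := by
      have : ω ≤ ω' / N := min_le_left _ _
      rw [le_div_iff₀ hNp] at this; linarith
    have hω2 : ω ≤ ε0 / 2 := (min_le_right _ _).trans (min_le_left _ _)
    have hω3 : N * ω ≤ ε' / 2 := by
      have : ω ≤ ε' / (2 * N) := (min_le_right _ _).trans (min_le_right _ _)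
      rw [le_div_iff₀ (by positivity)] at this; linarith
    have hωω' : ω ≤ ω' := by
      have : (1:ℝ) ≤ N := by rw [hN]; linarith [Nat.cast_nonneg (α := ℝ) n]
      nlinarith
    refine ⟨ω, hωp, ?_⟩
    intro r E u v P hr hE hrr huv hv hP hdeg hlog hidx
    have hidx0 := hidx.mono (min_le_left ε 1)
    rw [← hε0] at hidx0
    obtain ⟨k, W, U, V, hk0, hkr, hU, hV, hWUV, hWdeg, hWn, hWidx⟩ := wronskian P hP r E hdeg hr hE
    have hWidx := hWidx _ ε0 ω hωp.le (fun h => hrr 0 h.succ (Fin.succ_pos h)) hidx0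
    have hk0' : (0:ℝ) < k := by exact_mod_cast hk0
    have hS := sum_max_bound (ε0 - ω) (by linarith) (by linarith) k (r 0) (hr 0) hkr
    have hS2 : 2 * ε' * k ≤ ∑ b : Fin k, max 0 (ε0 - ω - (b : ℕ) / r 0) := by
      refine le_trans ?_ hS
      have : (ε0 / 2) ^ 2 ≤ (ε0 - ω) ^ 2 := by gcongr; linarith
      rw [hε']
      nlinarith
    have hWidx := hWidx.mono hS2
    -- log bounds
    have hP1 := one_le_nrm P hP
    have hW0 : W ≠ 0 := by
      rintro rfl
      rw [map_zero] at hWUV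
      obtain ⟨e, he⟩ := ne_zero_iff.1 hU
      have := coeff_tp U V V.natDegree e
      rw [← hWUV, coeff_zero] at this
      exact mul_ne_zero he (by simpa using hV) this.symm
    have hW1 := one_le_nrm W hW0
    have hlogP : 0 ≤ Real.log (nrm (fun _ => 1) P) := Real.log_nonneg hP1
    have hlogW : Real.log (nrm (fun _ => 1) W) + k * E ≤ k * (N * (Real.log (nrm (fun _ => 1) P) + E)) := by
      have h1 : Real.log (nrm (fun _ => 1) W) ≤ k * ((n + 2) * E * Real.log 2 + Real.log (nrm (fun _ => 1) P)) := by
        refine (Real.log_le_log (by linarith) hWn).trans ?_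
        rw [Real.log_pow, Real.log_mul (by positivity) (by linarith), Real.log_pow]
        push_cast; exact le_rfl
      have h2 : Real.log 2 ≤ 1 := by linarith [Real.log_two_lt_d9]
      have h3 : (n + 2) * E * Real.log 2 ≤ ((n:ℝ) + 2) * E := by
        apply mul_le_of_le_one_right (by positivity) h2
      have h4 : (n + 2) * E * Real.log 2 + Real.log (nrm (fun _ => 1) P) + E ≤ N * (Real.log (nrm (fun _ => 1) P) + E) := by
        rw [hN]; nlinarith [Nat.cast_nonneg (α := ℝ) n]
      nlinarith
    have hE0 : (1:ℝ) ≤ E := by exact_mod_cast (hr 0).trans_le (hE 0)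
    have hbig : ∀ h, Real.log (nrm (fun _ => 1) W) + k * E ≤ k * (N * ω * r h * lH (u h) (v h)) := by
      intro h
      refine hlogW.trans ?_
      have := mul_le_mul_of_nonneg_left (hlog h) hNp.le
      apply mul_le_mul_of_nonneg_left _ hk0'.le
      linarith
    have hlHp : ∀ h, 0 < lH (u h) (v h) := by
      intro h
      have h1 := hlog h
      have h2 : (0:ℝ) < r h := by exact_mod_cast hr h
      by_contra hcon
      push Not at hcon
      have : ω * r h * lH (u h) (v h) ≤ 0 := mul_nonpos_of_nonneg_of_nonpos (by positivity) hcon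
      linarith
    -- the first factor
    obtain ⟨U', c, hc, hU', hU'deg, hU'n⟩ := extract1 W U V hU hV hWUV
    have hU'0 : U' ≠ 0 := by
      rintro rfl
      rw [map_zero] at hU'
      exact smul_ne_zero hc hU hU'.symm
    have key := IH (fun h => k * r h.succ) (k * E) (fun h => u h.succ) (fun h => v h.succ) U'
      (fun h => Nat.mul_pos hk0 (hr _)) (fun h => Nat.mul_le_mul_left _ (hE _))
      (by
        intro i j hij
        push_cast
        have h1 := hrr i.succ j.succ (Fin.succ_lt_succ_iff.2 hij)
        have h2 : ω * r j.succ ≤ ω' * r j.succ := by gcongr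
        nlinarith)
      (fun h => huv _) (fun h => hv _) hU'0 (hU'deg _ hWdeg)
      (by
        intro h
        push_cast
        have h1 : Real.log (nrm (fun _ => 1) U') ≤ Real.log (nrm (fun _ => 1) W) :=
          Real.log_le_log (by linarith [one_le_nrm U' hU'0]) hU'n
        have h2 := hbig h.succ
        have h3 : k * (N * ω * r h.succ * lH (u h.succ) (v h.succ)) ≤ k * (ω' * r h.succ * lH (u h.succ) (v h.succ)) := by
          have := (hlHp h.succ).le
          gcongr
        linarith)
    have : ∃ e ∈ (tay (fun h : Fin n => (u h.succ / v h.succ : ℚ)) (map (Int.castRingHom ℚ) U')).support,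
        ∑ h, (e h : ℝ) / ((k * r h.succ : ℕ) : ℝ) < ε' := by
      by_contra hcon
      push Not at hcon
      exact key hcon
    obtain ⟨e, he, hesum⟩ := this
    -- the second factor
    obtain ⟨V', c', hc', hV', hV'n⟩ := extract0 W U V hU hV hWUV
    have hV'0 : V' ≠ 0 := by
      rintro rfl
      rw [Polynomial.map_zero] at hV'
      exact smul_ne_zero hc' hV hV'.symm
    set Vc := V.comp (Polynomial.X + Polynomial.C (u 0 / v 0 : ℚ)) with hVc
    have hVc0 : Vc ≠ 0 := by
      rw [hVc, Polynomial.comp_X_add_C_ne_zero_iff]; exact hV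
    set τ := Vc.natTrailingDegree with hτ
    have hτc : Vc.coeff τ ≠ 0 := Polynomial.trailingCoeff_nonzero_iff_nonzero.2 hVc0
    have hov := one_var V' hV'0 (u 0) (v 0) (huv 0) (hv 0) τ (by
      rw [hV', hτ, hVc, ← Polynomial.rootMultiplicity_eq_natTrailingDegree]
      rw [Polynomial.smul_eq_C_mul]
      exact Dvd.dvd.mul_left (Polynomial.pow_rootMultiplicity_dvd V _) _) _ hV'n
    have hmaxpos : (0:ℝ) < ((max |u 0| |v 0| : ℤ) : ℝ) := by
      have : 0 < max |u 0| |v 0| := lt_max_of_lt_right (abs_pos.2 (hv 0))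
      exact_mod_cast this
    have hτb : (τ : ℝ) / r 0 ≤ k * (ε' / 2) := by
      have h1 := Real.log_le_log (by positivity) hov
      rw [Real.log_pow] at h1
      change τ * lH (u 0) (v 0) ≤ _ at h1
      have h2 := hbig 0
      have h3 : (τ:ℝ) * lH (u 0) (v 0) ≤ (k * (N * ω) * r 0) * lH (u 0) (v 0) := by
        have : (0:ℝ) ≤ k * E := by positivity
        linarith
      have h4 := le_of_mul_le_mul_right h3 (hlHp 0)
      have h2 : (0:ℝ) < r 0 := by exact_mod_cast hr 0
      rw [div_le_iff₀ h2]
      refine h4.trans ?_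
      gcongr
    have hmem : e.cons τ ∈ (tay (fun h => (u h / v h : ℚ)) (map (Int.castRingHom ℚ) W)).support := by
      rw [mem_support_iff, hWUV, tay_tp, coeff_tp]
      refine mul_ne_zero ?_ hτc
      rw [hU', map_smul] at he
      have := support_smul he
      exact mem_support_iff.1 this
    have hfin := hWidx _ hmem
    rw [Fin.sum_univ_succ] at hfin
    simp only [Finsupp.cons_zero, Finsupp.cons_succ] at hfin
    have : ∑ h, (e h : ℝ) / (r h.succ : ℝ) = k * ∑ h, (e h : ℝ) / ((k * r h.succ : ℕ) : ℝ) := by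
      rw [Finset.mul_sum]
      apply Finset.sum_congr rfl
      intro h _
      have : (0:ℝ) < r h.succ := by exact_mod_cast hr _
      push_cast
      field_simp
    rw [this] at hfin
    nlinarith

end SubsThm
end

set_option linter.unusedSectionVars false
noncomputable section
namespace SubsThm
open Finset

section Counting
variable {ι : Type*} [Fintype ι] [DecidableEq ι]

lemma sum_antidiag_symm (r : ℕ) (i j : ι) :
    ∑ f ∈ piAntidiag (univ : Finset ι) r, (f i : ℝ) = ∑ f ∈ piAntidiag (univ : Finset ι) r, (f j : ℝ) := by
  apply Finset.sum_bij' (fun f _ => f ∘ Equiv.swap i j) (fun f _ => f ∘ Equiv.swap i j)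
  · intro f hf
    rw [mem_piAntidiag] at hf ⊢
    refine ⟨?_, fun _ _ => mem_univ _⟩
    rw [← hf.1]
    exact Equiv.sum_comp (Equiv.swap i j) f
  · intro f hf
    rw [mem_piAntidiag] at hf ⊢
    refine ⟨?_, fun _ _ => mem_univ _⟩
    rw [← hf.1]
    exact Equiv.sum_comp (Equiv.swap i j) f
  · intro f _; ext k; simp
  · intro f _; ext k; simp
  · intro f _; simp

lemma sum_antidiag_mean [Nonempty ι] (r : ℕ) (i : ι) :
    ∑ f ∈ piAntidiag (univ : Finset ι) r, (f i : ℝ)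
      = (piAntidiag (univ : Finset ι) r).card * r / Fintype.card ι := by
  have hN : (Fintype.card ι : ℝ) ≠ 0 := by exact_mod_cast Fintype.card_ne_zero
  rw [eq_div_iff hN]
  have h1 : ∑ j : ι, ∑ f ∈ piAntidiag (univ : Finset ι) r, (f j : ℝ)
      = (∑ f ∈ piAntidiag (univ : Finset ι) r, (f i : ℝ)) * Fintype.card ι := by
    rw [Finset.sum_congr rfl (fun j _ => sum_antidiag_symm r j i)]
    simp [mul_comm]
  rw [← h1, Finset.sum_comm]
  have : ∀ f ∈ piAntidiag (univ : Finset ι) r, ∑ j : ι, (f j : ℝ) = r := by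
    intro f hf
    rw [mem_piAntidiag] at hf
    exact_mod_cast hf.1
  rw [Finset.sum_congr rfl this]; simp

lemma antidiag_exp [Nonempty ι] (r : ℕ) (hr : 0 < r) (i : ι) (s : ℝ) (hs0 : 0 ≤ s) (hs1 : s ≤ 1) :
    ∑ f ∈ piAntidiag (univ : Finset ι) r, Real.exp (s * ((f i : ℝ) / r - 1 / Fintype.card ι))
      ≤ (piAntidiag (univ : Finset ι) r).card * (1 + s ^ 2) := by
  have hr' : (0:ℝ) < r := by exact_mod_cast hr
  have hN : (1:ℝ) ≤ Fintype.card ι := by exact_mod_cast Fintype.card_pos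
  have h1 : ∀ f ∈ piAntidiag (univ : Finset ι) r,
      Real.exp (s * ((f i : ℝ) / r - 1 / Fintype.card ι))
        ≤ (1 + s ^ 2 - s / Fintype.card ι) + s / r * (f i : ℝ) := by
    intro f hf
    rw [mem_piAntidiag] at hf
    have hfi : f i ≤ r := by
      rw [← hf.1]; exact Finset.single_le_sum (f := f) (fun _ _ => Nat.zero_le _) (mem_univ i)
    have a1 : (f i : ℝ) / r ≤ 1 := by rw [div_le_one hr']; exact_mod_cast hfi
    have a0 : 0 ≤ (f i : ℝ) / r := by positivity
    have b1 : 1 / (Fintype.card ι : ℝ) ≤ 1 := by rw [div_le_one (by linarith)]; exact hN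
    have b0 : 0 ≤ 1 / (Fintype.card ι : ℝ) := by positivity
    set x := (f i : ℝ) / r - 1 / Fintype.card ι with hx
    have hxx : |x| ≤ 1 := by rw [abs_le]; constructor <;> linarith
    have hx1 : |s * x| ≤ 1 := by
      rw [abs_mul, abs_of_nonneg hs0]; nlinarith [abs_nonneg x]
    have := (abs_le.1 (Real.abs_exp_sub_one_sub_id_le hx1)).2
    have hx2 : x ^ 2 ≤ 1 := by rw [← sq_abs]; nlinarith [abs_nonneg x]
    have e : s / r * (f i : ℝ) - s / Fintype.card ι = s * x := by rw [hx]; ring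
    nlinarith [sq_nonneg s]
  refine (Finset.sum_le_sum h1).trans ?_
  rw [Finset.sum_add_distrib, ← Finset.mul_sum, sum_antidiag_mean]
  simp only [sum_const, nsmul_eq_mul]
  apply le_of_eq
  field_simp
  ring

/-- index set of multidegrees -/
def JJ (ι : Type*) [Fintype ι] [DecidableEq ι] {m : ℕ} (r : Fin m → ℕ) : Finset (Fin m → ι → ℕ) :=
  Fintype.piFinset fun h => piAntidiag (univ : Finset ι) (r h)

lemma mem_JJ {m : ℕ} {r : Fin m → ℕ} {J : Fin m → ι → ℕ} :
    J ∈ JJ ι r ↔ ∀ h, ∑ i, J h i = r h := by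
  simp [JJ, Fintype.mem_piFinset, mem_piAntidiag]

lemma card_mul_le {κ : Type*} {S T : Finset κ} (h : S ⊆ T) {c : ℝ} {g : κ → ℝ} (h1 : ∀ J ∈ S, c ≤ g J)
    (h2 : ∀ J, 0 ≤ g J) : (S.card : ℝ) * c ≤ ∑ J ∈ T, g J := by
  rw [← nsmul_eq_mul]
  exact (Finset.card_nsmul_le_sum S g c h1).trans
    (Finset.sum_le_sum_of_subset_of_nonneg h fun J _ _ => h2 J)

lemma chernoff [Nonempty ι] {m : ℕ} (r : Fin m → ℕ) (hr : ∀ h, 0 < r h) (i : ι) (η : ℝ) (h0 : 0 < η) (h1 : η ≤ 1) :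
    (((JJ ι r).filter fun J => (m:ℝ) / Fintype.card ι + η * m < ∑ h, (J h i : ℝ) / r h).card : ℝ)
      ≤ (JJ ι r).card * Real.exp (-(m * η ^ 2 / 4)) := by
  have key : ∑ J ∈ JJ ι r, ∏ h, Real.exp (η / 2 * ((J h i : ℝ) / r h - 1 / Fintype.card ι))
      ≤ (JJ ι r).card * Real.exp (m * η ^ 2 / 4) := by
    rw [JJ, ← Finset.prod_univ_sum (t := fun h => piAntidiag (univ : Finset ι) (r h))
      (f := fun h f => Real.exp (η / 2 * ((f i : ℝ) / r h - 1 / Fintype.card ι)))]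
    calc _ ≤ ∏ h : Fin m, (((piAntidiag (univ : Finset ι) (r h)).card : ℝ) * Real.exp (η^2/4)) := by
          apply Finset.prod_le_prod
          · intro h _; exact Finset.sum_nonneg fun _ _ => (Real.exp_pos _).le
          · intro h _
            refine (antidiag_exp (r h) (hr h) i (η/2) (by linarith) (by linarith)).trans ?_
            gcongr
            have := Real.add_one_le_exp (η^2/4)
            linarith [show (η/2)^2 = η^2/4 by ring]
      _ = _ := by
          rw [Finset.prod_mul_distrib, Fintype.card_piFinset]
          push_cast
          rw [Finset.prod_const, card_univ, Fintype.card_fin, ← Real.exp_nat_mul]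
          congr 2; ring
  set S := (JJ ι r).filter fun J => (m:ℝ) / Fintype.card ι + η * m < ∑ h, (J h i : ℝ) / r h with hS
  have low : (S.card : ℝ) * Real.exp (m * η ^ 2 / 2)
      ≤ ∑ J ∈ JJ ι r, ∏ h, Real.exp (η / 2 * ((J h i : ℝ) / r h - 1 / Fintype.card ι)) := by
    have hSJ : S ⊆ JJ ι r := filter_subset _ _
    apply card_mul_le hSJ
    · intro J hJ
      have hJ2 := (mem_filter.1 hJ).2
      rw [← Real.exp_sum, Real.exp_le_exp, ← Finset.mul_sum, Finset.sum_sub_distrib]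
      simp only [sum_const, card_univ, Fintype.card_fin, nsmul_eq_mul]
      have e : (m:ℝ) * (1 / Fintype.card ι) = m / Fintype.card ι := by ring
      rw [e]
      nlinarith
    · intro J; exact Finset.prod_nonneg fun _ _ => (Real.exp_pos _).le
  have := low.trans key
  have hp := Real.exp_pos (m * η ^ 2 / 2)
  rw [← le_div_iff₀ hp] at this
  refine this.trans (le_of_eq ?_)
  rw [mul_div_assoc, ← Real.exp_sub]
  congr 2; ring

lemma card_antidiag_le (r : ℕ) : (piAntidiag (univ : Finset ι) r).card ≤ (2 ^ Fintype.card ι) ^ r := by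
  have h : piAntidiag (univ : Finset ι) r ⊆ Fintype.piFinset fun _ => range (r + 1) := by
    intro f hf
    rw [mem_piAntidiag] at hf
    rw [Fintype.mem_piFinset]
    intro i
    rw [mem_range, Nat.lt_succ_iff, ← hf.1]
    exact Finset.single_le_sum (f := f) (fun _ _ => Nat.zero_le _) (mem_univ i)
  refine (card_le_card h).trans ?_
  rw [Fintype.card_piFinset]
  simp only [card_range, prod_const, card_univ]
  rw [← pow_mul, mul_comm, pow_mul]
  exact Nat.pow_le_pow_left (Nat.lt_two_pow_self) _

lemma card_JJ_le {m : ℕ} (r : Fin m → ℕ) : (JJ ι r).card ≤ (2 ^ Fintype.card ι) ^ (∑ h, r h) := by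
  rw [JJ, Fintype.card_piFinset, ← Finset.prod_pow_eq_pow_sum]
  exact Finset.prod_le_prod (fun _ _ => Nat.zero_le _) fun h _ => card_antidiag_le _

end Counting

end SubsThm
end

set_option linter.unusedSectionVars false
noncomputable section
namespace SubsThm
open Finset MvPolynomial

section Siegel
variable {ι : Type*} [Fintype ι] [DecidableEq ι]

/-- currying of exponents -/
def toF {m : ℕ} (J : Fin m → ι → ℕ) : Fin m × ι →₀ ℕ := Finsupp.equivFunOnFinite.symm fun s => J s.1 s.2

@[simp] lemma toF_apply {m : ℕ} (J : Fin m → ι → ℕ) (s : Fin m × ι) : toF J s = J s.1 s.2 := rfl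

lemma toF_inj {m : ℕ} : Function.Injective (toF : (Fin m → ι → ℕ) → _) := by
  intro J J' h
  ext a i
  simpa using DFunLike.congr_fun h (a, i)

lemma toF_surj {m : ℕ} (e : Fin m × ι →₀ ℕ) : ∃ J, toF J = e :=
  ⟨fun h i => e (h, i), by ext ⟨h, i⟩; simp⟩

/-- the linear substitution -/
def lsub {R : Type*} [CommRing R] (m : ℕ) (B : ι → ι → R) (s : Fin m × ι) : MvPolynomial (Fin m × ι) R :=
  ∑ i, C (B s.2 i) * X (s.1, i)

lemma nrm_lsub {R : Type*} [NormedCommRing R] [NormOneClass R] {m : ℕ} (B : ι → ι → R) (s : Fin m × ι) :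
    nrm (fun _ => 1) (lsub m B s) ≤ ∑ i, ‖B s.2 i‖ := by
  refine (nrm_sum_le (fun _ => zero_le_one) _ _).trans (Finset.sum_le_sum fun i _ => ?_)
  refine (nrm_mul_le (fun _ => zero_le_one) _ _).trans ?_
  rw [nrm_C, nrm_X, mul_one]

lemma nrm_lprod {R : Type*} [NormedCommRing R] [NormOneClass R] {m : ℕ} (B : ι → ι → R)
    (CB : ℝ) (hB : ∀ k, ∑ i, ‖B k i‖ ≤ CB) (r : Fin m → ℕ) (e : Fin m × ι →₀ ℕ)
    (he : ∀ h, ∑ i, e (h, i) = r h) :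
    nrm (fun _ => 1) (e.prod fun s k => lsub m B s ^ k) ≤ CB ^ (∑ h, r h) := by
  rw [Finsupp.prod_fintype _ _ (by simp)]
  refine (nrm_prod_le (fun _ => zero_le_one) _ _).trans ?_
  have : ∑ h, r h = ∑ s : Fin m × ι, e s := by
    rw [Fintype.sum_prod_type]
    exact Finset.sum_congr rfl fun h _ => (he h).symm
  rw [this, ← Finset.prod_pow_eq_pow_sum]
  apply Finset.prod_le_prod
  · intro s _; exact nrm_nonneg (fun _ => zero_le_one) _
  · intro s _
    refine (nrm_pow_le (fun _ => zero_le_one) _ _).trans ?_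
    exact pow_le_pow_left₀ (nrm_nonneg (fun _ => zero_le_one) _) ((nrm_lsub B s).trans (hB _)) _

attribute [local instance] Matrix.seminormedAddCommGroup

lemma siegel_int {κ κ' : Type*} [Fintype κ] [Fintype κ'] [Nonempty κ'] [DecidableEq κ'] (A : Matrix κ κ' ℤ) (D : ℝ) (hD : 1 ≤ D)
    (hA : ∀ i j, |(A i j : ℝ)| ≤ D) (hc : 2 * Fintype.card κ ≤ Fintype.card κ') :
    ∃ t : κ' → ℤ, t ≠ 0 ∧ A.mulVec t = 0 ∧ ∀ j, |(t j : ℝ)| ≤ Fintype.card κ' * D := by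
  have hn : (1:ℝ) ≤ Fintype.card κ' := by exact_mod_cast Fintype.card_pos
  by_cases h0 : 0 < Fintype.card κ
  · obtain ⟨t, ht0, ht1, ht2⟩ := Int.Matrix.exists_ne_zero_int_vec_norm_le A (by omega) h0
    refine ⟨t, ht0, ht1, fun j => ?_⟩
    have hj : |(t j : ℝ)| ≤ ‖t‖ := by
      have := norm_le_pi_norm t j
      rwa [Int.norm_eq_abs] at this
    refine hj.trans (ht2.trans ?_)
    have hAn : ‖A‖ ≤ D := by
      rw [Matrix.norm_le_iff (by linarith)]
      intro i j; rw [Int.norm_eq_abs]; exact hA i j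
    have hmax : max 1 ‖A‖ ≤ D := max_le hD hAn
    have h1 : 1 ≤ (Fintype.card κ' : ℝ) * max 1 ‖A‖ := by
      have : (1:ℝ) ≤ max 1 ‖A‖ := le_max_left _ _
      nlinarith
    have hcr : 2 * (Fintype.card κ : ℝ) ≤ Fintype.card κ' := by exact_mod_cast hc
    have h0r : 0 < (Fintype.card κ : ℝ) := by exact_mod_cast h0
    calc _ ≤ ((Fintype.card κ' : ℝ) * max 1 ‖A‖) ^ (1:ℝ) := by
          apply Real.rpow_le_rpow_of_exponent_le h1
          rw [div_le_one (by linarith)]; linarith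
      _ ≤ _ := by rw [Real.rpow_one]; gcongr
  · obtain ⟨j0⟩ := ‹Nonempty κ'›
    have : IsEmpty κ := Fintype.card_eq_zero_iff.1 (by omega)
    refine ⟨Pi.single j0 1, by simp, by ext i; exact this.elim i, fun j => ?_⟩
    by_cases hj : j = j0
    · subst hj; simp; nlinarith
    · simp [hj]; nlinarith

theorem siegel_core [Nonempty ι] {R : Type*} [NormedCommRing R] [NormOneClass R] {d : ℕ}
    (co : R →+ (Fin d → ℤ)) (hinj : Function.Injective co) (C0 : ℝ) (hC0 : 1 ≤ C0)
    (hco : ∀ x t, |(co x t : ℝ)| ≤ C0 * ‖x‖) (B : ι → ι → R) (CB : ℝ) (hCB : 1 ≤ CB)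
    (hB : ∀ k, ∑ i, ‖B k i‖ ≤ CB) (m : ℕ) (η : ℝ) (hη0 : 0 < η) (hη1 : η ≤ 1)
    (hsm : 2 * d * Fintype.card ι * Real.exp (-(m * η ^ 2 / 4)) ≤ 1) (r : Fin m → ℕ) (hr : ∀ h, 0 < r h) :
    ∃ P : MvPolynomial (Fin m × ι) ℤ, P ≠ 0 ∧ (∀ e ∈ P.support, ∀ h, ∑ i, e (h, i) = r h) ∧
      nrm (fun _ => 1) P ≤ (2 ^ Fintype.card ι) ^ (∑ h, r h) * ((2 ^ Fintype.card ι) ^ (∑ h, r h) * (C0 * CB ^ (∑ h, r h))) ∧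
      ∀ e : Fin m × ι →₀ ℕ, (∀ h, ∑ i, e (h, i) = r h) →
        (∃ i, (m:ℝ) / Fintype.card ι + η * m < ∑ h, (e (h, i) : ℝ) / r h) →
        coeff e (aeval (lsub m B) P) = 0 := by
  classical
  set Bad := (JJ ι r).filter fun J => ∃ i, (m:ℝ) / Fintype.card ι + η * m < ∑ h, (J h i : ℝ) / r h with hBad
  have hBc : (Bad.card : ℝ) ≤ Fintype.card ι * ((JJ ι r).card * Real.exp (-(m * η ^ 2 / 4))) := by
    have hsub : Bad ⊆ (univ : Finset ι).biUnion fun i => (JJ ι r).filter fun J => (m:ℝ) / Fintype.card ι + η * m < ∑ h, (J h i : ℝ) / r h := by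
      intro J hJ
      obtain ⟨h1, i, h2⟩ := mem_filter.1 hJ
      rw [mem_biUnion]
      exact ⟨i, mem_univ _, mem_filter.2 ⟨h1, h2⟩⟩
    have h1 := (card_le_card hsub).trans card_biUnion_le
    have h2 : (Bad.card : ℝ) ≤ ∑ i : ι, (((JJ ι r).filter fun J => (m:ℝ) / Fintype.card ι + η * m < ∑ h, (J h i : ℝ) / r h).card : ℝ) := by
      exact_mod_cast h1
    refine h2.trans ((Finset.sum_le_sum fun i _ => chernoff r hr i η hη0 hη1).trans ?_)
    simp
  have hne : Nonempty (JJ ι r) := by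
    obtain ⟨i0⟩ := ‹Nonempty ι›
    refine ⟨⟨fun h => Pi.single i0 (r h), mem_JJ.2 fun h => ?_⟩⟩
    simp
  set G : (Fin m → ι → ℕ) → MvPolynomial (Fin m × ι) R := fun J => (toF J).prod fun s k => lsub m B s ^ k with hG
  let A : Matrix (Bad × Fin d) (JJ ι r) ℤ := fun et J => co (coeff (toF et.1.1) (G J.1)) et.2
  have hA : ∀ i j, |(A i j : ℝ)| ≤ C0 * CB ^ (∑ h, r h) := by
    intro et J
    refine (hco _ _).trans ?_
    gcongr
    have h1 := coeff_le_nrm (w := fun _ => 1) (fun _ => zero_le_one) (G J.1) (toF et.1.1)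
    rw [wt_one, mul_one] at h1
    exact h1.trans (nrm_lprod B CB hB r _ (mem_JJ.1 J.2))
  have hcard : 2 * Fintype.card (Bad × Fin d) ≤ Fintype.card (JJ ι r) := by
    rw [Fintype.card_prod, Fintype.card_coe, Fintype.card_coe, Fintype.card_fin]
    have : (2 * (Bad.card * d : ℕ) : ℝ) ≤ (JJ ι r).card := by
      push_cast
      calc (2 * (Bad.card * d) : ℝ) ≤ 2 * (Fintype.card ι * ((JJ ι r).card * Real.exp (-(m * η ^ 2 / 4))) * d) := by gcongr
        _ = (2 * d * Fintype.card ι * Real.exp (-(m * η ^ 2 / 4))) * (JJ ι r).card := by ring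
        _ ≤ 1 * (JJ ι r).card := by gcongr
        _ = _ := one_mul _
    exact_mod_cast this
  obtain ⟨t, ht0, ht1, ht2⟩ := siegel_int A (C0 * CB ^ (∑ h, r h)) (by nlinarith [one_le_pow₀ (n := ∑ h, r h) hCB]) hA hcard
  set P : MvPolynomial (Fin m × ι) ℤ := ∑ J : JJ ι r, monomial (toF J.1) (t J) with hP
  have hcP : ∀ J : JJ ι r, coeff (toF J.1) P = t J := by
    intro J
    rw [hP, coeff_sum, Finset.sum_eq_single J]
    · simp
    · intro J' _ hJ'
      rw [coeff_monomial, if_neg]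
      intro h; exact hJ' (Subtype.ext (toF_inj h))
    · simp
  have hcard2 : (Fintype.card (JJ ι r) : ℝ) ≤ (2 ^ Fintype.card ι) ^ (∑ h, r h) := by
    rw [Fintype.card_coe]; exact_mod_cast card_JJ_le r
  refine ⟨P, ?_, ?_, ?_, ?_⟩
  · intro h
    apply ht0
    ext J
    rw [← hcP J, h]; simp
  · intro e he h
    have := support_sum he
    rw [mem_biUnion] at this
    obtain ⟨J, _, hJ⟩ := this
    have := support_monomial_subset hJ
    rw [mem_singleton] at this
    subst this
    exact mem_JJ.1 J.2 h
  · refine (nrm_sum_le (fun _ => zero_le_one) _ _).trans ?_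
    calc ∑ J : JJ ι r, nrm (fun _ => 1) (monomial (toF J.1) (t J))
        ≤ ∑ J : JJ ι r, ((2 ^ Fintype.card ι) ^ (∑ h, r h) * (C0 * CB ^ (∑ h, r h)) : ℝ) := by
          apply Finset.sum_le_sum
          intro J _
          rw [nrm_monomial, wt_one, mul_one, Int.norm_eq_abs]
          refine (ht2 J).trans ?_
          gcongr
      _ = Fintype.card (JJ ι r) * ((2 ^ Fintype.card ι) ^ (∑ h, r h) * (C0 * CB ^ (∑ h, r h)) : ℝ) := by
          rw [Finset.sum_const, nsmul_eq_mul, card_univ]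
      _ ≤ _ := by gcongr
  · intro e he hbad
    obtain ⟨J', rfl⟩ := toF_surj e
    have hJ' : J' ∈ Bad := mem_filter.2 ⟨mem_JJ.2 he, hbad⟩
    apply hinj
    rw [map_zero]
    ext q
    have h1 := congrFun ht1 (⟨J', hJ'⟩, q)
    rw [Matrix.mulVec, dotProduct] at h1
    have h2 : coeff (toF J') (aeval (lsub m B) P) = ∑ J : JJ ι r, t J • coeff (toF J') (G J.1) := by
      rw [hP, map_sum, coeff_sum]
      apply Finset.sum_congr rfl
      intro J _
      rw [aeval_monomial, ← Algebra.smul_def, coeff_smul]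
    rw [h2, map_sum, Finset.sum_apply]
    simp only [map_zsmul, Pi.smul_apply, smul_eq_mul, Pi.zero_apply]
    refine Eq.trans ?_ h1
    exact Finset.sum_congr rfl fun J _ => mul_comm _ _

end Siegel
end SubsThm
end

set_option linter.unusedSectionVars false
noncomputable section
namespace SubsThm
open Finset MvPolynomial

section Siegel2
variable {ι : Type*} [Fintype ι] [DecidableEq ι]

section
attribute [local instance] Matrix.linftyOpNormedRing

theorem siegel_ring [Nonempty ι] {R : Type*} [cr : CommRing R] [Nontrivial R] [Module.Finite ℤ R] [Module.Free ℤ R]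
    (B : ι → ι → R) : ∃ (C0 : ℝ) (d : ℕ), 1 ≤ C0 ∧ ∀ (m : ℕ) (η : ℝ), 0 < η → η ≤ 1 →
    2 * d * Fintype.card ι * Real.exp (-(m * η ^ 2 / 4)) ≤ 1 → ∀ (r : Fin m → ℕ), (∀ h, 0 < r h) →
    ∃ P : MvPolynomial (Fin m × ι) ℤ, P ≠ 0 ∧ (∀ e ∈ P.support, ∀ h, ∑ i, e (h, i) = r h) ∧
      nrm (fun _ => 1) P ≤ C0 ^ (∑ h, r h + 1) ∧
      ∀ e : Fin m × ι →₀ ℕ, (∀ h, ∑ i, e (h, i) = r h) →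
        (∃ i, (m:ℝ) / Fintype.card ι + η * m < ∑ h, (e (h, i) : ℝ) / r h) →
        coeff e (aeval (lsub m B) P) = 0 := by
  classical
  let b := Module.finBasis ℤ R
  set d := Module.finrank ℤ R with hd
  have hd0 : 0 < d := Module.finrank_pos
  haveI : Nonempty (Fin d) := ⟨⟨0, hd0⟩⟩
  let φ : R →+* Matrix (Fin d) (Fin d) ℤ := (Algebra.leftMulMatrix b).toRingHom
  have hφ : Function.Injective φ := Algebra.leftMulMatrix_injective b
  letI nr : NormedCommRing R := NormedCommRing.induced R (Matrix (Fin d) (Fin d) ℤ) φ hφ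
  haveI : NormOneClass R := NormOneClass.induced R (Matrix (Fin d) (Fin d) ℤ) φ
  let co : R →+ (Fin d → ℤ) := (b.equivFun : R →+ (Fin d → ℤ))
  have hco : Function.Injective co := b.equivFun.injective
  set C1 : ℝ := max 1 ‖(b.repr 1 : Fin d → ℤ)‖
  have hC1 : 1 ≤ C1 := le_max_left _ _
  have hbd : ∀ x t, |(co x t : ℝ)| ≤ C1 * ‖x‖ := by
    intro x t
    have h1 : co x = (Algebra.leftMulMatrix b x).mulVec (b.repr 1) := by
      rw [Algebra.leftMulMatrix_mulVec_repr, mul_one]; rfl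
    have h2 := Matrix.linfty_opNorm_mulVec (Algebra.leftMulMatrix b x) (b.repr 1 : Fin d → ℤ)
    rw [← h1] at h2
    have h3 : |(co x t : ℝ)| ≤ ‖co x‖ := by
      have := norm_le_pi_norm (co x) t
      rwa [Int.norm_eq_abs] at this
    have h4 : ‖Algebra.leftMulMatrix b x‖ = ‖x‖ := rfl
    rw [h4] at h2
    refine h3.trans (h2.trans ?_)
    rw [mul_comm]
    exact mul_le_mul_of_nonneg_right (le_max_right _ _) (norm_nonneg _)
  set CB : ℝ := max 1 (∑ k, ∑ i, ‖B k i‖)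
  have hCB : 1 ≤ CB := le_max_left _ _
  have hB : ∀ k, ∑ i, ‖B k i‖ ≤ CB := fun k =>
    (Finset.single_le_sum (f := fun k => ∑ i, ‖B k i‖)
      (fun _ _ => Finset.sum_nonneg fun _ _ => norm_nonneg _) (mem_univ k)).trans (le_max_right _ _)
  refine ⟨(2 ^ Fintype.card ι) * (2 ^ Fintype.card ι) * C1 * CB, d, ?_, ?_⟩
  · have : (1:ℝ) ≤ 2 ^ Fintype.card ι := one_le_pow₀ (by norm_num)
    have h2 : (1:ℝ) ≤ (2 ^ Fintype.card ι) * (2 ^ Fintype.card ι) := by nlinarith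
    have h3 : (1:ℝ) ≤ (2 ^ Fintype.card ι) * (2 ^ Fintype.card ι) * C1 := by nlinarith
    nlinarith
  intro m η hη0 hη1 hsm r hr
  obtain ⟨P, h1, h2, h3, h4⟩ := siegel_core co hco C1 hC1 hbd B CB hCB hB m η hη0 hη1 hsm r hr
  refine ⟨P, h1, h2, h3.trans ?_, h4⟩
  have : (1:ℝ) ≤ 2 ^ Fintype.card ι := one_le_pow₀ (by norm_num)
  rw [mul_pow, mul_pow, mul_pow]
  set S := ∑ h, r h
  have e1 : ((2:ℝ) ^ Fintype.card ι) ^ S ≤ (2 ^ Fintype.card ι) ^ (S+1) := pow_le_pow_right₀ this (by omega)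
  have e2 : C1 ≤ C1 ^ (S+1) := le_self_pow₀ hC1 (by omega)
  have e3 : CB ^ S ≤ CB ^ (S+1) := pow_le_pow_right₀ hCB (by omega)
  calc _ = ((2:ℝ) ^ Fintype.card ι) ^ S * (2 ^ Fintype.card ι) ^ S * C1 * CB ^ S := by ring
    _ ≤ _ := by gcongr
end

/-- multihomogeneity weight -/
def hw (m : ℕ) (ι : Type*) : Fin m × ι → (Fin m → ℕ) := fun s => Pi.single s.1 1

lemma weight_hw {m : ℕ} (e : Fin m × ι →₀ ℕ) (h : Fin m) : Finsupp.weight (hw m ι) e h = ∑ i, e (h, i) := by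
  rw [Finsupp.weight_apply, Finsupp.sum_fintype _ _ (by simp), Finset.sum_apply, Fintype.sum_prod_type]
  simp only [hw, Pi.smul_apply, smul_eq_mul, Pi.single_apply]
  rw [Finset.sum_eq_single h]
  · simp
  · intro b _ hb
    apply Finset.sum_eq_zero
    intro i _
    rw [if_neg (Ne.symm hb), mul_zero]
  · simp

lemma whom_iff {R : Type*} [CommSemiring R] {m : ℕ} (P : MvPolynomial (Fin m × ι) R) (r : Fin m → ℕ) :
    IsWeightedHomogeneous (hw m ι) P r ↔ ∀ e ∈ P.support, ∀ h, ∑ i, e (h, i) = r h := by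
  constructor
  · intro H e he h
    rw [← weight_hw]
    exact congrFun (H (mem_support_iff.1 he)) h
  · intro H e he
    ext h
    rw [weight_hw]
    exact H e (mem_support_iff.2 he) h

lemma whom_lsub {R : Type*} [CommRing R] {m : ℕ} (B : ι → ι → R) (s : Fin m × ι) :
    IsWeightedHomogeneous (hw m ι) (lsub m B s) (hw m ι s) := by
  apply IsWeightedHomogeneous.sum
  intro i _
  have := (isWeightedHomogeneous_C (hw m ι) (B s.2 i)).mul (isWeightedHomogeneous_X R (hw m ι) (s.1, i))
  rw [zero_add] at this
  exact this

lemma whom_aeval {R : Type*} [CommRing R] {m : ℕ} (B : ι → ι → R) (P : MvPolynomial (Fin m × ι) ℤ) (r : Fin m → ℕ)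
    (hP : ∀ e ∈ P.support, ∀ h, ∑ i, e (h, i) = r h) :
    IsWeightedHomogeneous (hw m ι) (aeval (lsub m B) P) r := by
  rw [aeval_def, eval₂_eq]
  apply IsWeightedHomogeneous.sum
  intro e he
  have h1 : IsWeightedHomogeneous (hw m ι) (∏ s ∈ e.support, lsub m B s ^ e s) (∑ s ∈ e.support, e s • hw m ι s) :=
    IsWeightedHomogeneous.prod _ _ _ fun s _ => (whom_lsub B s).pow _
  have h2 : ∑ s ∈ e.support, e s • hw m ι s = r := by
    have : ∑ s ∈ e.support, e s • hw m ι s = Finsupp.weight (hw m ι) e := by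
      rw [Finsupp.weight_apply]; rfl
    rw [this]
    ext h
    rw [weight_hw]; exact hP e he h
  rw [h2] at h1
  have := (isWeightedHomogeneous_C (hw m ι) ((algebraMap ℤ R (coeff e P)))).mul h1
  rw [zero_add] at this
  exact this

lemma nrm_aeval {m : ℕ} (B : ι → ι → ℝ) (CB : ℝ) (hB : ∀ k, ∑ i, ‖B k i‖ ≤ CB)
    (P : MvPolynomial (Fin m × ι) ℤ) (r : Fin m → ℕ)
    (hP : ∀ e ∈ P.support, ∀ h, ∑ i, e (h, i) = r h) :
    nrm (fun _ => 1) (aeval (lsub m B) P) ≤ nrm (fun _ => 1) P * CB ^ (∑ h, r h) := by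
  rw [aeval_def, eval₂_eq]
  refine (nrm_sum_le (fun _ => zero_le_one) _ _).trans ?_
  rw [nrm, Finset.sum_mul]
  apply Finset.sum_le_sum
  intro e he
  refine (nrm_mul_le (fun _ => zero_le_one) _ _).trans ?_
  rw [wt_one, mul_one]
  have h2 := nrm_lprod B CB hB r e (hP e he)
  have h1 : nrm (fun _ => 1) (algebraMap ℤ (MvPolynomial (Fin m × ι) ℝ) (coeff e P)) = ‖coeff e P‖ := by
    have : algebraMap ℤ (MvPolynomial (Fin m × ι) ℝ) (coeff e P) = C ((coeff e P : ℤ) : ℝ) := by simp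
    rw [this, nrm_C]; simp [Int.norm_eq_abs]
  rw [h1]
  exact mul_le_mul_of_nonneg_left h2 (norm_nonneg _)

/-- the auxiliary polynomial -/
theorem aux_poly [Nonempty ι] (B : ι → ι → ℝ) (hB : ∀ k i, IsIntegral ℤ (B k i)) :
    ∃ (C0 : ℝ) (d : ℕ), 1 ≤ C0 ∧ ∀ (m : ℕ) (η : ℝ), 0 < η → η ≤ 1 →
    2 * d * Fintype.card ι * Real.exp (-(m * η ^ 2 / 4)) ≤ 1 → ∀ (r : Fin m → ℕ), (∀ h, 0 < r h) →
    ∃ P : MvPolynomial (Fin m × ι) ℤ, P ≠ 0 ∧ (∀ e ∈ P.support, ∀ h, ∑ i, e (h, i) = r h) ∧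
      nrm (fun _ => 1) P ≤ C0 ^ (∑ h, r h + 1) ∧
      nrm (fun _ => 1) (aeval (lsub m B) P) ≤ C0 ^ (∑ h, r h + 1) ∧
      ∀ e ∈ (aeval (lsub m B) P).support, (∀ h, ∑ i, e (h, i) = r h) ∧
        ∀ i, ∑ h, (e (h, i) : ℝ) / r h ≤ (m:ℝ) / Fintype.card ι + η * m := by
  classical
  let S : Set ℝ := Set.range fun p : ι × ι => B p.1 p.2
  let R := Algebra.adjoin ℤ S
  haveI : Module.Finite ℤ R := Module.Finite.of_fg (fg_adjoin_of_finite (Set.finite_range _) (by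
    rintro x ⟨p, rfl⟩; exact hB _ _))
  let B' : ι → ι → R := fun k i => ⟨B k i, Algebra.subset_adjoin ⟨(k, i), rfl⟩⟩
  obtain ⟨C0, d, hC0, H⟩ := siegel_ring B'
  set CB : ℝ := max 1 (∑ k, ∑ i, ‖B k i‖)
  have hCB : 1 ≤ CB := le_max_left _ _
  have hB : ∀ k, ∑ i, ‖B k i‖ ≤ CB := fun k =>
    (Finset.single_le_sum (f := fun k => ∑ i, ‖B k i‖)
      (fun _ _ => Finset.sum_nonneg fun _ _ => norm_nonneg _) (mem_univ k)).trans (le_max_right _ _)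
  refine ⟨C0 * CB, d, by nlinarith, ?_⟩
  intro m η hη0 hη1 hsm r hr
  obtain ⟨P, h1, h2, h3, h4⟩ := H m η hη0 hη1 hsm r hr
  have e1 : C0 ^ (∑ h, r h + 1) * CB ^ (∑ h, r h) ≤ (C0 * CB) ^ (∑ h, r h + 1) := by
    rw [mul_pow]; gcongr; omega
  have e2 : C0 ^ (∑ h, r h + 1) ≤ C0 ^ (∑ h, r h + 1) * CB ^ (∑ h, r h) := by
    have := one_le_pow₀ (n := ∑ h, r h) hCB
    have h' : 0 < C0 ^ (∑ h, r h + 1) := by positivity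
    nlinarith
  refine ⟨P, h1, h2, h3.trans (e2.trans e1), ?_, ?_⟩
  · refine (nrm_aeval B CB hB P r h2).trans (le_trans ?_ e1)
    gcongr
  · intro e he
    have hm : ∀ h, ∑ i, e (h, i) = r h := (whom_iff _ _).1 (whom_aeval B P r h2) e he
    refine ⟨hm, fun i => ?_⟩
    by_contra! hi
    have h5 := h4 e hm ⟨i, hi⟩
    rw [mem_support_iff] at he
    apply he
    have : aeval (lsub m B) P = map (algebraMap R ℝ) (aeval (lsub m B') P) := by
      rw [aeval_def, aeval_def, hom_eval₂]
      congr 1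
      · exact RingHom.ext_int _ _
      · ext1 s
        simp [lsub, B']
    rw [this, coeff_map, h5, map_zero]

end Siegel2
end SubsThm
end

set_option linter.unusedSectionVars false
noncomputable section
namespace SubsThm
open Finset MvPolynomial

lemma psi_coeff {O S : Type*} [CommRing S] (ψ : S →+* MvPolynomial O S)
    (hψ : ∀ s, constantCoeff (ψ s) = s) (T : MvPolynomial O S) (e : O →₀ ℕ)
    (he : ∀ e' ∈ T.support, e.degree ≤ e'.degree) :
    coeff e (eval₂ ψ X T) = coeff e T := by
  classical
  rw [eval₂_eq, coeff_sum]
  have key : ∀ e' ∈ T.support, coeff e (ψ (coeff e' T) * ∏ i ∈ e'.support, X i ^ e' i)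
      = if e' = e then coeff e' T else 0 := by
    intro e' he'
    have h1 : (∏ i ∈ e'.support, (X i : MvPolynomial O S) ^ e' i) = monomial e' 1 := by
      rw [monomial_eq, C_1, one_mul]; rfl
    rw [h1, coeff_mul_monomial', mul_one]
    by_cases hle : e' ≤ e
    · rw [if_pos hle]
      have h2 : e' = e := by
        have hd : (e - e').degree + e'.degree = e.degree := by
          rw [← map_add, tsub_add_cancel_of_le hle]
        have := he e' he'
        have h0 : (e - e').degree = 0 := by omega
        rw [Finsupp.degree_eq_zero_iff] at h0
        rw [← tsub_add_cancel_of_le hle, h0, zero_add]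
      subst h2
      rw [if_pos rfl, tsub_self]
      exact hψ _
    · rw [if_neg hle, if_neg]
      rintro rfl; exact hle le_rfl
  rw [Finset.sum_congr rfl key, Finset.sum_ite_eq']
  by_cases h : e ∈ T.support
  · rw [if_pos h]
  · rw [if_neg h, notMem_support_iff.1 h]

section Descent
variable {ι κ : Type*} [Fintype ι] [DecidableEq ι] [Fintype κ] [DecidableEq κ] {m : ℕ} (i0 i1 : Fin m → ι)

/-- outer part of an exponent -/
def outE (J : Fin m × ι →₀ ℕ) : Fin m × ι →₀ ℕ := J.filter fun s => s.2 ≠ i0 s.1 ∧ s.2 ≠ i1 s.1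

/-- inner part of an exponent -/
def innE (J : Fin m × ι →₀ ℕ) : Fin m →₀ ℕ := Finsupp.equivFunOnFinite.symm fun h => J (h, i0 h)

/-- dehomogenization -/
def dehom : MvPolynomial (Fin m × ι) ℤ →+* MvPolynomial (Fin m × ι) (MvPolynomial (Fin m) ℤ) :=
  eval₂Hom (Int.castRingHom _) fun s => if s.2 = i0 s.1 then C (X s.1) else if s.2 = i1 s.1 then 1 else X s

lemma dehom_monomial_one (J : Fin m × ι →₀ ℕ) :
    dehom i0 i1 (monomial J 1) = monomial (outE i0 i1 J) (monomial (innE i0 J) 1) := by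
  induction J using Finsupp.induction_linear with
  | zero =>
    have h1 : outE i0 i1 (0 : Fin m × ι →₀ ℕ) = 0 := by rw [outE]; exact Finsupp.filter_zero _
    have h2 : innE i0 (0 : Fin m × ι →₀ ℕ) = 0 := by ext; simp [innE]
    rw [h1, h2]
    have h3 : (monomial (0 : Fin m × ι →₀ ℕ) (1:ℤ)) = 1 := rfl
    rw [h3, map_one]; rfl
  | add f g hf hg =>
    have h1 : outE i0 i1 (f + g) = outE i0 i1 f + outE i0 i1 g := by simp [outE, Finsupp.filter_add]
    have h2 : innE i0 (f + g) = innE i0 f + innE i0 g := by ext; simp [innE]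
    have h3 : (monomial (f + g) (1:ℤ)) = monomial f 1 * monomial g 1 := by rw [monomial_mul, mul_one]
    rw [h1, h2, h3, map_mul, hf, hg, monomial_mul, monomial_mul, mul_one]
  | single s n =>
    have h3 : (monomial (Finsupp.single s n) (1:ℤ)) = X s ^ n := by rw [X_pow_eq_monomial]
    rw [h3, map_pow]
    have h4 : dehom i0 i1 (X s) = if s.2 = i0 s.1 then C (X s.1) else if s.2 = i1 s.1 then 1 else X s := by
      simp [dehom]
    rw [h4]
    have hin : innE i0 (Finsupp.single s n) = if s.2 = i0 s.1 then Finsupp.single s.1 n else 0 := by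
      obtain ⟨h, i⟩ := s
      ext h'
      simp only [innE, Finsupp.equivFunOnFinite_symm_apply_apply, Finsupp.single_apply, Prod.mk.injEq]
      by_cases hh : h = h'
      · subst hh
        by_cases hi : i = i0 h <;> simp [hi]
      · by_cases hi : i = i0 h <;> simp [hi, hh]
    rw [hin]
    by_cases c1 : s.2 = i0 s.1
    · rw [if_pos c1, if_pos c1, outE, Finsupp.filter_single_of_neg _ (by tauto), ← C_pow, X_pow_eq_monomial]
      rfl
    · rw [if_neg c1, if_neg c1]
      by_cases c2 : s.2 = i1 s.1
      · rw [if_pos c2, outE, Finsupp.filter_single_of_neg _ (by tauto), one_pow]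
        rfl
      · rw [if_neg c2, outE, Finsupp.filter_single_of_pos _ (by tauto), X_pow_eq_monomial]
        rfl

lemma dehom_eq (P : MvPolynomial (Fin m × ι) ℤ) :
    dehom i0 i1 P = ∑ J ∈ P.support, monomial (outE i0 i1 J) (monomial (innE i0 J) (coeff J P)) := by
  conv_lhs => rw [P.as_sum, map_sum]
  apply Finset.sum_congr rfl
  intro J _
  have : monomial J (coeff J P) = C (coeff J P) * monomial J 1 := by rw [C_mul_monomial, mul_one]
  rw [this, map_mul, dehom_monomial_one]
  have h2 : dehom i0 i1 (C (coeff J P)) = C (C (coeff J P)) := by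
    simp [dehom]
  rw [h2, C_mul_monomial, C_mul_monomial, mul_one]

lemma coeff_dehom (P : MvPolynomial (Fin m × ι) ℤ) (e : Fin m × ι →₀ ℕ) :
    coeff e (dehom i0 i1 P) = ∑ J ∈ P.support with outE i0 i1 J = e, monomial (innE i0 J) (coeff J P) := by
  classical
  rw [dehom_eq, coeff_sum, Finset.sum_filter]
  apply Finset.sum_congr rfl
  intro J _
  rw [coeff_monomial]

lemma exp_eq_of {r : Fin m → ℕ} {J J' : Fin m × ι →₀ ℕ}
    (hJ : ∀ h, ∑ i, J (h, i) = r h) (hJ' : ∀ h, ∑ i, J' (h, i) = r h)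
    (ho : outE i0 i1 J = outE i0 i1 J') (hi : innE i0 J = innE i0 J') : J = J' := by
  have a1 : ∀ h, J (h, i0 h) = J' (h, i0 h) := fun h => by
    simpa [innE] using DFunLike.congr_fun hi h
  have a2 : ∀ h i, i ≠ i0 h → i ≠ i1 h → J (h, i) = J' (h, i) := fun h i h0 h1 => by
    simpa [outE, Finsupp.filter_apply, h0, h1] using DFunLike.congr_fun ho (h, i)
  have a3 : ∀ h i, i ≠ i1 h → J (h, i) = J' (h, i) := fun h i h1 => by
    by_cases h0 : i = i0 h
    · subst h0; exact a1 h
    · exact a2 h i h0 h1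
  ext ⟨h, i⟩
  by_cases h1 : i = i1 h
  · subst h1
    have e1 := hJ h
    have e2 := hJ' h
    rw [← Finset.add_sum_erase _ _ (mem_univ (i1 h))] at e1 e2
    have : ∑ i ∈ univ.erase (i1 h), J (h, i) = ∑ i ∈ univ.erase (i1 h), J' (h, i) :=
      Finset.sum_congr rfl fun i hi => a3 h i (Finset.ne_of_mem_erase hi)
    omega
  · exact a3 h i h1

lemma dehom_ne_zero {r : Fin m → ℕ} (P : MvPolynomial (Fin m × ι) ℤ) (hP : P ≠ 0)
    (hh : ∀ e ∈ P.support, ∀ h, ∑ i, e (h, i) = r h) : dehom i0 i1 P ≠ 0 := by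
  classical
  obtain ⟨J, hJ⟩ := ne_zero_iff.1 hP
  have hJs := mem_support_iff.2 hJ
  intro h0
  have h1 := coeff_dehom i0 i1 P (outE i0 i1 J)
  rw [h0, coeff_zero] at h1
  have h2 := congrArg (coeff (innE i0 J)) h1
  rw [coeff_zero, coeff_sum, Finset.sum_eq_single J] at h2
  · rw [coeff_monomial, if_pos rfl] at h2
    exact hJ h2.symm
  · intro J' hJ' hn
    rw [mem_filter] at hJ'
    rw [coeff_monomial, if_neg]
    intro h
    exact hn (exp_eq_of i0 i1 (hh J' hJ'.1) (hh J hJs) hJ'.2 h)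
  · intro hn
    exact absurd ((mem_filter (p := fun J' => outE i0 i1 J' = outE i0 i1 J)).2 ⟨hJs, rfl⟩) hn

lemma degLE_coeff_dehom {r : Fin m → ℕ} (P : MvPolynomial (Fin m × ι) ℤ)
    (hh : ∀ e ∈ P.support, ∀ h, ∑ i, e (h, i) = r h) (e : Fin m × ι →₀ ℕ) :
    degLE r (coeff e (dehom i0 i1 P)) := by
  rw [coeff_dehom]
  apply degLE_sum
  intro J hJ f hf h
  have := Finset.mem_singleton.1 (support_monomial_subset hf)
  subst this
  rw [← hh J (mem_filter.1 hJ).1 h]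
  exact Finset.single_le_sum (f := fun i => J (h, i)) (fun _ _ => Nat.zero_le _) (mem_univ (i0 h))

lemma nrm_coeff_dehom (P : MvPolynomial (Fin m × ι) ℤ) (e : Fin m × ι →₀ ℕ) :
    nrm (fun _ => 1) (coeff e (dehom i0 i1 P)) ≤ nrm (fun _ => 1) P := by
  rw [coeff_dehom]
  refine (nrm_sum_le (fun _ => zero_le_one) _ _).trans ?_
  rw [nrm]
  refine le_trans (Finset.sum_le_sum_of_subset_of_nonneg (filter_subset _ _) fun _ _ _ => nrm_nonneg (fun _ => zero_le_one) _) ?_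
  apply Finset.sum_le_sum
  intro J _
  rw [nrm_monomial, wt_one, wt_one]

end Descent
end SubsThm
end

set_option linter.unusedSectionVars false
noncomputable section
namespace SubsThm
open Finset MvPolynomial

section Descent
variable {ι κ : Type*} [Fintype ι] [DecidableEq ι] [Fintype κ] [DecidableEq κ] {m : ℕ}

/-- parametrization of points near the hyperplanes -/
def parm (i0 : Fin m → ι) (g : Fin m → κ → ι → ℤ) (s : Fin m × ι) : MvPolynomial (Fin m × Option κ) ℤ :=
  (if s.2 = i0 s.1 then X (s.1, none) else 0) + ∑ k, C (g s.1 k s.2) * X (s.1, some k)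

lemma eval₂_parm {T : Type*} [CommRing T] (i0 : Fin m → ι) (g : Fin m → κ → ι → ℤ) (Ω : Fin m × Option κ → T)
    (h : Fin m) (j : ι) : eval₂ (Int.castRingHom T) Ω (parm i0 g (h, j))
      = (if j = i0 h then Ω (h, none) else 0) + ∑ k, (g h k j : T) * Ω (h, some k) := by
  rw [parm, eval₂_add, eval₂_sum]
  congr 1
  · split_ifs
    · rw [eval₂_X]
    · rw [eval₂_zero]
  · apply Finset.sum_congr rfl
    intro k _
    rw [eval₂_mul, eval₂_C, eval₂_X]; rfl

/-- index of coefficient of a substituted polynomial -/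
lemma omega_idx {O : Type*} (l : Fin m → κ → MvPolynomial O ℚ) (F : MvPolynomial (Fin m × Option κ) ℤ)
    (r : Fin m → ℕ) (ε : ℝ) (hF : ∀ f ∈ F.support, ε ≤ ∑ h, (f (h, none) : ℝ) / r h) (e : O →₀ ℕ) :
    idxGE r (coeff e (eval₂ (Int.castRingHom (MvPolynomial O (MvPolynomial (Fin m) ℚ)))
      (fun s => match s with
        | (h, none) => C (X h)
        | (h, some k) => map C (l h k)) F)) ε := by
  classical
  rw [eval₂_eq', coeff_sum]
  apply idxGE_sum
  intro f hf
  set q : MvPolynomial O ℚ := ∏ h, ∏ k, l h k ^ f (h, some k) with hq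
  set n : Fin m →₀ ℕ := Finsupp.equivFunOnFinite.symm fun h => f (h, none) with hn
  have h1 : (∏ s : Fin m × Option κ, (match s with
        | (h, none) => C (X h)
        | (h, some k) => map C (l h k) : MvPolynomial O (MvPolynomial (Fin m) ℚ)) ^ f s)
      = C (monomial n 1) * map C q := by
    rw [Fintype.prod_prod_type]
    simp only [Fintype.prod_option, Finset.prod_mul_distrib]
    congr 1
    · rw [monomial_eq, C_1, one_mul, Finsupp.prod_fintype _ _ (by simp), map_prod]
      apply Finset.prod_congr rfl
      intro h _
      rw [map_pow]; rfl
    · rw [hq, map_prod]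
      apply Finset.prod_congr rfl
      intro h _
      rw [map_prod]
      exact Finset.prod_congr rfl fun k _ => by rw [map_pow]
  have h2 : coeff e ((Int.castRingHom (MvPolynomial O (MvPolynomial (Fin m) ℚ))) (coeff f F) * ∏ s : Fin m × Option κ, (match s with
        | (h, none) => C (X h)
        | (h, some k) => map C (l h k) : MvPolynomial O (MvPolynomial (Fin m) ℚ)) ^ f s)
      = monomial n (((coeff f F : ℤ) : ℚ) * coeff e q) := by
    rw [h1, eq_intCast]
    have h3 : ((coeff f F : ℤ) : MvPolynomial O (MvPolynomial (Fin m) ℚ)) = C (C ((coeff f F : ℤ) : ℚ)) := by simp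
    rw [h3, coeff_C_mul, coeff_C_mul, coeff_map, mul_comm (monomial n 1), C_mul_monomial, C_mul_monomial]
    simp
  intro e' he'
  rw [h2] at he'
  have := Finset.mem_singleton.1 (support_monomial_subset he')
  subst this
  exact hF f hf

set_option maxHeartbeats 1000000 in
theorem descent (r : Fin m → ℕ) (P : MvPolynomial (Fin m × ι) ℤ) (hP : P ≠ 0)
    (hh : ∀ e ∈ P.support, ∀ h, ∑ i, e (h, i) = r h) (i0 i1 : Fin m → ι) (hne : ∀ h, i0 h ≠ i1 h)
    (g : Fin m → κ → ι → ℤ) (M : Fin m → ι → ℤ) (hM : ∀ h, M h (i0 h) ≠ 0)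
    (hspan : ∀ h (x : ι → ℚ), ∑ i, (M h i : ℚ) * x i = 0 → ∃ c : κ → ℚ, ∀ i, x i = ∑ k, c k * (g h k i : ℚ))
    (ξ : Fin m → ℚ) (hξ : ∀ h, ξ h = -(M h (i1 h) : ℚ) / M h (i0 h))
    (ε : ℝ) (hF : ∀ f ∈ (aeval (parm i0 g) P).support, ε ≤ ∑ h, (f (h, none) : ℝ) / r h) :
    ∃ p : MvPolynomial (Fin m) ℤ, p ≠ 0 ∧ degLE r p ∧ nrm (fun _ => 1) p ≤ nrm (fun _ => 1) P ∧
      idxGE r (tay ξ (map (Int.castRingHom ℚ) p)) ε := by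
  classical
  -- choose minimal outer exponent
  have hd := dehom_ne_zero i0 i1 P hP hh
  obtain ⟨e, he, hmin⟩ := Finset.exists_min_image (dehom i0 i1 P).support (fun e => e.degree)
    (support_nonempty.2 hd)
  refine ⟨coeff e (dehom i0 i1 P), mem_support_iff.1 he, degLE_coeff_dehom i0 i1 P hh e,
    nrm_coeff_dehom i0 i1 P e, ?_⟩
  -- the shifted polynomial
  let τ : MvPolynomial (Fin m) ℤ →+* MvPolynomial (Fin m) ℚ := (tay ξ).toRingHom.comp (map (Int.castRingHom ℚ))
  let T := MvPolynomial.map τ (dehom i0 i1 P)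
  have hT : coeff e T = tay ξ (map (Int.castRingHom ℚ) (coeff e (dehom i0 i1 P))) := by
    simp only [T, coeff_map]; rfl
  let q : Fin m → ι → ℚ := fun h i => if i = i0 h ∨ i = i1 h then 0 else -(M h i : ℚ) / M h (i0 h)
  let ψ : MvPolynomial (Fin m) ℚ →+* MvPolynomial (Fin m × ι) (MvPolynomial (Fin m) ℚ) :=
    (aeval fun h => C (X h) + ∑ i, C (C (q h i)) * X (h, i) : MvPolynomial (Fin m) ℚ →ₐ[ℚ] _).toRingHom
  have hψ : ∀ s, constantCoeff (ψ s) = s := by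
    intro s
    have : (constantCoeff.comp ψ) = RingHom.id _ := by
      apply MvPolynomial.ringHom_ext
      · intro a
        simp [ψ]
      · intro h
        simp [ψ]
    exact RingHom.congr_fun this s
  have h1 := psi_coeff ψ hψ T e (fun e' he' => hmin e' (support_map_subset _ _ he'))
  rw [← hT, ← h1]
  -- spanning
  have hb : ∀ h i, i ≠ i0 h → ∃ c : κ → ℚ, ∀ j, ((if j = i then 1 else 0) - (if j = i0 h then (M h i : ℚ) / M h (i0 h) else 0))
      = ∑ k, c k * (g h k j : ℚ) := by
    intro h i hi
    apply hspan
    have hMQ : (M h (i0 h) : ℚ) ≠ 0 := by exact_mod_cast hM h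
    simp only [mul_sub, mul_ite, mul_one, mul_zero, Finset.sum_sub_distrib, Finset.sum_ite_eq', mem_univ, if_true]
    field_simp; ring
  choose! c hc using hb
  let xh : Fin m → ι → MvPolynomial (Fin m × ι) ℚ := fun h i => if i = i1 h then 1 else X (h, i)
  let l : Fin m → κ → MvPolynomial (Fin m × ι) ℚ := fun h k => ∑ i ∈ univ.erase (i0 h), C (c h i k) * xh h i
  have h2 := omega_idx l (aeval (parm i0 g) P) r ε hF e
  -- equality of ring homs
  set Ω : Fin m × Option κ → MvPolynomial (Fin m × ι) (MvPolynomial (Fin m) ℚ) := (fun s => match s with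
        | (h, none) => C (X h)
        | (h, some k) => map C (l h k)) with hΩ
  have hsum : ∀ h j, ∑ k, (g h k j : MvPolynomial (Fin m × ι) (MvPolynomial (Fin m) ℚ)) * map C (l h k)
      = map C (∑ i ∈ univ.erase (i0 h), C ((if j = i then 1 else 0) - (if j = i0 h then (M h i : ℚ) / M h (i0 h) else 0)) * xh h i) := by
    intro h j
    have : ∀ k, (g h k j : MvPolynomial (Fin m × ι) (MvPolynomial (Fin m) ℚ)) = map C (C (g h k j : ℚ)) := by
      intro k; simp
    simp only [this, ← map_mul, ← map_sum]
    congr 1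
    simp only [l, Finset.mul_sum]
    rw [Finset.sum_comm]
    apply Finset.sum_congr rfl
    intro i hi
    rw [hc h i (Finset.ne_of_mem_erase hi) j, map_sum, Finset.sum_mul]
    apply Finset.sum_congr rfl
    intro k _
    rw [map_mul]; ring
  let f1 : MvPolynomial (Fin m × ι) ℤ →+* MvPolynomial (Fin m × ι) (MvPolynomial (Fin m) ℚ) :=
    (eval₂Hom ψ X).comp ((MvPolynomial.map τ).comp (dehom i0 i1))
  let f2 : MvPolynomial (Fin m × ι) ℤ →+* MvPolynomial (Fin m × ι) (MvPolynomial (Fin m) ℚ) :=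
    (eval₂Hom (Int.castRingHom _) Ω).comp (aeval (parm i0 g) : _ →ₐ[ℤ] _).toRingHom
  have hf : f1 = f2 := by
    apply MvPolynomial.ringHom_ext
    · intro a; simp [f1, f2, dehom]
    · rintro ⟨h, j⟩
      have e2 : f2 (X (h, j)) = (if j = i0 h then C (X h) else 0) + ∑ k, (g h k j : MvPolynomial (Fin m × ι) (MvPolynomial (Fin m) ℚ)) * map C (l h k) := by
        have e0 : f2 (X (h, j)) = eval₂ (Int.castRingHom _) Ω (parm i0 g (h, j)) := by
          simp only [f2, RingHom.comp_apply, AlgHom.toRingHom_eq_coe, RingHom.coe_coe, aeval_X, coe_eval₂Hom]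
        rw [e0, eval₂_parm]
      rw [e2, hsum]
      have e1 : dehom i0 i1 (X (h, j)) = if j = i0 h then C (X h) else if j = i1 h then 1 else X (h, j) := by
        simp [dehom]
      simp only [f1, RingHom.comp_apply, e1]
      by_cases c1 : j = i0 h
      · subst c1
        simp only [if_true, map_C, coe_eval₂Hom, eval₂_C]
        have e3 : τ (X h) = X h + C (ξ h) := by simp [τ, tay]
        rw [e3, map_add]
        have e4 : ψ (C (ξ h)) = C (C (ξ h)) := by simp [ψ]
        have e5 : ψ (X h) = C (X h) + ∑ i, C (C (q h i)) * X (h, i) := by simp [ψ]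
        rw [e4, e5, add_assoc]
        congr 1
        have hi1 : i1 h ∈ univ.erase (i0 h) := mem_erase.2 ⟨(hne h).symm, mem_univ _⟩
        rw [← Finset.add_sum_erase _ _ (mem_univ (i0 h)), ← Finset.add_sum_erase _ _ hi1,
          ← Finset.add_sum_erase (univ.erase (i0 h)) _ hi1, map_add, add_comm]
        have e6 : q h (i0 h) = 0 := by simp [q]
        have e7 : q h (i1 h) = 0 := by simp [q]
        rw [e6, e7]
        simp only [map_zero, zero_mul, zero_add]
        congr 1
        · rw [if_neg (hne h), zero_sub, hξ]
          simp [xh, neg_div]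
        · rw [map_sum]
          apply Finset.sum_congr rfl
          intro i hi
          have g1 := Finset.ne_of_mem_erase hi
          have g2 := Finset.ne_of_mem_erase (Finset.mem_of_mem_erase hi)
          rw [if_neg (Ne.symm g2), zero_sub]
          have g3 : q h i = -((M h i : ℚ) / M h (i0 h)) := by simp [q, g1, g2, neg_div]
          rw [g3]
          simp only [xh, if_neg g1, map_mul, MvPolynomial.map_C, MvPolynomial.map_X]
      · rw [if_neg c1, if_neg c1, zero_add, Finset.sum_eq_single j]
        · simp only [if_true, if_neg c1, sub_zero, C_1, one_mul, xh]
          split_ifs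
          · simp
          · simp
        · intro i _ hij
          rw [if_neg (Ne.symm hij), if_neg c1]; simp
        · intro hj
          exact absurd (mem_erase.2 ⟨c1, mem_univ _⟩) hj
  have h3 : eval₂ ψ X T = eval₂ (Int.castRingHom _) Ω (aeval (parm i0 g) P) := RingHom.congr_fun hf P
  rw [h3]
  exact h2

end Descent
end SubsThm
end

set_option linter.unusedSectionVars false
noncomputable section
namespace SubsThm
open Finset MvPolynomial

section Engine
variable {ι κ : Type*} [Fintype ι] [DecidableEq ι] [Fintype κ] [DecidableEq κ] {m : ℕ}

/-- linear forms evaluated at the parametrization -/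
def lfm (A : ι → ι → ℝ) (i0 : Fin m → ι) (g : Fin m → κ → ι → ℤ) (s : Fin m × ι) :
    MvPolynomial (Fin m × Option κ) ℝ :=
  C (A s.2 (i0 s.1)) * X (s.1, none) + ∑ k, C (∑ j, A s.2 j * (g s.1 k j : ℝ)) * X (s.1, some k)

lemma aeval_scale {σ S : Type*} [Fintype σ] [CommRing S] [Algebra ℤ S] (P : MvPolynomial σ ℤ) (c : S) (y : σ → S)
    (n : ℕ) (hP : ∀ e ∈ P.support, ∑ s, e s = n) :
    aeval (fun s => c * y s) P = c ^ n * aeval y P := by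
  rw [aeval_def, aeval_def, eval₂_eq', eval₂_eq', Finset.mul_sum]
  apply Finset.sum_congr rfl
  intro e he
  simp only [mul_pow]
  rw [Finset.prod_mul_distrib, Finset.prod_pow_eq_pow_sum, hP e he]
  ring

lemma aeval_lfm (A B : ι → ι → ℝ) (c0 : ℝ) (hBA : ∀ k j, ∑ i, B k i * A i j = if k = j then c0 else 0)
    (i0 : Fin m → ι) (g : Fin m → κ → ι → ℤ) (P : MvPolynomial (Fin m × ι) ℤ) (r : Fin m → ℕ)
    (hh : ∀ e ∈ P.support, ∀ h, ∑ i, e (h, i) = r h) :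
    aeval (lfm A i0 g) (aeval (lsub m B) P) =
      C c0 ^ (∑ h, r h) * MvPolynomial.map (Int.castRingHom ℝ) (aeval (parm i0 g) P) := by
  have h1 : aeval (lfm A i0 g) (aeval (lsub m B) P) = aeval (fun s => aeval (lfm A i0 g) (lsub m B s)) P := by
    have : ((aeval (lfm A i0 g)).restrictScalars ℤ).comp (aeval (lsub m B)) 
        = (aeval (fun s => aeval (lfm A i0 g) (lsub m B s)) : MvPolynomial (Fin m × ι) ℤ →ₐ[ℤ] _) := by
      apply algHom_ext
      intro s
      simp
    exact DFunLike.congr_fun this P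
  have h2 : MvPolynomial.map (Int.castRingHom ℝ) (aeval (parm i0 g) P) =
      aeval (fun s => MvPolynomial.map (Int.castRingHom ℝ) (parm i0 g s)) P := by
    have : ((mapAlgHom (algebraMap ℤ ℝ).toIntAlgHom).comp (aeval (parm i0 g)))
        = (aeval (fun s => MvPolynomial.map (Int.castRingHom ℝ) (parm i0 g s)) : MvPolynomial (Fin m × ι) ℤ →ₐ[ℤ] _) := by
      apply algHom_ext
      intro s
      simp
      rfl
    exact DFunLike.congr_fun this P
  have hfun : (fun s => aeval (lfm A i0 g) (lsub m B s)) =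
      fun s => C c0 * MvPolynomial.map (Int.castRingHom ℝ) (parm i0 g s) := by
    funext s
    obtain ⟨h, j⟩ := s
    simp only [lsub, parm, lfm, map_sum, map_add, map_mul, algHom_C, aeval_X, MvPolynomial.map_C, MvPolynomial.map_X]
    simp only [algebraMap_eq]
    have e1 : MvPolynomial.map (Int.castRingHom ℝ) (if j = i0 h then X (h, none) else (0 : MvPolynomial (Fin m × Option κ) ℤ))
        = if j = i0 h then X (h, none) else 0 := by
      split_ifs <;> simp
    rw [e1]
    simp only [mul_add, Finset.sum_add_distrib]
    congr 1
    · simp only [← mul_assoc, ← C_mul]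
      rw [← Finset.sum_mul, ← map_sum, hBA]
      split_ifs <;> simp
    · simp only [Finset.mul_sum]
      rw [Finset.sum_comm]
      apply Finset.sum_congr rfl
      intro k _
      simp only [← mul_assoc, ← C_mul, ← map_sum]
      rw [← Finset.sum_mul, ← map_sum]
      congr 2
      simp only [Finset.mul_sum]
      rw [Finset.sum_comm]
      simp only [← mul_assoc, ← Finset.sum_mul, hBA]
      simp
  rw [h1, h2, hfun]
  apply aeval_scale
  · intro e he
    rw [Fintype.sum_prod_type]
    exact Finset.sum_congr rfl fun h _ => hh e he h

lemma nrm_aeval_le {σ τ : Type*} [Fintype σ] (w : τ → ℝ) (hw : ∀ i, 0 ≤ w i) (G : MvPolynomial σ ℝ)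
    (y : σ → MvPolynomial τ ℝ) (N : σ → ℝ) (hN : ∀ s, nrm w (y s) ≤ N s) (K : ℝ)
    (hK : ∀ e ∈ G.support, ∏ s, N s ^ e s ≤ K) : nrm w (aeval y G) ≤ nrm (fun _ => 1) G * K := by
  have h0 : nrm (fun _ => 1) G = ∑ e ∈ G.support, ‖coeff e G‖ := by
    simp [nrm, wt_one]
  rw [h0, aeval_def, eval₂_eq', Finset.sum_mul]
  refine (nrm_sum_le hw _ _).trans (Finset.sum_le_sum fun e he => ?_)
  refine (nrm_mul_le hw _ _).trans ?_
  rw [algebraMap_eq, nrm_C]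
  apply mul_le_mul_of_nonneg_left _ (norm_nonneg _)
  refine le_trans ?_ (hK e he)
  refine (nrm_prod_le hw _ _).trans ?_
  apply Finset.prod_le_prod
  · intro s _; exact nrm_nonneg hw _
  · intro s _
    exact (nrm_pow_le hw _ _).trans (pow_le_pow_left₀ (nrm_nonneg hw _) (hN s) _)

lemma exp_bound [Nonempty ι] (c : ι → ℝ) (cs η R : ℝ) (hcs : ∀ i, |c i| ≤ cs) (hη : 0 ≤ η) (hR : 0 ≤ R)
    (s : ℝ) (hs : ∑ i, c i = -s) (hs0 : 0 ≤ s)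
    (lq : Fin m → ℝ) (r : Fin m → ℕ) (hr : ∀ h, 0 < r h) (h1 : ∀ h, R ≤ r h * lq h)
    (h2 : ∀ h, r h * lq h ≤ (1 + η) * R) (J : Fin m → ι → ℕ) (hJ : ∀ h, ∑ i, J h i = r h)
    (hT : ∀ i, ∑ h, (J h i : ℝ) / r h ≤ m / Fintype.card ι + η * m) :
    ∑ h, ∑ i, c i * (J h i * lq h) ≤ R * m * (-s / Fintype.card ι + cs * η * (Fintype.card ι + 1)) := by
  have hcs0 : 0 ≤ cs := (abs_nonneg _).trans (hcs (Classical.arbitrary ι))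
  set N : ℝ := (Fintype.card ι : ℝ) with hN
  have hNpos : 0 < N := by rw [hN]; exact_mod_cast Fintype.card_pos
  have hr' : ∀ h, (0 : ℝ) < r h := fun h => by exact_mod_cast hr h
  set T : ι → ℝ := fun i => ∑ h, (J h i : ℝ) / r h with hTd
  have hTs : ∑ i, T i = m := by
    rw [hTd, Finset.sum_comm]
    have : ∀ h, ∑ i, (J h i : ℝ) / r h = 1 := by
      intro h
      rw [← Finset.sum_div, div_eq_one_iff_eq (hr' h).ne']
      exact_mod_cast hJ h
    simp [this]
  have e1 : ∑ h, ∑ i, c i * (J h i * lq h) ≤ ∑ h, ∑ i, (c i * ((J h i : ℝ) / r h) * R + cs * ((J h i : ℝ) / r h) * (η * R)) := by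
    apply Finset.sum_le_sum; intro h _
    apply Finset.sum_le_sum; intro i _
    have : c i * (J h i * lq h) = c i * ((J h i : ℝ) / r h) * R + c i * ((J h i : ℝ) / r h) * (r h * lq h - R) := by
      field_simp [(hr' h).ne']; ring
    rw [this]
    have q0 : 0 ≤ (J h i : ℝ) / r h := by positivity
    have q1 : c i * ((J h i : ℝ) / r h) ≤ cs * ((J h i : ℝ) / r h) :=
      mul_le_mul_of_nonneg_right ((le_abs_self _).trans (hcs i)) q0
    have q2 : 0 ≤ r h * lq h - R := by linarith [h1 h]
    have q3 : r h * lq h - R ≤ η * R := by linarith [h2 h]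
    have := mul_le_mul q1 q3 q2 (by positivity)
    linarith
  have e2 : ∑ h, ∑ i, (c i * ((J h i : ℝ) / r h) * R + cs * ((J h i : ℝ) / r h) * (η * R))
      = (∑ i, c i * T i) * R + cs * (η * R) * ∑ i, T i := by
    rw [Finset.sum_comm]
    simp only [hTd, Finset.sum_add_distrib, Finset.mul_sum, Finset.sum_mul]
    congr 1
    refine Finset.sum_congr rfl fun i _ => Finset.sum_congr rfl fun h _ => by ring
  have e3 : ∑ i, c i * T i ≤ -s * m / N + cs * N * η * m := by
    have : ∀ i, c i * T i ≤ c i * (m / N + η * m) + cs * (m / N + η * m - T i) := by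
      intro i
      have q0 : 0 ≤ m / N + η * m - T i := by linarith [hT i]
      have := mul_le_mul_of_nonneg_right ((neg_le_abs (c i)).trans (hcs i)) q0
      linarith
    calc ∑ i, c i * T i ≤ ∑ i, (c i * (m / N + η * m) + cs * (m / N + η * m - T i)) := Finset.sum_le_sum fun i _ => this i
      _ = -s * (m / N + η * m) + cs * (N * (m / N + η * m) - m) := by
        rw [Finset.sum_add_distrib, ← Finset.sum_mul, hs, ← Finset.mul_sum, Finset.sum_sub_distrib, hTs]
        simp only [Finset.sum_const, Finset.card_univ, nsmul_eq_mul, hN]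
      _ = -s * m / N + cs * N * η * m - s * (η * m) := by field_simp; ring
      _ ≤ _ := by have : 0 ≤ s * (η * m) := by positivity
                  linarith
  rw [e2, hTs] at e1
  refine e1.trans ?_
  have := mul_le_mul_of_nonneg_right e3 hR
  refine le_trans (add_le_add_left this _) (le_of_eq ?_)
  field_simp; ring
end Engine
end SubsThm
end

set_option linter.unusedSectionVars false
noncomputable section
namespace SubsThm
open Finset MvPolynomial

section Engine
variable {ι κ : Type*} [Fintype ι] [DecidableEq ι] [Fintype κ] [DecidableEq κ] {m : ℕ}

/-- weights for the parametrized variables -/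
def ewt (cs : ℝ) (lq : Fin m → ℝ) (s : Fin m × Option κ) : ℝ :=
  match s.2 with
  | none => Real.exp (-cs * lq s.1)
  | some _ => 1

lemma ewt_nonneg (cs : ℝ) (lq : Fin m → ℝ) (s : Fin m × Option κ) : 0 ≤ ewt cs lq s := by
  obtain ⟨h, _ | k⟩ := s
  · exact (Real.exp_pos _).le
  · exact zero_le_one

lemma wt_ewt (cs : ℝ) (lq : Fin m → ℝ) (f : Fin m × Option κ →₀ ℕ) :
    wt (ewt cs lq) f = Real.exp (-cs * ∑ h, (f (h, none) : ℝ) * lq h) := by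
  rw [wt, Finsupp.prod_fintype _ _ (by simp), Fintype.prod_prod_type, Finset.mul_sum, Real.exp_sum]
  apply Finset.prod_congr rfl
  intro h _
  rw [Fintype.prod_option]
  simp only [ewt, one_pow, Finset.prod_const_one, mul_one]
  rw [← Real.exp_nat_mul]
  congr 1; ring

set_option maxHeartbeats 1000000 in
theorem index_bound [Nonempty ι] (A B : ι → ι → ℝ) (c0 : ℝ) (hc0 : 1 ≤ |c0|)
    (hBA : ∀ k j, ∑ i, B k i * A i j = if k = j then c0 else 0)
    (c : ι → ℝ) (cs η R : ℝ) (hcs : ∀ i, |c i| ≤ cs) (hη : 0 ≤ η) (hη1 : η ≤ 1) (hR : 0 ≤ R)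
    (s : ℝ) (hs : ∑ i, c i = -s) (hs0 : 0 ≤ s)
    (lq : Fin m → ℝ) (hlq : ∀ h, 0 ≤ lq h) (r : Fin m → ℕ) (hr : ∀ h, 0 < r h) (h1 : ∀ h, R ≤ r h * lq h)
    (h2 : ∀ h, r h * lq h ≤ (1 + η) * R)
    (P : MvPolynomial (Fin m × ι) ℤ) (hh : ∀ e ∈ P.support, ∀ h, ∑ i, e (h, i) = r h)
    (C0 : ℝ) (hC0 : 1 ≤ C0) (hG : nrm (fun _ => 1) (aeval (lsub m B) P) ≤ C0 ^ (∑ h, r h + 1))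
    (hsupp : ∀ e ∈ (aeval (lsub m B) P).support, (∀ h, ∑ i, e (h, i) = r h) ∧
      ∀ i, ∑ h, (e (h, i) : ℝ) / r h ≤ m / Fintype.card ι + η * m)
    (i0 : Fin m → ι) (g : Fin m → κ → ι → ℤ) (K CA : ℝ) 
    (hg : ∀ h k i, |∑ j, A i j * (g h k j : ℝ)| ≤ K * Real.exp (c i * lq h))
    (hCA1 : 1 ≤ CA) (hCA : ∑ i, ∑ j, |A i j| + Fintype.card κ * K ≤ CA) (ε : ℝ) 
    (hη2 : cs * η * (Fintype.card ι + 1) ≤ s / (4 * Fintype.card ι))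
    (hfin : (∑ h, (r h : ℝ) + 1) * (Real.log C0 + Real.log CA) + 2 * cs * R * ε <
      R * m * (3 * s / (4 * Fintype.card ι))) :
    ∀ f ∈ (aeval (parm i0 g) P).support, ε ≤ ∑ h, (f (h, none) : ℝ) / r h := by
  intro f hf
  by_contra! hlt
  have hcs0 : 0 ≤ cs := (abs_nonneg _).trans (hcs (Classical.arbitrary ι))
  have hr' : ∀ h, (0 : ℝ) < r h := fun h => by exact_mod_cast hr h
  set F := aeval (parm i0 g) P with hF
  set G := aeval (lsub m B) P with hGd
  set w : Fin m × Option κ → ℝ := ewt cs lq with hwd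
  have hw : ∀ i, 0 ≤ w i := ewt_nonneg cs lq
  -- norm of the linear forms
  have hN : ∀ t : Fin m × ι, nrm w (lfm A i0 g t) ≤ CA * Real.exp (c t.2 * lq t.1) := by
    rintro ⟨h, i⟩
    simp only [lfm]
    have a1 : nrm w (C (A i (i0 h)) * X (h, none) : MvPolynomial (Fin m × Option κ) ℝ) ≤
        |A i (i0 h)| * Real.exp (c i * lq h) := by
      refine (nrm_mul_le hw _ _).trans ?_
      rw [nrm_C, nrm_X, Real.norm_eq_abs]
      apply mul_le_mul_of_nonneg_left _ (abs_nonneg _)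
      apply Real.exp_le_exp.2
      apply mul_le_mul_of_nonneg_right _ (hlq h)
      linarith [neg_abs_le (c i), hcs i]
    have a2 : nrm w (∑ k, C (∑ j, A i j * (g h k j : ℝ)) * X (h, some k) : MvPolynomial (Fin m × Option κ) ℝ)
        ≤ Fintype.card κ * K * Real.exp (c i * lq h) := by
      refine (nrm_sum_le hw _ _).trans ?_
      calc _ ≤ ∑ k : κ, K * Real.exp (c i * lq h) := by
            apply Finset.sum_le_sum; intro k _
            refine (nrm_mul_le hw _ _).trans ?_
            rw [nrm_C, nrm_X, Real.norm_eq_abs]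
            simpa [hwd, ewt] using hg h k i
        _ = _ := by simp [Finset.sum_const, mul_assoc]
    have a3 : |A i (i0 h)| ≤ ∑ i, ∑ j, |A i j| := by
      refine le_trans ?_ (Finset.single_le_sum (f := fun i => ∑ j, |A i j|) (fun i _ => Finset.sum_nonneg fun j _ => abs_nonneg _) (mem_univ i))
      exact Finset.single_le_sum (f := fun j => |A i j|) (fun j _ => abs_nonneg _) (mem_univ (i0 h))
    refine (nrm_add_le hw _ _).trans ((add_le_add a1 a2).trans ?_)
    rw [← add_mul]
    apply mul_le_mul_of_nonneg_right _ (Real.exp_pos _).le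
    linarith
  set X0 : ℝ := R * m * (-s / Fintype.card ι + cs * η * (Fintype.card ι + 1)) with hX0
  have hK : ∀ e ∈ G.support, ∏ t, (CA * Real.exp (c t.2 * lq t.1)) ^ e t ≤ CA ^ (∑ h, r h) * Real.exp X0 := by
    intro e he
    obtain ⟨b1, b2⟩ := hsupp e he
    simp only [mul_pow]
    rw [Finset.prod_mul_distrib, Finset.prod_pow_eq_pow_sum, Fintype.sum_prod_type]
    simp only [b1]
    apply mul_le_mul_of_nonneg_left _ (by positivity)
    have := exp_bound c cs η R hcs hη hR s hs hs0 lq r hr h1 h2 (fun h i => e (h, i)) b1 b2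
    refine le_trans (le_of_eq ?_) (Real.exp_le_exp.2 this)
    rw [Fintype.prod_prod_type, Real.exp_sum]
    apply Finset.prod_congr rfl; intro h _
    rw [Real.exp_sum]
    apply Finset.prod_congr rfl; intro i _
    rw [← Real.exp_nat_mul]
    congr 1; ring
  have h3 := nrm_aeval_le w hw G (lfm A i0 g) _ hN _ hK
  rw [hGd, aeval_lfm A B c0 hBA i0 g P r hh, ← C_pow] at h3
  have h4 := coeff_le_nrm hw (C (c0 ^ (∑ h, r h)) * MvPolynomial.map (Int.castRingHom ℝ) (aeval (parm i0 g) P)) f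
  rw [coeff_C_mul, coeff_map, norm_mul, norm_pow, Real.norm_eq_abs, hwd, wt_ewt] at h4
  have h5 : (1 : ℝ) ≤ ‖(Int.castRingHom ℝ) (coeff f F)‖ := by
    have : coeff f F ≠ 0 := mem_support_iff.1 hf
    rw [eq_intCast, Real.norm_eq_abs, ← Int.cast_abs]
    exact_mod_cast Int.one_le_abs this
  have h6 : (1 : ℝ) ≤ |c0| ^ (∑ h, r h) := one_le_pow₀ hc0
  have h7 : ∑ h, (f (h, none) : ℝ) * lq h ≤ 2 * R * ε := by
    have : ∀ h, (f (h, none) : ℝ) * lq h ≤ (f (h, none) : ℝ) / r h * (2 * R) := by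
      intro h
      have e1 : (f (h, none) : ℝ) * lq h = (f (h, none) : ℝ) / r h * (r h * lq h) := by
        field_simp [(hr' h).ne']
      rw [e1]
      apply mul_le_mul_of_nonneg_left _ (by positivity)
      nlinarith [h2 h]
    refine (Finset.sum_le_sum fun h _ => this h).trans ?_
    rw [← Finset.sum_mul]
    nlinarith
  have h8 : Real.exp (-cs * (2 * R * ε)) ≤ Real.exp (-cs * ∑ h, (f (h, none) : ℝ) * lq h) := by
    apply Real.exp_le_exp.2
    nlinarith
  have h9 : Real.exp (-cs * (2 * R * ε)) ≤ C0 ^ (∑ h, r h + 1) * (CA ^ (∑ h, r h) * Real.exp X0) := by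
    calc Real.exp (-cs * (2 * R * ε)) ≤ 1 * Real.exp (-cs * (2 * R * ε)) := by rw [one_mul]
      _ ≤ (|c0| ^ (∑ h, r h) * ‖(Int.castRingHom ℝ) (coeff f F)‖) * Real.exp (-cs * ∑ h, (f (h, none) : ℝ) * lq h) := by
        apply mul_le_mul _ h8 (Real.exp_pos _).le (by positivity)
        nlinarith
      _ ≤ _ := h4
      _ ≤ _ := h3
      _ ≤ _ := mul_le_mul_of_nonneg_right hG (by positivity)
  have h10 : C0 ^ (∑ h, r h + 1) * (CA ^ (∑ h, r h) * Real.exp X0) ≤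
      Real.exp ((∑ h, (r h : ℝ) + 1) * (Real.log C0 + Real.log CA) + X0) := by
    rw [Real.exp_add, mul_add, Real.exp_add, mul_assoc]
    have p0 : 0 < C0 := by linarith
    have p1 : 0 < CA := by linarith
    have e1 : Real.exp ((∑ h, (r h : ℝ) + 1) * Real.log C0) = C0 ^ (∑ h, r h + 1) := by
      have : (∑ h, (r h : ℝ) + 1) = ((∑ h, r h + 1 : ℕ) : ℝ) := by push_cast; rfl
      rw [this, Real.exp_nat_mul, Real.exp_log p0]
    have e2 : Real.exp ((∑ h, (r h : ℝ) + 1) * Real.log CA) = CA ^ (∑ h, r h + 1) := by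
      have : (∑ h, (r h : ℝ) + 1) = ((∑ h, r h + 1 : ℕ) : ℝ) := by push_cast; rfl
      rw [this, Real.exp_nat_mul, Real.exp_log p1]
    rw [e1, e2]
    have : CA ^ (∑ h, r h) ≤ CA ^ (∑ h, r h + 1) := pow_le_pow_right₀ hCA1 (by omega)
    gcongr
  have h11 := Real.exp_le_exp.1 (h9.trans h10)
  have hNpos : (0 : ℝ) < Fintype.card ι := by exact_mod_cast Fintype.card_pos
  have h12 : X0 ≤ R * m * (-(3 * s / (4 * Fintype.card ι))) := by
    rw [hX0]
    apply mul_le_mul_of_nonneg_left _ (by positivity)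
    have : -s / Fintype.card ι + s / (4 * Fintype.card ι) = -(3 * s / (4 * Fintype.card ι)) := by
      field_simp; ring
    linarith
  linarith
end Engine
end SubsThm
end

set_option linter.unusedSectionVars false
noncomputable section
namespace SubsThm
open Finset MvPolynomial

section Engine
variable {ι κ : Type*} [Fintype ι] [DecidableEq ι] [Fintype κ] [DecidableEq κ]

lemma exists_growth (lq : ℕ → ℝ) (hlq : Tendsto lq atTop atTop) (Λ X : ℝ) (hΛ : 0 < Λ) (hX : 1 ≤ X) :
    ∃ k : ℕ → ℕ, (∀ t, Λ ≤ lq (k t)) ∧ ∀ t t', t < t' → X * lq (k t) ≤ lq (k t') := by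
  have h1 : ∀ x : ℝ, ∃ n, x ≤ lq n := fun x => (hlq.eventually_ge_atTop x).exists
  choose f hf using h1
  let k : ℕ → ℕ := fun t => Nat.rec (f Λ) (fun _ p => f (max Λ (X * lq p))) t
  have hk : ∀ t, k (t+1) = f (max Λ (X * lq (k t))) := fun t => rfl
  have hΛk : ∀ t, Λ ≤ lq (k t) := by
    intro t
    cases t with
    | zero => exact hf Λ
    | succ t => rw [hk]; exact (le_max_left _ _).trans (hf _)
  have hs : ∀ t, X * lq (k t) ≤ lq (k (t+1)) := fun t => by
    rw [hk]; exact (le_max_right _ _).trans (hf _)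
  refine ⟨k, hΛk, fun t t' h => ?_⟩
  induction t', h using Nat.le_induction with
  | base => exact hs t
  | succ t' h ih =>
    refine ih.trans (le_trans ?_ (hs t'))
    have := hΛk t'
    nlinarith

lemma lH_neg (u v : ℤ) : lH (-u) v = lH u v := by simp [lH]

set_option maxHeartbeats 1000000 in
theorem engine [Nonempty ι] (A B : ι → ι → ℝ) (c0 : ℝ) (hc0 : 1 ≤ |c0|)
    (hBA : ∀ k j, ∑ i, B k i * A i j = if k = j then c0 else 0)
    (hB : ∀ k i, IsIntegral ℤ (B k i))
    (c : ι → ℝ) (hc : ∑ i, c i < 0) (c1 : ℝ) (hc1 : 0 < c1) (K : ℝ)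
    (lq : ℕ → ℝ) (hlq : Tendsto lq atTop atTop) (g : ℕ → κ → ι → ℤ)
    (hg : ∀ n k i, |∑ j, A i j * (g n k j : ℝ)| ≤ K * Real.exp (c i * lq n))
    (M : ℕ → ι → ℤ)
    (hspan : ∀ n (x : ι → ℚ), ∑ i, (M n i : ℚ) * x i = 0 → ∃ c : κ → ℚ, ∀ i, x i = ∑ k, c k * (g n k i : ℚ))
    (i0 i1 : ℕ → ι) (hM : ∀ n, M n (i0 n) ≠ 0) (hne : ∀ n, i0 n ≠ i1 n)
    (u v : ℕ → ℤ) (hcop : ∀ n, IsCoprime (u n) (v n)) (hv : ∀ n, v n ≠ 0)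
    (huv : ∀ n, u n * M n (i0 n) = v n * M n (i1 n))
    (hH : ∀ n, c1 * lq n ≤ lH (u n) (v n)) : False := by
  obtain ⟨C0, d, hC0, haux⟩ := aux_poly B hB
  set N : ℝ := (Fintype.card ι : ℝ) with hN
  have hNpos : 0 < N := by rw [hN]; exact_mod_cast Fintype.card_pos
  set s : ℝ := -∑ i, c i with hs
  have hs0 : 0 < s := by linarith
  set cs : ℝ := 1 + ∑ i, |c i| with hcsd
  have hcs1 : 1 ≤ cs := by
    have : 0 ≤ ∑ i, |c i| := Finset.sum_nonneg fun i _ => abs_nonneg _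
    linarith
  have hcs : ∀ i, |c i| ≤ cs := fun i => by
    have := Finset.single_le_sum (f := fun i => |c i|) (fun i _ => abs_nonneg _) (mem_univ i)
    linarith
  set η : ℝ := min 1 (s / (4 * N * cs * (N + 1))) with hηd
  have hη0 : 0 < η := by rw [hηd]; apply lt_min one_pos; positivity
  have hη1 : η ≤ 1 := min_le_left _ _
  have hη2 : cs * η * (N + 1) ≤ s / (4 * N) := by
    have h1 : η ≤ s / (4 * N * cs * (N + 1)) := min_le_right _ _
    have h2 : cs * (s / (4 * N * cs * (N + 1))) * (N + 1) = s / (4 * N) := by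
      field_simp
    rw [← h2]
    gcongr
  -- choice of m
  obtain ⟨m, hm1, hm2⟩ : ∃ m : ℕ, 1 ≤ m ∧ 2 * (d : ℝ) * N * Real.exp (-(m * η ^ 2 / 4)) ≤ 1 := by
    have t1 : Tendsto (fun m : ℕ => Real.exp (-((m : ℝ) * η ^ 2 / 4))) atTop (𝓝 0) := by
      apply Real.tendsto_exp_neg_atTop_nhds_zero.comp
      have : Tendsto (fun m : ℕ => (m : ℝ) * (η ^ 2 / 4)) atTop atTop :=
        tendsto_natCast_atTop_atTop.atTop_mul_const (by positivity)
      refine this.congr fun m => by ring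
    have t2 := t1.const_mul (2 * (d : ℝ) * N)
    rw [mul_zero] at t2
    have := (t2.eventually (ge_mem_nhds one_pos)).and (eventually_ge_atTop 1)
    obtain ⟨m, h1, h2⟩ := this.exists
    exact ⟨m, h2, h1⟩
  have hmR : (1 : ℝ) ≤ m := by exact_mod_cast hm1
  set ε : ℝ := s / (8 * N * cs) with hε
  have hε0 : 0 < ε := by positivity
  obtain ⟨ω, hω, hroth⟩ := roth m ε hε0
  set CA : ℝ := 1 + (∑ i, ∑ j, |A i j| + Fintype.card κ * |K|) with hCAd
  have hCA1 : 1 ≤ CA := by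
    have : 0 ≤ ∑ i, ∑ j, |A i j| := Finset.sum_nonneg fun i _ => Finset.sum_nonneg fun j _ => abs_nonneg _
    have : 0 ≤ Fintype.card κ * |K| := by positivity
    linarith
  have hl0 : 0 ≤ Real.log C0 := Real.log_nonneg hC0
  have hlA : 0 ≤ Real.log CA := Real.log_nonneg hCA1
  set Λ : ℝ := 1 + 6 * N * (Real.log C0 + Real.log CA) / s + 3 * m * (Real.log C0 + 1) / (ω * c1) with hΛd
  have hΛa : 6 * N * (Real.log C0 + Real.log CA) / s < Λ := by
    have : 0 ≤ 3 * m * (Real.log C0 + 1) / (ω * c1) := by positivity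
    linarith
  have hΛb : 3 * m * (Real.log C0 + 1) / (ω * c1) ≤ Λ := by
    have : 0 ≤ 6 * N * (Real.log C0 + Real.log CA) / s := by positivity
    linarith
  have hΛ1 : 1 ≤ Λ := by
    have : 0 ≤ 3 * m * (Real.log C0 + 1) / (ω * c1) := by positivity
    have : 0 ≤ 6 * N * (Real.log C0 + Real.log CA) / s := by positivity
    linarith
  have hΛ0 : 0 < Λ := by linarith
  obtain ⟨k, hk1, hk2⟩ := exists_growth lq hlq Λ (2 / ω + 1) hΛ0 (by
    have : 0 < 2 / ω := by positivity
    linarith)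
  let n : Fin m → ℕ := fun h => k (m - 1 - h)
  set l : Fin m → ℝ := fun h => lq (n h) with hl
  have hlΛ : ∀ h, Λ ≤ l h := fun h => hk1 _
  have hlpos : ∀ h, 0 < l h := fun h => hΛ0.trans_le (hlΛ h)
  have hlgrow : ∀ i j : Fin m, i < j → 2 * l j ≤ ω * l i := by
    intro i j hij
    have := hk2 (m - 1 - j) (m - 1 - i) (by have := j.2; have : (i : ℕ) < j := hij; omega)
    have h2 : (2 / ω + 1) * l j ≤ l i := this
    have h3 : ω * ((2 / ω + 1) * l j) = 2 * l j + ω * l j := by field_simp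
    have := mul_le_mul_of_nonneg_left h2 hω.le
    have := mul_pos hω (hlpos j)
    linarith
  set R : ℝ := (∑ h, l h) / η with hRd
  have hlR : ∀ h, l h ≤ η * R := by
    intro h
    have := Finset.single_le_sum (f := l) (fun i _ => (hlpos i).le) (mem_univ h)
    rw [hRd, mul_div_cancel₀ _ hη0.ne']
    exact this
  have hRΛ : Λ ≤ R := by
    have h0 := (hlΛ ⟨0, hm1⟩).trans (hlR _)
    have : 0 ≤ R := by rw [hRd]; exact div_nonneg (Finset.sum_nonneg fun i _ => (hlpos i).le) hη0.le
    nlinarith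
  have hR0 : 0 < R := by linarith
  set r : Fin m → ℕ := fun h => ⌈R / l h⌉₊ with hrd
  have hr0 : ∀ h, 0 < r h := fun h => Nat.ceil_pos.2 (div_pos hR0 (hlpos h))
  have h1 : ∀ h, R ≤ r h * l h := by
    intro h
    have := Nat.le_ceil (R / l h)
    rwa [div_le_iff₀ (hlpos h)] at this
  have h2 : ∀ h, r h * l h ≤ (1 + η) * R := by
    intro h
    have h3 : (r h : ℝ) < R / l h + 1 := Nat.ceil_lt_add_one (div_pos hR0 (hlpos h)).le
    have h4 := mul_le_mul_of_nonneg_right h3.le (hlpos h).le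
    rw [add_mul, div_mul_cancel₀ _ (hlpos h).ne'] at h4
    linarith [hlR h]
  have hr2 : ∀ h, (r h : ℝ) ≤ 2 * R / Λ := by
    intro h
    rw [le_div_iff₀ hΛ0]
    have a1 : (r h : ℝ) * Λ ≤ r h * l h := mul_le_mul_of_nonneg_left (hlΛ h) (Nat.cast_nonneg _)
    nlinarith [h2 h]
  have hS : ∑ h, (r h : ℝ) + 1 ≤ 3 * m * R / Λ := by
    have a1 : ∑ h, (r h : ℝ) ≤ ∑ h : Fin m, 2 * R / Λ := Finset.sum_le_sum fun h _ => hr2 h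
    simp only [Finset.sum_const, Finset.card_univ, Fintype.card_fin, nsmul_eq_mul] at a1
    have a2 : 1 ≤ m * R / Λ := by
      rw [le_div_iff₀ hΛ0]; nlinarith
    have a3 : (m : ℝ) * (2 * R / Λ) + m * R / Λ = 3 * m * R / Λ := by ring
    linarith
  obtain ⟨P, hP0, hPh, hPn, hGn, hGs⟩ := haux m η hη0 hη1 hm2 r hr0
  have hidx := index_bound (κ := κ) A B c0 hc0 hBA c cs η R hcs hη0.le hη1 hR0.le s (by rw [hs]; ring) hs0.le l
    (fun h => (hlpos h).le) r hr0 h1 h2 P hPh C0 hC0 hGn hGs (fun h => i0 (n h)) (fun h => g (n h)) |K| CA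
    (fun h k i => (hg (n h) k i).trans (mul_le_mul_of_nonneg_right (le_abs_self K) (Real.exp_pos _).le)) hCA1
    (by linarith) ε hη2 (by
      have a1 : (∑ h, (r h : ℝ) + 1) * (Real.log C0 + Real.log CA) ≤ 3 * m * R / Λ * (Real.log C0 + Real.log CA) :=
        mul_le_mul_of_nonneg_right hS (by linarith)
      have a2 : 3 * m * R / Λ * (Real.log C0 + Real.log CA) < R * m * (s / (2 * N)) := by
        rw [div_lt_iff₀ hs0] at hΛa
        rw [div_mul_eq_mul_div, div_lt_iff₀ hΛ0]
        have : R * m * (s / (2 * N)) * Λ - 3 * m * R * (Real.log C0 + Real.log CA) =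
          R * m / (2 * N) * (Λ * s - 6 * N * (Real.log C0 + Real.log CA)) := by field_simp; ring
        have : 0 < R * m / (2 * N) * (Λ * s - 6 * N * (Real.log C0 + Real.log CA)) := by
          apply mul_pos (by positivity); linarith
        linarith
      have a3 : 2 * cs * R * ε = R * (s / (4 * N)) := by rw [hε]; field_simp; ring
      have a4 : R * (s / (4 * N)) ≤ R * m * (s / (4 * N)) := by
        apply mul_le_mul_of_nonneg_right _ (by positivity)
        nlinarith
      have a5 : R * m * (3 * s / (4 * N)) = R * m * (s / (2 * N)) + R * m * (s / (4 * N)) := by field_simp; ring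
      rw [a3, a5]
      linarith)
  obtain ⟨p, hp0, hpd, hpn, hpi⟩ := descent r P hP0 hPh (fun h => i0 (n h)) (fun h => i1 (n h)) (fun h => hne _)
    (fun h => g (n h)) (fun h => M (n h)) (fun h => hM _) (fun h => hspan _)
    (fun h => (((-u (n h) : ℤ) : ℚ) / (v (n h) : ℚ))) (by
      intro h
      have q1 : (v (n h) : ℚ) ≠ 0 := by exact_mod_cast hv _
      have q2 : (M (n h) (i0 (n h)) : ℚ) ≠ 0 := by exact_mod_cast hM _
      rw [div_eq_div_iff q1 q2]
      have := huv (n h)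
      have h3 : (u (n h) : ℚ) * M (n h) (i0 (n h)) = v (n h) * M (n h) (i1 (n h)) := by exact_mod_cast this
      push_cast
      linarith) ε hidx
  refine hroth r (∑ h, r h) (fun h => -u (n h)) (fun h => v (n h)) p hr0
    (fun h => Finset.single_le_sum (f := r) (fun _ _ => Nat.zero_le _) (mem_univ h)) ?_
    (fun h => (hcop (n h)).neg_left) (fun h => hv _) hp0 hpd ?_ hpi
  · intro i j hij
    have a1 := hlgrow i j hij
    have a2 := h1 j
    have a3 : r i * l i ≤ 2 * R := by nlinarith [h2 i]
    have a4 : (r i : ℝ) * l i ≤ ω * r j * l i := by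
      have : 2 * R ≤ 2 * (r j * l j) := by linarith
      have : (r j : ℝ) * (2 * l j) ≤ r j * (ω * l i) := mul_le_mul_of_nonneg_left a1 (Nat.cast_nonneg _)
      nlinarith
    exact le_of_mul_le_mul_right a4 (hlpos i)
  · intro h
    rw [lH_neg]
    have a1 : Real.log (nrm (fun _ => 1) p) ≤ (∑ h, (r h : ℝ) + 1) * Real.log C0 := by
      have : (∑ h, (r h : ℝ) + 1) = ((∑ h, r h + 1 : ℕ) : ℝ) := by push_cast; rfl
      rw [this, ← Real.log_pow]
      exact Real.log_le_log (lt_of_lt_of_le one_pos (one_le_nrm p hp0)) (hpn.trans hPn)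
    have a2 : c1 * l h ≤ lH (u (n h)) (v (n h)) := hH (n h)
    have a3 : ω * (R * c1) ≤ ω * r h * lH (u (n h)) (v (n h)) := by
      rw [mul_assoc]
      apply mul_le_mul_of_nonneg_left _ hω.le
      calc R * c1 ≤ r h * l h * c1 := mul_le_mul_of_nonneg_right (h1 h) hc1.le
        _ = r h * (c1 * l h) := by ring
        _ ≤ _ := mul_le_mul_of_nonneg_left a2 (Nat.cast_nonneg _)
    refine le_trans ?_ a3
    have a4 : 3 * m * R / Λ * (Real.log C0 + 1) ≤ ω * (R * c1) := by
      rw [div_le_iff₀ (by positivity)] at hΛb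
      rw [div_mul_eq_mul_div, div_le_iff₀ hΛ0]
      nlinarith
    have a5 := mul_le_mul_of_nonneg_right hS (show 0 ≤ Real.log C0 + 1 by linarith)
    push_cast
    linarith
end Engine
end SubsThm
end

set_option linter.unusedSectionVars false
noncomputable section
namespace SubsThm
open Finset

section Pivot
variable {ι G : Type*} [Fintype ι] [AddCommGroup G]

set_option maxHeartbeats 1000000 in
theorem pivot (n : ℕ) : ∀ (φ : G →+ (ι → ℝ)) (γ : Fin n → G) (m : Fin n → ℝ), Monotone m →
    (∀ k i, |φ (γ k) i| ≤ m k) → LinearIndependent ℝ (fun k => φ (γ k)) →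
    ∃ (π : Fin n → ι) (γ' : Fin n → G), Function.Injective π ∧
      (∀ k, γ k ∈ Submodule.span ℤ (Set.range γ')) ∧
      (∀ k j, |φ (γ' k) (π j)| ≤ 3 ^ n * m j) ∧
      (∀ b, (∀ k, m k ≤ b) → ∀ k i, |φ (γ' k) i| ≤ 3 ^ n * b) ∧
      (∀ j, ∃ k, φ (γ k) (π j) ≠ 0) ∧
      (∀ k, ∀ y ∈ Submodule.span ℝ ((fun k => φ (γ k)) '' Set.Iic k), ∀ B, (∀ i ≤ k, |y (π i)| ≤ B) →
        ∀ i, |y i| ≤ 3 ^ n * B) := by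
  induction n with
  | zero =>
    intro φ γ m _ _ _
    exact ⟨Fin.elim0, Fin.elim0, fun a => a.elim0, fun a => a.elim0, fun a => a.elim0, fun _ _ a => a.elim0,
      fun a => a.elim0, fun a => a.elim0⟩
  | succ n ih =>
    intro φ γ m hm hb hli
    have hC : (1 : ℝ) ≤ 3 ^ n := one_le_pow₀ (by norm_num)
    set f0 : ι → ℝ := φ (γ 0) with hf0
    have hf0ne : f0 ≠ 0 := hli.ne_zero 0
    obtain ⟨j0, hj0⟩ : ∃ j, f0 j ≠ 0 := by
      by_contra! h; exact hf0ne (funext h)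
    have : Nonempty ι := ⟨j0⟩
    obtain ⟨p0, hp0⟩ := Finite.exists_max (fun i => |f0 i|)
    have hp0ne : f0 p0 ≠ 0 := by
      have := lt_of_lt_of_le (abs_pos.2 hj0) (hp0 j0)
      exact abs_pos.1 this
    -- projected map on vectors
    let pr : (ι → ℝ) →ₗ[ℝ] (ι → ℝ) := LinearMap.id - (LinearMap.toSpanSingleton ℝ (ι → ℝ) f0).comp
      ((f0 p0)⁻¹ • LinearMap.proj p0)
    have hpr : ∀ y i, pr y i = y i - (y p0 / f0 p0) * f0 i := by
      intro y i
      show y i - ((f0 p0)⁻¹ * y p0) * f0 i = _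
      ring
    have hpr0 : ∀ y, pr y p0 = 0 := by intro y; rw [hpr]; field_simp; ring
    have hprabs : ∀ (y : ι → ℝ) i, |(y p0 / f0 p0) * f0 i| ≤ |y p0| := by
      intro y i
      rw [abs_mul, abs_div]
      have := abs_pos.2 hp0ne
      rw [div_mul_eq_mul_div, div_le_iff₀ this]
      exact mul_le_mul_of_nonneg_left (hp0 i) (abs_nonneg _)
    have hpry : ∀ (y : ι → ℝ) i, y i = pr y i + (y p0 / f0 p0) * f0 i := by intro y i; rw [hpr]; ring
    let φ1 : G →+ (ι → ℝ) := pr.toAddMonoidHom.comp φ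
    have hφ1 : ∀ x, φ1 x = pr (φ x) := fun x => rfl
    have hmn : ∀ k, 0 ≤ m k := fun k => (abs_nonneg _).trans (hb k p0)
    have hli1 : LinearIndependent ℝ (fun k : Fin n => φ1 (γ k.succ)) := by
      rw [Fintype.linearIndependent_iff] at hli ⊢
      intro a ha i
      have h1 : ∑ k, a k • φ (γ k.succ) = ((∑ k, a k • φ (γ k.succ)) p0 / f0 p0) • f0 := by
        have h2 : pr (∑ k, a k • φ (γ k.succ)) = 0 := by
          rw [map_sum]; simp only [map_smul]; exact ha
        funext i
        have := hpry (∑ k, a k • φ (γ k.succ)) i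
        rw [h2] at this
        simpa using this
      have := hli (Fin.cons (-((∑ k, a k • φ (γ k.succ)) p0 / f0 p0)) a) (by
        rw [Fin.sum_univ_succ]
        simp only [Fin.cons_zero, Fin.cons_succ]
        rw [← hf0]
        nth_rewrite 2 [h1]
        rw [neg_smul, neg_add_cancel]) i.succ
      simpa using this
    obtain ⟨π, γ', hπ, hsp, hb1, hb2, hnz, hdom⟩ := ih φ1 (fun k => γ k.succ) (fun k => 2 * m k.succ)
      (fun i j hij => by
        have := hm (Fin.succ_le_succ_iff.2 hij)
        simp only; linarith) (by
        intro k i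
        rw [hφ1, hpr]
        refine (abs_sub _ _).trans ?_
        have := hprabs (φ (γ k.succ)) i
        linarith [hb k.succ i, hb k.succ p0]) hli1
    let t : Fin n → ℤ := fun k => round (φ (γ' k) p0 / f0 p0)
    let γ2 : Fin n → G := fun k => γ' k - t k • γ 0
    have hγ2 : ∀ k i, |φ (γ2 k) i| ≤ |φ1 (γ' k) i| + |f0 i| := by
      intro k i
      have : φ (γ2 k) i = φ1 (γ' k) i + (φ (γ' k) p0 / f0 p0 - t k) * f0 i := by
        have e1 : φ (γ2 k) i = φ (γ' k) i - (t k • f0) i := by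
          simp only [γ2, map_sub, map_zsmul, Pi.sub_apply, ← hf0]
        rw [e1, hφ1, hpr, Pi.smul_apply, zsmul_eq_mul]
        ring
      rw [this]
      refine (abs_add_le _ _).trans (add_le_add le_rfl ?_)
      rw [abs_mul]
      have h1 : |φ (γ' k) p0 / f0 p0 - t k| ≤ 1 := (abs_sub_round _).trans (by norm_num)
      calc _ ≤ 1 * |f0 i| := mul_le_mul_of_nonneg_right h1 (abs_nonneg _)
        _ = _ := one_mul _
    have hf0b : ∀ i, |f0 i| ≤ m 0 := fun i => hb 0 i
    refine ⟨Fin.cons p0 π, Fin.cons (γ 0) γ2, ?_, ?_, ?_, ?_, ?_, ?_⟩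
    · rw [Fin.cons_injective_iff]
      refine ⟨?_, hπ⟩
      rintro ⟨j, hj⟩
      obtain ⟨k, hk⟩ := hnz j
      apply hk
      rw [hj]; exact hpr0 _
    · have h0 : γ 0 ∈ Submodule.span ℤ (Set.range (Fin.cons (γ 0) γ2 : Fin (n+1) → G)) :=
        Submodule.subset_span ⟨0, rfl⟩
      intro k
      refine Fin.cases h0 (fun k => ?_) k
      refine (Submodule.span_le.2 ?_) (hsp k)
      rintro _ ⟨j, rfl⟩
      have : γ' j = γ2 j + t j • γ 0 := by simp [γ2]
      rw [this]
      exact Submodule.add_mem _ (Submodule.subset_span ⟨j.succ, by simp⟩) (Submodule.smul_mem _ _ h0)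
    · intro k j
      have hm0 : ∀ j, m 0 ≤ m j := fun j => hm (Fin.zero_le j)
      have e0 : ∀ j, m 0 ≤ 3 ^ (n+1) * m j := fun j => by
        have := hm0 j
        have h3 : (1 : ℝ) ≤ 3 ^ (n+1) := one_le_pow₀ (by norm_num)
        nlinarith [hmn j]
      refine Fin.cases ?_ (fun k => ?_) k
      · simp only [Fin.cons_zero]
        exact (hb 0 _).trans (e0 j)
      · simp only [Fin.cons_succ]
        refine (hγ2 k _).trans ?_
        refine Fin.cases ?_ (fun j => ?_) j
        · simp only [Fin.cons_zero]
          rw [hφ1, hpr0, abs_zero, zero_add]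
          exact (hf0b _).trans (e0 0)
        · simp only [Fin.cons_succ]
          have a1 := hb1 k j
          have a2 := hf0b (π j)
          have a3 := hm0 j.succ
          rw [pow_succ]
          nlinarith [hmn j.succ]
    · intro b hbb k i
      have hb0 : 0 ≤ b := (hmn 0).trans (hbb 0)
      refine Fin.cases ?_ (fun k => ?_) k
      · simp only [Fin.cons_zero]
        have h3 : (1 : ℝ) ≤ 3 ^ (n+1) := one_le_pow₀ (by norm_num)
        refine ((hb 0 i).trans (hbb 0)).trans ?_
        nlinarith
      · simp only [Fin.cons_succ]
        refine (hγ2 k i).trans ?_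
        have a1 := hb2 (2 * b) (fun k => by linarith [hbb k.succ]) k i
        have a2 := (hf0b i).trans (hbb 0)
        rw [pow_succ]
        nlinarith
    · intro j
      refine Fin.cases ⟨0, by simpa using hp0ne⟩ (fun j => ?_) j
      simp only [Fin.cons_succ]
      obtain ⟨k, hk⟩ := hnz j
      rw [hφ1, hpr] at hk
      by_contra! hall
      apply hk
      rw [hall k.succ, hf0, hall 0]; ring
    · intro k y hy B hB i
      have hB0 : 0 ≤ B := (abs_nonneg _).trans (hB 0 (Fin.zero_le k))
      have hyp : |y p0| ≤ B := by simpa using hB 0 (Fin.zero_le k)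
      have hmain : ∀ i, |pr y i| ≤ 3 ^ n * (2 * B) := by
        revert hy hB
        refine Fin.cases (fun hy hB i => ?_) (fun k hy hB i => ?_) k
        · have : pr y = 0 := by
            have hle : Submodule.span ℝ ((fun k => φ (γ k)) '' Set.Iic (0 : Fin (n+1))) ≤ LinearMap.ker pr := by
              rw [Submodule.span_le]
              rintro _ ⟨j, hj, rfl⟩
              have : j = 0 := Fin.le_zero_iff.1 hj
              subst this
              rw [SetLike.mem_coe, LinearMap.mem_ker]
              funext i
              show pr f0 i = 0
              rw [hpr]; field_simp; ring
            exact hle hy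
          rw [this]; simp only [Pi.zero_apply, abs_zero]; positivity
        · refine hdom k (pr y) ?_ (2 * B) ?_ i
          · have hle : Submodule.span ℝ ((fun k => φ (γ k)) '' Set.Iic k.succ) ≤
                (Submodule.span ℝ ((fun k => φ1 (γ k.succ)) '' Set.Iic k)).comap pr := by
              rw [Submodule.span_le]
              rintro _ ⟨j, hj, rfl⟩
              rw [SetLike.mem_coe, Submodule.mem_comap]
              revert hj
              refine Fin.cases (fun _ => ?_) (fun j hj => ?_) j
              · have : pr f0 = 0 := by
                  funext i
                  rw [hpr]; simp; field_simp; ring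
                simp only
                rw [← hf0, this]; exact Submodule.zero_mem _
              · exact Submodule.subset_span ⟨j, Fin.succ_le_succ_iff.1 hj, rfl⟩
            exact hle hy
          · intro j hj
            have := hB j.succ (Fin.succ_le_succ_iff.2 hj)
            simp only [Fin.cons_succ] at this
            rw [hpr]
            refine (abs_sub _ _).trans ?_
            have := hprabs y (π j)
            linarith
      rw [hpry y i]
      refine (abs_add_le _ _).trans ?_
      have a1 := hmain i
      have a2 := hprabs y i
      rw [pow_succ]
      nlinarith
end Pivot
end SubsThm
end

set_option linter.unusedSectionVars false
noncomputable section
namespace SubsThm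
open Finset

section Engine2
variable {ι κ G : Type*} [Fintype ι] [DecidableEq ι] [Fintype κ] [DecidableEq κ] [AddCommGroup G]

theorem pivot_gen (φ : G →+ (ι → ℝ)) (γ : κ → G) (m : κ → ℝ) (mx : ℝ) (hmx : ∀ k, m k ≤ mx)
    (hb : ∀ k i, |φ (γ k) i| ≤ m k) (hli : LinearIndependent ℝ (fun k => φ (γ k))) :
    ∃ (π : κ → ι) (γ' : κ → G), Function.Injective π ∧
      (∀ k, γ k ∈ Submodule.span ℤ (Set.range γ')) ∧
      (∀ k j, |φ (γ' k) (π j)| ≤ 3 ^ (Fintype.card κ) * m j) ∧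
      (∀ k i, |φ (γ' k) i| ≤ 3 ^ (Fintype.card κ) * mx) := by
  let e0 := (Fintype.equivFin κ).symm
  let e : Fin (Fintype.card κ) ≃ κ := (Tuple.sort (m ∘ e0)).trans e0
  obtain ⟨π, γ', h1, h2, h3, h4, -, -⟩ := pivot (Fintype.card κ) φ (γ ∘ e) (m ∘ e)
    (Tuple.monotone_sort (m ∘ e0)) (fun k i => hb _ _) (hli.comp e e.injective)
  refine ⟨π ∘ e.symm, γ' ∘ e.symm, h1.comp e.symm.injective, ?_, ?_, ?_⟩
  · intro k
    have := h2 (e.symm k)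
    rw [Function.comp_apply, e.apply_symm_apply] at this
    rwa [EquivLike.range_comp]
  · intro k j
    have := h3 (e.symm k) (e.symm j)
    have e1 : (m ∘ e) (e.symm j) = m j := by simp
    rw [e1] at this
    exact this
  · intro k i
    exact h4 mx (fun k => hmx _) _ _

lemma exists_den (B : ι → ι → ℝ) (hB : ∀ k i, IsAlgebraic ℤ (B k i)) :
    ∃ D : ℤ, D ≠ 0 ∧ ∀ k i, IsIntegral ℤ ((D : ℝ) * B k i) := by
  have h1 : ∀ p : ι × ι, ∃ D : ℤ, D ≠ 0 ∧ IsIntegral ℤ ((D : ℝ) * B p.1 p.2) := by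
    intro p
    obtain ⟨D, hD, h⟩ := (hB p.1 p.2).exists_integral_multiple
    refine ⟨D, hD, ?_⟩
    rwa [zsmul_eq_mul] at h
  choose D hD h using h1
  refine ⟨∏ p, D p, Finset.prod_ne_zero_iff.2 fun p _ => hD p, fun k i => ?_⟩
  rw [← Finset.mul_prod_erase _ _ (mem_univ (k, i))]
  push_cast
  rw [mul_comm (D (k,i) : ℝ), mul_assoc]
  have := h (k, i)
  refine IsIntegral.mul ?_ this
  have e : (∏ x ∈ univ.erase (k, i), (D x : ℝ)) = ((∏ x ∈ univ.erase (k, i), D x : ℤ) : ℝ) := by push_cast; rfl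
  rw [e]
  exact isIntegral_algebraMap (R := ℤ)

lemma sum_pivot (π : κ → ι) (hπ : Function.Injective π) (hcard : Fintype.card κ + 1 = Fintype.card ι)
    (l : κ → ℝ) (lm : ℝ) (e : ι → ℝ) (h1 : ∀ k, e (π k) = l k) (h2 : ∀ i, (∀ k, π k ≠ i) → e i = lm) :
    ∑ i, e i = ∑ k, l k + lm := by
  rw [← Finset.sum_add_sum_compl (univ.image π) e, Finset.sum_image (fun a _ b _ h => hπ h)]
  simp only [h1]
  congr 1
  have h3 : (univ.image π)ᶜ.card = 1 := by
    rw [Finset.card_compl, Finset.card_image_of_injective _ hπ, Finset.card_univ]; omega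
  obtain ⟨i, hi⟩ := Finset.card_eq_one.1 h3
  rw [hi, Finset.sum_singleton]
  apply h2
  intro k hk
  have : i ∈ (univ.image π)ᶜ := by rw [hi]; simp
  rw [mem_compl] at this
  exact this (mem_image.2 ⟨k, mem_univ _, hk⟩)

set_option maxHeartbeats 1000000 in
theorem engine2 [Nonempty ι] (A B : Matrix ι ι ℝ) (hBA : B * A = 1) (hB : ∀ k i, IsAlgebraic ℤ (B k i))
    (lq : ℕ → ℝ) (hlq : Tendsto lq atTop atTop) (Γ Γs : ℕ → Matrix ι ι ℤ) (d : ℕ → ℤ) (hd : ∀ n, d n ≠ 0)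
    (hΓ : ∀ n, Γ n * Γs n = d n • (1 : Matrix ι ι ℤ)) (k0 : ι) (c l : ℕ → ι → ℝ) (lm : ℕ → ℝ)
    (K Kb ε c1 : ℝ) (hK : 0 ≤ K) (hε : 0 < ε) (hc1 : 0 < c1)
    (hA : ∀ n k i, |∑ j, A i j * (Γ n k j : ℝ)| ≤ K * Real.exp ((c n i + l n k) * lq n))
    (hlm : ∀ n k, k ≠ k0 → l n k ≤ lm n)
    (hcb : ∀ n i, |c n i| ≤ Kb) (hlb : ∀ n k, |l n k| ≤ Kb) (hlmb : ∀ n, |lm n| ≤ Kb)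
    (hsum : ∀ n, ∑ i, c n i + ∑ k ∈ univ.erase k0, l n k + lm n ≤ -ε)
    (hht : ∀ n, ∃ (i0 i1 : ι) (u v : ℤ), i0 ≠ i1 ∧ Γs n i0 k0 ≠ 0 ∧ IsCoprime u v ∧ v ≠ 0 ∧
      u * Γs n i0 k0 = v * Γs n i1 k0 ∧ c1 * lq n ≤ lH u v) : False := by
  obtain ⟨D, hD0, hD⟩ := exists_den B hB
  -- restrict to n with lq ≥ 0
  obtain ⟨n0, hn0⟩ := eventually_atTop.1 (hlq.eventually_ge_atTop 0)
  -- pivoting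
  have hpiv : ∀ n, n0 ≤ n → ∃ (c' : ι → ℝ) (g : {k // k ≠ k0} → ι → ℤ), (∀ i, |c' i| ≤ 2 * Kb) ∧ ∑ i, c' i ≤ -ε ∧
      (∀ k i, |∑ j, A i j * (g k j : ℝ)| ≤ (3 ^ (Fintype.card {k // k ≠ k0}) * K) * Real.exp (c' i * lq n)) ∧
      ∀ x : ι → ℚ, ∑ i, (Γs n i k0 : ℚ) * x i = 0 → ∃ a : {k // k ≠ k0} → ℚ, ∀ i, x i = ∑ k, a k * (g k i : ℚ) := by
    intro n hn
    have hlq0 := hn0 n hn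
    let φ : (ι → ℤ) →+ (ι → ℝ) :=
      { toFun := fun x i => Real.exp (-(c n i * lq n)) * ∑ j, A i j * (x j : ℝ)
        map_zero' := by funext i; simp
        map_add' := by
          intro x y; funext i
          simp only [Pi.add_apply, Int.cast_add, mul_add, Finset.sum_add_distrib] }
    have hφ : ∀ x i, φ x i = Real.exp (-(c n i * lq n)) * ∑ j, A i j * (x j : ℝ) := fun x i => rfl
    have hli : LinearIndependent ℝ (fun k : {k // k ≠ k0} => φ (Γ n k)) := by
      have : LinearIndependent ℝ (fun k : ι => φ (Γ n k)) := by
        rw [Fintype.linearIndependent_iff]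
        intro a ha
        set y : ι → ℝ := fun j => ∑ k, a k * (Γ n k j : ℝ) with hy
        have h1 : A.mulVec y = 0 := by
          funext i
          have h2 := congrFun ha i
          simp only [Finset.sum_apply, Pi.smul_apply, hφ, smul_eq_mul, Pi.zero_apply] at h2
          have h3 : Real.exp (-(c n i * lq n)) * (A.mulVec y) i = 0 := by
            rw [← h2, Matrix.mulVec, dotProduct, hy]
            simp only [Finset.mul_sum]
            rw [Finset.sum_comm]
            refine Finset.sum_congr rfl fun k _ => Finset.sum_congr rfl fun j _ => by ring
          exact (mul_eq_zero.1 h3).resolve_left (Real.exp_pos _).ne'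
        have h4 : y = 0 := by
          have : (B * A).mulVec y = 0 := by rw [← Matrix.mulVec_mulVec, h1, Matrix.mulVec_zero]
          rwa [hBA, Matrix.one_mulVec] at this
        intro k
        have h5 : ∑ j, y j * (Γs n j k : ℝ) = d n * a k := by
          simp only [hy, Finset.sum_mul]
          rw [Finset.sum_comm]
          have : ∀ k', ∑ j, a k' * (Γ n k' j : ℝ) * (Γs n j k : ℝ) = a k' * ((Γ n * Γs n) k' k : ℤ) := by
            intro k'
            rw [Matrix.mul_apply]; push_cast; rw [Finset.mul_sum]
            refine Finset.sum_congr rfl fun j _ => by ring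
          simp only [this, hΓ, Matrix.smul_apply, Matrix.one_apply]
          simp [mul_comm]
        rw [h4] at h5
        simp only [Pi.zero_apply, zero_mul, Finset.sum_const_zero] at h5
        have : (d n : ℝ) ≠ 0 := by exact_mod_cast hd n
        exact (mul_eq_zero.1 h5.symm).resolve_left this
      exact this.comp _ Subtype.val_injective
    obtain ⟨π, g, hπ, hsp, hb1, hb2⟩ := pivot_gen φ (fun k : {k // k ≠ k0} => Γ n k)
      (fun k => K * Real.exp (l n k * lq n)) (K * Real.exp (lm n * lq n)) (by
        intro k
        exact mul_le_mul_of_nonneg_left (Real.exp_le_exp.2 (mul_le_mul_of_nonneg_right (hlm n k k.2) hlq0)) hK) (by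
        intro k i
        rw [hφ, abs_mul, abs_of_pos (Real.exp_pos _)]
        refine (mul_le_mul_of_nonneg_left (hA n k i) (Real.exp_pos _).le).trans (le_of_eq ?_)
        rw [mul_left_comm, ← Real.exp_add]; congr 2; ring) hli
    classical
    set e : ι → ℝ := fun i => if h : ∃ k, π k = i then l n h.choose else lm n with he
    have he1 : ∀ k, e (π k) = l n k := by
      intro k
      have h : ∃ k', π k' = π k := ⟨k, rfl⟩
      simp only [he, dif_pos h]
      rw [hπ h.choose_spec]
    have he2 : ∀ i, (∀ k, π k ≠ i) → e i = lm n := by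
      intro i hi
      simp only [he]
      rw [dif_neg]; push Not; exact hi
    refine ⟨fun i => c n i + e i, g, ?_, ?_, ?_, ?_⟩
    · intro i
      refine (abs_add_le _ _).trans ?_
      have : |e i| ≤ Kb := by
        by_cases h : ∃ k, π k = i
        · obtain ⟨k, rfl⟩ := h
          rw [he1]; exact hlb n _
        · push Not at h
          rw [he2 i h]; exact hlmb n
      linarith [hcb n i]
    · rw [Finset.sum_add_distrib, sum_pivot π hπ (by
        rw [Fintype.card_subtype_compl, Fintype.card_subtype_eq]
        have : 0 < Fintype.card ι := Fintype.card_pos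
        omega) (fun k => l n k) (lm n) e he1 he2]
      have : ∑ k : {k // k ≠ k0}, l n k = ∑ k ∈ univ.erase k0, l n k :=
        (Finset.sum_subtype (univ.erase k0) (by simp) _).symm
      rw [this, ← add_assoc]
      exact hsum n
    · intro k i
      have h1 : ∑ j, A i j * (g k j : ℝ) = Real.exp (c n i * lq n) * φ (g k) i := by
        rw [hφ, ← mul_assoc, ← Real.exp_add]; simp
      rw [h1, abs_mul, abs_of_pos (Real.exp_pos _), add_mul, Real.exp_add]
      have h2 : |φ (g k) i| ≤ 3 ^ Fintype.card {k // k ≠ k0} * (K * Real.exp (e i * lq n)) := by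
        by_cases h : ∃ k, π k = i
        · obtain ⟨k', rfl⟩ := h
          rw [he1]; exact hb1 k k'
        · push Not at h
          rw [he2 i h]; exact hb2 k i
      refine (mul_le_mul_of_nonneg_left h2 (Real.exp_pos _).le).trans (le_of_eq ?_)
      ring
    · intro x hx
      -- integer combinations
      have hcomb : ∀ k : {k // k ≠ k0}, ∃ a : {k // k ≠ k0} → ℤ, ∀ i, Γ n k i = ∑ k', a k' * g k' i := by
        intro k
        obtain ⟨a, ha⟩ := (Submodule.mem_span_range_iff_exists_fun ℤ).1 (hsp k)
        refine ⟨a, fun i => ?_⟩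
        rw [← ha]
        simp [Finset.sum_apply]
      choose a ha using hcomb
      have hΓ' : Γs n * Γ n = d n • (1 : Matrix ι ι ℤ) := by
        have h1 : (Γ n * Γs n) * Γ n = Γ n * (d n • (1 : Matrix ι ι ℤ)) := by
          rw [hΓ, Matrix.smul_mul, Matrix.mul_smul, Matrix.one_mul, Matrix.mul_one]
        have hdet : (Γ n).det ≠ 0 := by
          intro h0
          have := congrArg Matrix.det (hΓ n)
          rw [Matrix.det_mul, h0, zero_mul, Matrix.det_smul, Matrix.det_one, mul_one] at this
          exact pow_ne_zero _ (hd n) this.symm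
        rw [Matrix.mul_assoc] at h1
        have h2 : Γ n * (Γs n * Γ n - d n • (1 : Matrix ι ι ℤ)) = 0 := by rw [Matrix.mul_sub, h1, sub_self]
        have h3 : (Γ n).det • (Γs n * Γ n - d n • (1 : Matrix ι ι ℤ)) = 0 := by
          have := congrArg (fun X => (Γ n).adjugate * X) h2
          simp only [Matrix.mul_zero] at this
          rwa [← Matrix.mul_assoc, Matrix.adjugate_mul, Matrix.smul_mul, Matrix.one_mul] at this
        exact sub_eq_zero.1 ((smul_eq_zero.1 h3).resolve_left hdet)
      have hdq : (d n : ℚ) ≠ 0 := by exact_mod_cast hd n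
      set b : ι → ℚ := fun k => ∑ i, (Γs n i k : ℚ) * x i with hb
      have hxb : ∀ i, x i = ∑ k, (b k / d n) * (Γ n k i : ℚ) := by
        intro i
        have h1 : ∑ k, b k * (Γ n k i : ℚ) = d n * x i := by
          simp only [hb, Finset.sum_mul]
          rw [Finset.sum_comm]
          have : ∀ j, ∑ k, (Γs n j k : ℚ) * x j * (Γ n k i : ℚ) = x j * ((Γs n * Γ n) j i : ℤ) := by
            intro j
            rw [Matrix.mul_apply]; push_cast; rw [Finset.mul_sum]
            refine Finset.sum_congr rfl fun k _ => by ring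
          simp only [this, hΓ', Matrix.smul_apply, Matrix.one_apply]
          simp [mul_comm]
        have h2 : ∑ k, (b k / d n) * (Γ n k i : ℚ) = (∑ k, b k * (Γ n k i : ℚ)) / d n := by
          rw [Finset.sum_div]
          refine Finset.sum_congr rfl fun k _ => by ring
        rw [h2, h1, mul_div_cancel_left₀ _ hdq]
      refine ⟨fun k' => ∑ k : {k // k ≠ k0}, (b k / d n) * (a k k' : ℚ), fun i => ?_⟩
      rw [hxb i, ← Finset.add_sum_erase _ _ (mem_univ k0)]
      have hbk : b k0 = 0 := hx
      rw [hbk, zero_div, zero_mul, zero_add]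
      have : ∑ k ∈ univ.erase k0, (b k / d n) * (Γ n k i : ℚ) = ∑ k : {k // k ≠ k0}, (b k / d n) * (Γ n k i : ℚ) :=
        Finset.sum_subtype (univ.erase k0) (by simp) _
      rw [this]
      simp only [Finset.sum_mul]
      rw [Finset.sum_comm]
      refine Finset.sum_congr rfl fun k _ => ?_
      rw [ha k i]; push_cast; rw [Finset.mul_sum]
      refine Finset.sum_congr rfl fun k' _ => by ring
  choose! c' g hc'b hc's hc'g hc'sp using hpiv
  choose i0 i1 u v hne hM hcop hv huv hH using hht
  -- convergent subsequence
  have hKb : 0 ≤ 2 * Kb := by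
    have := (abs_nonneg _).trans (hcb 0 (Classical.arbitrary ι))
    linarith
  obtain ⟨a, -, ψ, hψ, hlim⟩ := tendsto_subseq_of_bounded (Metric.isBounded_closedBall (x := (0 : ι → ℝ)) (r := 2 * Kb))
    (x := fun n => c' (n + n0)) (by
      intro n
      rw [mem_closedBall_zero_iff, pi_norm_le_iff_of_nonneg hKb]
      intro i
      exact hc'b _ (by omega) i)
  have hlim' : ∀ i, Tendsto (fun n => c' (ψ n + n0) i) atTop (𝓝 (a i)) := fun i => (tendsto_pi_nhds.1 hlim) i
  have hsa : ∑ i, a i ≤ -ε := by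
    have := tendsto_finsetSum (univ : Finset ι) (fun i _ => hlim' i)
    exact le_of_tendsto this (Eventually.of_forall fun n => hc's _ (by omega))
  have hNpos : (0 : ℝ) < Fintype.card ι := by exact_mod_cast Fintype.card_pos
  set δ : ℝ := ε / (2 * Fintype.card ι) with hδ
  have hδ0 : 0 < δ := by positivity
  have hev : ∀ᶠ n in atTop, ∀ i, c' (ψ n + n0) i ≤ a i + δ := by
    rw [eventually_all]
    intro i
    exact (hlim' i).eventually (ge_mem_nhds (by linarith))
  obtain ⟨n1, hn1⟩ := eventually_atTop.1 hev
  let s : ℕ → ℕ := fun n => ψ (n + n1) + n0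
  have hs : Tendsto s atTop atTop := (tendsto_add_atTop_nat n0).comp (hψ.tendsto_atTop.comp (tendsto_add_atTop_nat n1))
  refine engine (κ := {k // k ≠ k0}) A (fun k i => (D : ℝ) * B k i) D ?_ ?_ hD (fun i => a i + δ) ?_ c1 hc1 (3 ^ (Fintype.card {k // k ≠ k0}) * K)
    (lq ∘ s) (hlq.comp hs) (g ∘ s) ?_ (fun n i => Γs (s n) i k0) ?_ (i0 ∘ s) (i1 ∘ s) (fun n => hM _) (fun n => hne _)
    (u ∘ s) (v ∘ s) (fun n => hcop _) (fun n => hv _) (fun n => huv _) (fun n => hH _)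
  · rw [← Int.cast_abs]; exact_mod_cast Int.one_le_abs hD0
  · intro k j
    have := congrFun (congrFun hBA k) j
    rw [Matrix.mul_apply, Matrix.one_apply] at this
    simp only [mul_assoc, ← Finset.mul_sum, this]
    split_ifs <;> simp
  · rw [Finset.sum_add_distrib, Finset.sum_const, Finset.card_univ, nsmul_eq_mul, hδ]
    have : (Fintype.card ι : ℝ) * (ε / (2 * Fintype.card ι)) = ε / 2 := by field_simp
    rw [this]; linarith
  · intro n k i
    refine (hc'g (s n) (by simp [s]) k i).trans ?_
    apply mul_le_mul_of_nonneg_left _ (by positivity)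
    apply Real.exp_le_exp.2
    apply mul_le_mul_of_nonneg_right _ (hn0 _ (by simp [s]))
    exact hn1 _ (by omega) i
  · intro n x hx
    exact hc'sp (s n) (by simp [s]) x hx
end Engine2
end SubsThm
end

set_option linter.unusedSectionVars false
noncomputable section
namespace SubsThm
open Finset

section Liou
variable {ι : Type*} [Fintype ι] [DecidableEq ι]

lemma adj_le {κ : Type*} [Fintype κ] [DecidableEq κ] (M : Matrix κ κ ℤ) (x : ℝ) (hx : 1 ≤ x)
    (h : ∀ i j, |(M i j : ℝ)| ≤ x) (i j : κ) :
    |(M.adjugate i j : ℝ)| ≤ (Fintype.card κ).factorial * x ^ Fintype.card κ := by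
  have h1 : ((M.adjugate i j : ℤ) : ℝ) = ((M.map (Int.castRingHom ℝ)).adjugate i j) := by
    have := (Int.castRingHom ℝ).map_adjugate M
    rw [← RingHom.mapMatrix_apply, ← this]
    simp
  rw [h1, Matrix.adjugate_apply]
  have := Matrix.det_le (A := (M.map (Int.castRingHom ℝ)).updateRow j (Pi.single i 1)) (abv := AbsoluteValue.abs)
    (x := x) (by
      intro k l
      rw [Matrix.updateRow_apply]
      split_ifs with hk
      · rw [Pi.single_apply]
        split_ifs
        · simpa using hx
        · simp; linarith
      · exact h k l)
  simpa using this

theorem liouville_int (τ : ι → ℝ) (hτ : ∀ i, IsIntegral ℤ (τ i)) :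
    ∃ (C : ℝ) (D0 : ℕ), 1 ≤ C ∧ ∀ (x : ι → ℤ) (X : ℝ), 1 ≤ X → (∀ i, |(x i : ℝ)| ≤ X) →
      ∑ i, (x i : ℝ) * τ i ≠ 0 → 1 ≤ C * X ^ D0 * |∑ i, (x i : ℝ) * τ i| := by
  classical
  let S : Set ℝ := Set.range τ
  let R := Algebra.adjoin ℤ S
  have : Module.Finite ℤ R := Module.Finite.of_fg (fg_adjoin_of_finite (Set.finite_range _) (by
    rintro x ⟨p, rfl⟩; exact hτ _))
  have : Module.Free ℤ R := inferInstance
  let b := Module.Free.chooseBasis ℤ R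
  let κ := Module.Free.ChooseBasisIndex ℤ R
  let t : ι → R := fun i => ⟨τ i, Algebra.subset_adjoin ⟨i, rfl⟩⟩
  set c0 : ℝ := 1 + ∑ i, ∑ j, ∑ k, |((Algebra.leftMulMatrix b (t i) j k : ℤ) : ℝ)| with hc0
  have hc0' : 1 ≤ c0 := by
    rw [hc0]; linarith [show (0:ℝ) ≤ ∑ i, ∑ j, ∑ k, |((Algebra.leftMulMatrix b (t i) j k : ℤ) : ℝ)| by positivity]
  set y : κ → ℤ := fun k => b.repr 1 k with hy
  set c1 : ℝ := 1 + ∑ j : κ, ∑ k : κ, |((b j : R) : ℝ)| * |(y k : ℝ)| with hc1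
  have hc1' : 1 ≤ c1 := by
    rw [hc1]; linarith [show (0:ℝ) ≤ ∑ j : κ, ∑ k : κ, |((b j : R) : ℝ)| * |(y k : ℝ)| by positivity]
  set N := Fintype.card κ with hN
  refine ⟨c1 * (N.factorial * c0 ^ N), N, ?_, ?_⟩
  · have : (1:ℝ) ≤ N.factorial := by exact_mod_cast Nat.succ_le_of_lt (Nat.factorial_pos N)
    have h2 : 1 ≤ c0 ^ N := one_le_pow₀ hc0'
    nlinarith [mul_le_mul this h2 (by norm_num) (by positivity)]
  intro x X hX hx hne
  set θ : R := ∑ i, x i • t i with hθ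
  have hθv : (θ : ℝ) = ∑ i, (x i : ℝ) * τ i := by
    rw [hθ]
    simp [t]
  have hθ0 : θ ≠ 0 := by
    intro h; apply hne; rw [← hθv, h]; rfl
  set M := Algebra.leftMulMatrix b θ with hM
  have hMb : ∀ j k, |(M j k : ℝ)| ≤ c0 * X := by
    intro j k
    have : (M j k : ℝ) = ∑ i, (x i : ℝ) * (Algebra.leftMulMatrix b (t i) j k : ℤ) := by
      rw [hM, hθ, map_sum, Matrix.sum_apply]; push_cast
      refine Finset.sum_congr rfl fun i _ => ?_
      rw [map_zsmul, Matrix.smul_apply, smul_eq_mul]; push_cast; rfl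
    rw [this]
    refine (Finset.abs_sum_le_sum_abs _ _).trans ?_
    have h2 : ∑ i, |((Algebra.leftMulMatrix b (t i) j k : ℤ) : ℝ)| ≤ c0 := by
      rw [hc0]
      have : ∑ i, |((Algebra.leftMulMatrix b (t i) j k : ℤ) : ℝ)| ≤ ∑ i, ∑ j, ∑ k, |((Algebra.leftMulMatrix b (t i) j k : ℤ) : ℝ)| := by
        refine Finset.sum_le_sum fun i _ => ?_
        refine le_trans ?_ (Finset.single_le_sum (f := fun j => ∑ k, |((Algebra.leftMulMatrix b (t i) j k : ℤ) : ℝ)|)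
          (fun j _ => by positivity) (mem_univ j))
        exact Finset.single_le_sum (f := fun k => |((Algebra.leftMulMatrix b (t i) j k : ℤ) : ℝ)|)
          (fun j _ => by positivity) (mem_univ k)
      linarith
    calc ∑ i, |(x i : ℝ) * (Algebra.leftMulMatrix b (t i) j k : ℤ)| ≤ ∑ i, X * |((Algebra.leftMulMatrix b (t i) j k : ℤ) : ℝ)| := by
          refine Finset.sum_le_sum fun i _ => ?_
          rw [abs_mul]
          exact mul_le_mul_of_nonneg_right (hx i) (abs_nonneg _)
      _ ≤ c0 * X := by
          rw [← Finset.mul_sum, mul_comm]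
          exact mul_le_mul_of_nonneg_right h2 (by linarith)
  have hdet : M.det ≠ 0 := by
    rw [hM, ← Algebra.norm_eq_matrix_det b]
    exact (Algebra.norm_ne_zero_iff_of_basis b).2 hθ0
  set z : κ → ℤ := M.adjugate.mulVec y with hz
  set θ' : R := ∑ i, z i • b i with hθ'
  have hrep : ⇑(b.repr θ') = z := by
    rw [hθ', b.repr_sum_self]
  have hprod : θ * θ' = (M.det : ℤ) • (1 : R) := by
    apply b.repr.injective
    apply DFunLike.coe_injective
    rw [← Algebra.leftMulMatrix_mulVec_repr, hrep, hz, Matrix.mulVec_mulVec, ← hM, Matrix.mul_adjugate,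
      Matrix.smul_mulVec, Matrix.one_mulVec, map_zsmul]
    rfl
  have hprod' : (θ : ℝ) * (θ' : ℝ) = (M.det : ℝ) := by
    have := congrArg (fun r : R => (r : ℝ)) hprod
    simpa using this
  have h1 : (1 : ℝ) ≤ |(M.det : ℝ)| := by
    rw [← Int.cast_abs]; exact_mod_cast Int.one_le_abs hdet
  have hzb : ∀ i, |(z i : ℝ)| ≤ ∑ k, (N.factorial * (c0 * X) ^ N) * |(y k : ℝ)| := by
    intro i
    rw [hz, Matrix.mulVec, dotProduct]; push_cast
    refine (Finset.abs_sum_le_sum_abs _ _).trans (Finset.sum_le_sum fun k _ => ?_)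
    rw [abs_mul]
    exact mul_le_mul_of_nonneg_right (adj_le M (c0 * X) (by nlinarith) hMb i k) (abs_nonneg _)
  have hth : |(θ' : ℝ)| ≤ c1 * (N.factorial * (c0 * X) ^ N) := by
    have e : (θ' : ℝ) = ∑ i, (z i : ℝ) * ((b i : R) : ℝ) := by
      rw [hθ']; simp
    rw [e]
    calc |∑ i, (z i : ℝ) * ((b i : R) : ℝ)| ≤ ∑ i : κ, (∑ k : κ, (N.factorial * (c0 * X) ^ N) * |(y k : ℝ)|) * |((b i : R) : ℝ)| := by
          refine (Finset.abs_sum_le_sum_abs _ _).trans (Finset.sum_le_sum fun k _ => ?_)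
          rw [abs_mul]
          exact mul_le_mul_of_nonneg_right (hzb k) (abs_nonneg _)
      _ = (c1 - 1) * (N.factorial * (c0 * X) ^ N) := by
          rw [hc1, add_sub_cancel_left, Finset.sum_mul]
          refine Finset.sum_congr rfl fun i _ => ?_
          rw [Finset.sum_mul, Finset.sum_mul]
          refine Finset.sum_congr rfl fun k _ => by ring
      _ ≤ _ := by
          apply mul_le_mul_of_nonneg_right (by linarith)
          have : 0 ≤ c0 * X := by nlinarith
          positivity
  rw [← hθv]
  calc (1:ℝ) ≤ |(θ : ℝ)| * |(θ' : ℝ)| := by rw [← abs_mul, hprod']; exact h1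
    _ ≤ |(θ : ℝ)| * (c1 * (N.factorial * (c0 * X) ^ N)) := mul_le_mul_of_nonneg_left hth (abs_nonneg _)
    _ = _ := by rw [mul_pow]; ring

theorem liouville [Nonempty ι] (τ : ι → ℝ) (hτ : ∀ i, IsAlgebraic ℤ (τ i)) :
    ∃ (C : ℝ) (D0 : ℕ), 1 ≤ C ∧ ∀ (x : ι → ℤ) (X : ℝ), 1 ≤ X → (∀ i, |(x i : ℝ)| ≤ X) →
      ∑ i, (x i : ℝ) * τ i ≠ 0 → 1 ≤ C * X ^ D0 * |∑ i, (x i : ℝ) * τ i| := by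
  obtain ⟨D, hD0, hD⟩ := exists_den (fun _ : ι => τ) (fun _ i => hτ i)
  obtain ⟨C, D0, hC, h⟩ := liouville_int (fun i => (D : ℝ) * τ i) (hD (Classical.arbitrary ι))
  have hD1 : (1:ℝ) ≤ |(D : ℝ)| := by
    rw [← Int.cast_abs]; exact_mod_cast Int.one_le_abs hD0
  refine ⟨C * |(D : ℝ)|, D0, by nlinarith, fun x X hX hx hne => ?_⟩
  have e : ∑ i, (x i : ℝ) * ((D : ℝ) * τ i) = D * ∑ i, (x i : ℝ) * τ i := by
    rw [Finset.mul_sum]; exact Finset.sum_congr rfl fun i _ => by ring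
  have hD0' : (D : ℝ) ≠ 0 := by exact_mod_cast hD0
  have := h x X hX hx (by rw [e]; exact mul_ne_zero hD0' hne)
  rw [e, abs_mul] at this
  linarith [this, show C * X ^ D0 * (|(D : ℝ)| * |∑ i, (x i : ℝ) * τ i|) = C * |(D : ℝ)| * X ^ D0 * |∑ i, (x i : ℝ) * τ i| by ring]
end Liou
end SubsThm
end

set_option linter.unusedSectionVars false
noncomputable section
namespace SubsThm
open Finset

section Height
variable {ι : Type*} [Fintype ι] [DecidableEq ι]

lemma lH_le (u v : ℤ) (X : ℝ) (hv : v ≠ 0) (h : lH u v < X) :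
    |(u : ℝ)| ≤ Real.exp X ∧ |(v : ℝ)| ≤ Real.exp X := by
  have h1 : (1 : ℤ) ≤ max |u| |v| := le_max_of_le_right (Int.one_le_abs hv)
  have h2 : (0 : ℝ) < ((max |u| |v| : ℤ) : ℝ) := by exact_mod_cast (by omega : (0:ℤ) < max |u| |v|)
  have h3 : ((max |u| |v| : ℤ) : ℝ) ≤ Real.exp X := by
    rw [lH] at h
    exact ((Real.log_lt_iff_lt_exp h2).1 h).le
  push_cast at h3
  exact ⟨(le_max_left _ _).trans h3, (le_max_right _ _).trans h3⟩

theorem height [Nonempty ι] (τ : ι → ℝ) (hτ : ∀ i, IsAlgebraic ℤ (τ i)) (K c : ℝ) (hc : 0 < c) :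
    ∃ c1 : ℝ, 0 < c1 ∧ ∃ X0 : ℝ, 0 ≤ X0 ∧ ∀ lq : ℝ, X0 ≤ lq → ∀ M : ι → ℤ,
      ∑ i, (M i : ℝ) * τ i ≠ 0 → |∑ i, (M i : ℝ) * τ i| ≤ K * Real.exp (-c * lq) →
      ∃ (i0 i1 : ι) (u v : ℤ), i0 ≠ i1 ∧ M i0 ≠ 0 ∧ IsCoprime u v ∧ v ≠ 0 ∧ u * M i0 = v * M i1 ∧ c1 * lq ≤ lH u v := by
  obtain ⟨C, D0, hC, hL⟩ := liouville τ hτ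
  set N : ℝ := (Fintype.card ι : ℝ) with hN
  have hNpos : 0 < N := by rw [hN]; exact_mod_cast Fintype.card_pos
  set c1 : ℝ := c / (2 * N * (D0 + 1)) with hc1
  have hc1p : 0 < c1 := by positivity
  have hev : ∀ᶠ x : ℝ in atTop, C * |K| * Real.exp (-(c / 2 * x)) < 1 := by
    have h1 : Tendsto (fun x : ℝ => C * |K| * Real.exp (-(c / 2 * x))) atTop (𝓝 (C * |K| * 0)) := by
      apply Tendsto.const_mul
      exact Real.tendsto_exp_neg_atTop_nhds_zero.comp (tendsto_id.const_mul_atTop (by positivity))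
    rw [mul_zero] at h1
    exact h1.eventually (gt_mem_nhds one_pos)
  obtain ⟨X1, hX1⟩ := eventually_atTop.1 hev
  refine ⟨c1, hc1p, max X1 0, le_max_right _ _, fun lq hlq M hne hle => ?_⟩
  have hlq0 : 0 ≤ lq := (le_max_right _ _).trans hlq
  have hlq1 := hX1 lq ((le_max_left _ _).trans hlq)
  by_contra hcon
  push Not at hcon
  obtain ⟨i0, hi0⟩ : ∃ i0, M i0 ≠ 0 := by
    by_contra! h
    apply hne; simp [h]
  have huv : ∀ i, ∃ u v : ℤ, v ≠ 0 ∧ u * M i0 = v * M i ∧ |(u : ℝ)| ≤ Real.exp (c1 * lq) ∧ |(v : ℝ)| ≤ Real.exp (c1 * lq) := by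
    intro i
    by_cases h : i0 = i
    · subst h
      refine ⟨1, 1, by norm_num, by ring, ?_, ?_⟩ <;>
      · simp only [Int.cast_one, abs_one]
        exact Real.one_le_exp (by positivity)
    · have hg : (Int.gcd (M i) (M i0) : ℤ) ≠ 0 := by
        intro h0
        have : Int.gcd (M i) (M i0) = 0 := by exact_mod_cast h0
        exact hi0 (Int.gcd_eq_zero_iff.1 this).2
      obtain ⟨u, hu⟩ := Int.gcd_dvd_left (M i) (M i0)
      obtain ⟨v, hv⟩ := Int.gcd_dvd_right (M i) (M i0)
      have hv0 : v ≠ 0 := by rintro rfl; rw [mul_zero] at hv; exact hi0 hv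
      have hcop : IsCoprime u v := by
        have hb := Int.gcd_eq_gcd_ab (M i) (M i0)
        refine ⟨Int.gcdA (M i) (M i0), Int.gcdB (M i) (M i0), ?_⟩
        apply mul_left_cancel₀ hg
        set g : ℤ := (Int.gcd (M i) (M i0) : ℤ)
        have : g * (Int.gcdA (M i) (M i0) * u + Int.gcdB (M i) (M i0) * v) =
          (g * u) * Int.gcdA (M i) (M i0) + (g * v) * Int.gcdB (M i) (M i0) := by ring
        rw [this, ← hu, ← hv, mul_one, ← hb]
      have he : u * M i0 = v * M i := by
        linear_combination u * hv - v * hu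
      have hlt := hcon i0 i u v h hi0 hcop hv0 he
      obtain ⟨h1, h2⟩ := lH_le u v _ hv0 hlt
      exact ⟨u, v, hv0, he, h1, h2⟩
  choose u v hv he hu1 hv1 using huv
  set V : ℤ := ∏ j, v j with hV
  have hV0 : V ≠ 0 := Finset.prod_ne_zero_iff.2 fun i _ => hv i
  set x : ι → ℤ := fun i => u i * ∏ j ∈ univ.erase i, v j with hx
  have hxM : ∀ i, x i * M i0 = V * M i := by
    intro i
    rw [hx, hV, ← Finset.mul_prod_erase _ _ (mem_univ i)]
    linear_combination (∏ j ∈ univ.erase i, v j) * he i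
  set E := Real.exp (N * c1 * lq) with hE
  have hE1 : 1 ≤ E := Real.one_le_exp (by positivity)
  have hprod : ∏ _j : ι, Real.exp (c1 * lq) = E := by
    rw [Finset.prod_const, Finset.card_univ, ← Real.exp_nat_mul, hE]; congr 1; rw [hN]; ring
  have hxb : ∀ i, |(x i : ℝ)| ≤ E := by
    intro i
    rw [hx]; push_cast
    rw [abs_mul, Finset.abs_prod, ← hprod, ← Finset.mul_prod_erase _ _ (mem_univ i)]
    exact mul_le_mul (hu1 i) (Finset.prod_le_prod (fun _ _ => abs_nonneg _) fun j _ => hv1 j)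
      (Finset.prod_nonneg fun _ _ => abs_nonneg _) (Real.exp_pos _).le
  have hVb : |(V : ℝ)| ≤ E := by
    rw [hV]; push_cast
    rw [Finset.abs_prod, ← hprod]
    exact Finset.prod_le_prod (fun _ _ => abs_nonneg _) fun j _ => hv1 j
  have hM0 : (M i0 : ℝ) ≠ 0 := by exact_mod_cast hi0
  have hsum : (∑ i, (x i : ℝ) * τ i) * M i0 = V * ∑ i, (M i : ℝ) * τ i := by
    rw [Finset.sum_mul, Finset.mul_sum]
    refine Finset.sum_congr rfl fun i _ => ?_
    have : (x i : ℝ) * M i0 = V * M i := by exact_mod_cast hxM i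
    linear_combination τ i * this
  have hx0 : ∑ i, (x i : ℝ) * τ i ≠ 0 := by
    intro h
    rw [h, zero_mul] at hsum
    have : (V : ℝ) ≠ 0 := by exact_mod_cast hV0
    exact mul_ne_zero this hne hsum.symm
  have h1 := hL x E hE1 hxb hx0
  have h2 : |∑ i, (x i : ℝ) * τ i| ≤ E * (|K| * Real.exp (-c * lq)) := by
    have h3 : |∑ i, (x i : ℝ) * τ i| * |(M i0 : ℝ)| = |(V : ℝ)| * |∑ i, (M i : ℝ) * τ i| := by
      rw [← abs_mul, hsum, abs_mul]
    have h4 : (1:ℝ) ≤ |(M i0 : ℝ)| := by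
      rw [← Int.cast_abs]; exact_mod_cast Int.one_le_abs hi0
    calc |∑ i, (x i : ℝ) * τ i| ≤ |∑ i, (x i : ℝ) * τ i| * |(M i0 : ℝ)| := le_mul_of_one_le_right (abs_nonneg _) h4
      _ = _ := h3
      _ ≤ E * (|K| * Real.exp (-c * lq)) := by
        apply mul_le_mul hVb _ (abs_nonneg _) (by positivity)
        exact hle.trans (mul_le_mul_of_nonneg_right (le_abs_self K) (Real.exp_pos _).le)
  have h5 : C * E ^ D0 * (E * (|K| * Real.exp (-c * lq))) = C * |K| * Real.exp (-(c / 2 * lq)) := by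
    have : E ^ D0 * E * Real.exp (-c * lq) = Real.exp (-(c / 2 * lq)) := by
      rw [← pow_succ, hE, ← Real.exp_nat_mul, ← Real.exp_add]
      congr 1
      push_cast
      rw [hc1]
      field_simp
      ring
    rw [← this]; ring
  have : (1:ℝ) ≤ C * |K| * Real.exp (-(c / 2 * lq)) := by
    rw [← h5]
    exact h1.trans (mul_le_mul_of_nonneg_left h2 (by positivity))
  linarith

theorem engine3 [Nonempty ι] {S : Type*} [Fintype S] (A B : Matrix ι ι ℝ) (hBA : B * A = 1)
    (hB : ∀ k i, IsAlgebraic ℤ (B k i)) (k0 : ι) (τ : S → ι → ℝ) (hτ : ∀ s i, IsAlgebraic ℤ (τ s i))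
    (K Kb ε c0 : ℝ) (hK : 0 ≤ K) (hε : 0 < ε) (hc0 : 0 < c0) : ∃ X0 : ℝ, ∀ lq : ℝ, X0 ≤ lq →
    ∀ (Γ Γs : Matrix ι ι ℤ) (d : ℤ) (c l : ι → ℝ) (lm : ℝ), d ≠ 0 → Γ * Γs = d • (1 : Matrix ι ι ℤ) →
    (∀ k i, |∑ j, A i j * (Γ k j : ℝ)| ≤ K * Real.exp ((c i + l k) * lq)) →
    (∀ k, k ≠ k0 → l k ≤ lm) → (∀ i, |c i| ≤ Kb) → (∀ k, |l k| ≤ Kb) → |lm| ≤ Kb →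
    ∑ i, c i + ∑ k ∈ univ.erase k0, l k + lm ≤ -ε →
    (∃ s, ∑ i, (Γs i k0 : ℝ) * τ s i ≠ 0 ∧ |∑ i, (Γs i k0 : ℝ) * τ s i| ≤ K * Real.exp (-c0 * lq)) → False := by
  classical
  have H := fun s => height (τ s) (hτ s) K c0 hc0
  choose c1 hc1 X1 hX1 hH using H
  by_contra hcon
  push Not at hcon
  set Xm : ℝ := ∑ s, X1 s with hXm
  have hXs : ∀ s, X1 s ≤ Xm := fun s => Finset.single_le_sum (f := X1) (fun s _ => hX1 s) (mem_univ s)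
  have hXm0 : 0 ≤ Xm := Finset.sum_nonneg fun s _ => hX1 s
  have hcon' := fun n : ℕ => hcon (n + Xm)
  choose lq hlq Γ Γs d c l lm hd hΓ hA hlm hcb hlb hlmb hsum hs _ using hcon'
  choose s hs0 hs1 using hs
  haveI : Nonempty S := ⟨s 0⟩
  set cm : ℝ := univ.inf' univ_nonempty c1 with hcm
  refine engine2 A B hBA hB lq ?_ Γ Γs d hd hΓ k0 c l lm K Kb ε cm hK hε ?_ hA hlm hcb hlb hlmb hsum ?_
  · exact tendsto_atTop_mono (fun n => (by linarith [hlq n] : (n:ℝ) ≤ lq n)) tendsto_natCast_atTop_atTop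
  · rw [hcm, Finset.lt_inf'_iff]; exact fun s _ => hc1 s
  · intro n
    have hn : (0:ℝ) ≤ n := by positivity
    have h0 : 0 ≤ lq n := by linarith [hlq n]
    obtain ⟨i0, i1, u, v, h1, h2, h3, h4, h5, h6⟩ := hH (s n) (lq n) (by linarith [hlq n, hXs (s n)]) (fun i => Γs n i k0) (hs0 n) (hs1 n)
    refine ⟨i0, i1, u, v, h1, h2, h3, h4, h5, le_trans ?_ h6⟩
    exact mul_le_mul_of_nonneg_right (Finset.inf'_le _ (mem_univ _)) h0
end Height
end SubsThm
end

set_option linter.unusedSectionVars false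
noncomputable section
namespace SubsThm
open Finset

section Minima
variable {ι : Type*} [Fintype ι] [DecidableEq ι]

lemma det_exp_le (M : Matrix ι ι ℝ) (a b : ι → ℝ) (K : ℝ)
    (h : ∀ k i, |M k i| ≤ K * Real.exp (a i + b k)) :
    |M.det| ≤ (Fintype.card ι).factorial * K ^ (Fintype.card ι) * Real.exp (∑ i, a i + ∑ k, b k) := by
  rw [Matrix.det_apply]
  refine (Finset.abs_sum_le_sum_abs _ _).trans ?_
  have h1 : ∀ σ ∈ (univ : Finset (Equiv.Perm ι)), |Equiv.Perm.sign σ • ∏ i, M (σ i) i| ≤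
      K ^ (Fintype.card ι) * Real.exp (∑ i, a i + ∑ k, b k) := by
    intro σ _
    have e1 : |Equiv.Perm.sign σ • ∏ i, M (σ i) i| = ∏ i, |M (σ i) i| := by
      rw [← Finset.abs_prod]
      rcases Int.units_eq_one_or (Equiv.Perm.sign σ) with h | h <;> rw [h] <;> simp
    rw [e1]
    calc ∏ i, |M (σ i) i| ≤ ∏ i, (K * Real.exp (a i + b (σ i))) :=
          Finset.prod_le_prod (fun _ _ => abs_nonneg _) fun i _ => h _ _
      _ = _ := by
        rw [Finset.prod_mul_distrib, Finset.prod_const, Finset.card_univ, ← Real.exp_sum, Finset.sum_add_distrib,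
          Equiv.sum_comp σ b]
  refine (Finset.sum_le_sum h1).trans (le_of_eq ?_)
  rw [Finset.sum_const, Finset.card_univ, Fintype.card_perm, nsmul_eq_mul, mul_assoc]

lemma adj_exp_le (M : Matrix ι ι ℝ) (a b : ι → ℝ) (K : ℝ) (hK : 1 ≤ K)
    (h : ∀ k i, |M k i| ≤ K * Real.exp (a i + b k)) (i j : ι) :
    |M.adjugate i j| ≤ (Fintype.card ι).factorial * K ^ (Fintype.card ι) *
      Real.exp (∑ i, a i + ∑ k, b k - a i - b j) := by
  rw [Matrix.adjugate_apply]
  refine (det_exp_le _ a (Function.update b j (-a i)) K ?_).trans (le_of_eq ?_)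
  · intro k l
    rw [Matrix.updateRow_apply]
    by_cases hk : k = j
    · subst hk
      rw [if_pos rfl, Function.update_self, Pi.single_apply]
      split_ifs with hl
      · subst hl; simpa using hK
      · simp only [abs_zero]; positivity
    · rw [if_neg hk, Function.update_of_ne hk]; exact h k l
  · congr 2
    rw [Finset.sum_update_of_mem (mem_univ j), ← Finset.erase_eq, ← Finset.add_sum_erase _ b (mem_univ j)]
    ring

open MeasureTheory in
lemma minkowski_forms (M : Matrix ι ι ℝ) (hM : M.det ≠ 0) (r : ι → ℝ) (hr : ∀ i, 0 < r i)
    (h : |M.det| < ∏ i, r i) : ∃ x : ι → ℤ, x ≠ 0 ∧ ∀ i, |∑ j, M i j * (x j : ℝ)| < r i := by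
  let b := Pi.basisFun ℝ ι
  have hfund := ZSpan.isAddFundamentalDomain' b volume
  haveI : Countable (Submodule.span ℤ (Set.range b)).toAddSubgroup := by
    change Countable (Submodule.span ℤ (Set.range b))
    infer_instance
  let f : (ι → ℝ) →ₗ[ℝ] (ι → ℝ) := Matrix.toLin' M
  let box : Set (ι → ℝ) := Set.univ.pi fun i => Set.Ioo (-r i) (r i)
  have hdet : LinearMap.det f ≠ 0 := by rw [LinearMap.det_toLin']; exact hM
  have hvol : volume (f ⁻¹' box) = ENNReal.ofReal (|M.det|⁻¹ * (2 ^ Fintype.card ι * ∏ i, r i)) := by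
    rw [Measure.addHaar_preimage_linearMap _ hdet, LinearMap.det_toLin', Real.volume_pi_Ioo,
      ← ENNReal.ofReal_prod_of_nonneg (fun i _ => by linarith [hr i]), ← ENNReal.ofReal_mul (abs_nonneg _), abs_inv]
    congr 2
    rw [← Finset.card_univ, ← Finset.prod_const, ← Finset.prod_mul_distrib]
    exact Finset.prod_congr rfl fun i _ => by ring
  have hF : volume (ZSpan.fundamentalDomain b) = 1 := by
    rw [ZSpan.fundamentalDomain_pi_basisFun, Real.volume_pi_Ico]; simp
  obtain ⟨⟨x, hx⟩, hx0, hxs⟩ := exists_ne_zero_mem_lattice_of_measure_mul_two_pow_lt_measure (s := f ⁻¹' box) hfund (by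
      intro x hx i hi
      have := hx i hi
      rw [map_neg]
      constructor
      · simp only [Pi.neg_apply]; linarith [this.2]
      · simp only [Pi.neg_apply]; linarith [this.1]) (by
      apply Convex.linear_preimage
      exact convex_pi fun i _ => convex_Ioo _ _) (by
      rw [hF, one_mul, hvol, Module.finrank_fintype_fun_eq_card]
      have e : (2 : ENNReal) ^ Fintype.card ι = ENNReal.ofReal (2 ^ Fintype.card ι) := by
        rw [ENNReal.ofReal_pow (by norm_num)]; simp
      rw [e, ENNReal.ofReal_lt_ofReal_iff_of_nonneg (by positivity)]
      have hp : 0 < |M.det| := abs_pos.2 hM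
      rw [inv_mul_eq_div, lt_div_iff₀ hp]
      exact mul_lt_mul_of_pos_left h (by positivity))
  rw [Submodule.mem_toAddSubgroup, Module.Basis.mem_span_iff_repr_mem] at hx
  choose y hy using hx
  have hy' : ∀ i, (y i : ℝ) = x i := by
    intro i
    have := hy i
    simpa [b] using this
  refine ⟨y, ?_, ?_⟩
  · rintro rfl
    apply hx0
    ext i
    have := hy' i
    simpa using this.symm
  · intro i
    have := hxs i (Set.mem_univ i)
    rw [abs_lt]
    have e : f x i = ∑ j, M i j * (y j : ℝ) := by
      simp only [f, Matrix.toLin'_apply, Matrix.mulVec, dotProduct, hy']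
    rw [e] at this
    exact this
end Minima
end SubsThm
end

set_option linter.unusedSectionVars false
noncomputable section
namespace SubsThm
open Finset

section Minima2
variable {N : ℕ}

/-- the linear map given by a real matrix, restricted to integer vectors -/
def phiM (M : Matrix (Fin N) (Fin N) ℝ) : (Fin N → ℤ) →+ (Fin N → ℝ) :=
  { toFun := fun x i => ∑ j, M i j * (x j : ℝ)
    map_zero' := by funext i; simp
    map_add' := by
      intro x y; funext i
      simp only [Pi.add_apply, Int.cast_add, mul_add, Finset.sum_add_distrib] }

lemma phiM_apply (M : Matrix (Fin N) (Fin N) ℝ) (x : Fin N → ℤ) (i : Fin N) :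
    phiM M x i = ∑ j, M i j * (x j : ℝ) := rfl

lemma phiM_mul (M : Matrix (Fin N) (Fin N) ℝ) (G : Matrix (Fin N) (Fin N) ℤ) :
    (G.map (Int.castRingHom ℝ)) * M.transpose = Matrix.of (fun k => phiM M (G k)) := by
  ext k i
  simp only [Matrix.mul_apply, Matrix.map_apply, Matrix.transpose_apply, Matrix.of_apply, phiM_apply]
  exact Finset.sum_congr rfl fun j _ => by rw [mul_comm]; rfl

lemma det_map_ne (G : Matrix (Fin N) (Fin N) ℤ) : (G.map (Int.castRingHom ℝ)).det = (G.det : ℝ) := by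
  rw [← RingHom.mapMatrix_apply, ← RingHom.map_det]; rfl

theorem minima (M : Matrix (Fin N) (Fin N) ℝ) (hM : M.det ≠ 0) :
    ∃ (G : Matrix (Fin N) (Fin N) ℤ) (m : Fin N → ℝ), G.det ≠ 0 ∧ Monotone m ∧ (∀ k, 0 < m k) ∧
      (∀ k i, |∑ j, M i j * (G k j : ℝ)| ≤ m k) ∧ ∏ k, m k ≤ (2 * 3 ^ N) ^ N * |M.det| := by
  classical
  have hpos : ∀ G : Matrix (Fin N) (Fin N) ℤ, G.det ≠ 0 → ∀ k, 0 < ‖phiM M (G k)‖ := by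
    intro G hG k
    rw [norm_pos_iff]
    intro h0
    have hd : ((G.map (Int.castRingHom ℝ)) * M.transpose).det ≠ 0 := by
      rw [Matrix.det_mul, det_map_ne, Matrix.det_transpose]
      exact mul_ne_zero (by exact_mod_cast hG) hM
    apply hd
    rw [phiM_mul]
    apply Matrix.det_eq_zero_of_row_eq_zero k
    intro j
    rw [Matrix.of_apply, h0]; rfl
  set S : Set ℝ := {t | ∃ G : Matrix (Fin N) (Fin N) ℤ, G.det ≠ 0 ∧ t = ∏ k, ‖phiM M (G k)‖} with hS
  have hSne : S.Nonempty := ⟨_, 1, by simp, rfl⟩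
  have hlow : ∀ t ∈ S, |M.det| / N.factorial ≤ t := by
    rintro t ⟨G, hG, rfl⟩
    have h1 := det_exp_le ((G.map (Int.castRingHom ℝ)) * M.transpose) 0 (fun k => Real.log ‖phiM M (G k)‖) 1 (by
      intro k i
      rw [phiM_mul, Matrix.of_apply, Pi.zero_apply, zero_add, one_mul, Real.exp_log (hpos G hG k)]
      exact norm_le_pi_norm (phiM M (G k)) i)
    simp only [Pi.zero_apply, Finset.sum_const_zero, zero_add, one_pow, mul_one, Fintype.card_fin] at h1
    rw [Real.exp_sum, Finset.prod_congr rfl (fun k _ => Real.exp_log (hpos G hG k)), Matrix.det_mul, det_map_ne,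
      Matrix.det_transpose, abs_mul] at h1
    have h2 : (1:ℝ) ≤ |(G.det : ℝ)| := by
      rw [← Int.cast_abs]; exact_mod_cast Int.one_le_abs hG
    have h3 : (0:ℝ) < N.factorial := by exact_mod_cast Nat.factorial_pos N
    rw [div_le_iff₀ h3]
    nlinarith [abs_nonneg M.det]
  have hbdd : BddBelow S := ⟨_, fun t ht => hlow t ht⟩
  set t0 := sInf S with ht0
  have ht0p : 0 < t0 := by
    have h3 : (0:ℝ) < N.factorial := by exact_mod_cast Nat.factorial_pos N
    exact lt_of_lt_of_le (div_pos (abs_pos.2 hM) h3) (le_csInf hSne hlow)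
  obtain ⟨t, ⟨G0, hG0, rfl⟩, ht⟩ := exists_lt_of_csInf_lt hSne (show sInf S < 2 * t0 by linarith)
  set σ := Tuple.sort (fun k => ‖phiM M (G0 k)‖) with hσ
  set G : Matrix (Fin N) (Fin N) ℤ := G0.submatrix σ id with hG
  have hGd : G.det ≠ 0 := by
    rw [hG, Matrix.det_permute]
    rcases Int.units_eq_one_or (Equiv.Perm.sign σ) with h | h <;> rw [h] <;> simpa using hG0
  set m : Fin N → ℝ := fun k => ‖phiM M (G k)‖ with hm
  have hmono : Monotone m := Tuple.monotone_sort (fun k => ‖phiM M (G0 k)‖)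
  have hmpos : ∀ k, 0 < m k := hpos G hGd
  have hprod : ∏ k, m k < 2 * t0 := by
    have : ∏ k, m k = ∏ k, ‖phiM M (G0 k)‖ := Equiv.prod_comp σ (fun k => ‖phiM M (G0 k)‖)
    rw [this]; exact ht
  have hb : ∀ k i, |phiM M (G k) i| ≤ m k := fun k i => norm_le_pi_norm (phiM M (G k)) i
  have hGr : (G.map (Int.castRingHom ℝ)).det ≠ 0 := by rw [det_map_ne]; exact_mod_cast hGd
  have hli : LinearIndependent ℝ (fun k => phiM M (G k)) := by
    have : (Matrix.of (fun k => phiM M (G k))).det ≠ 0 := by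
      rw [← phiM_mul, Matrix.det_mul, Matrix.det_transpose]
      exact mul_ne_zero hGr hM
    exact Matrix.linearIndependent_rows_of_det_ne_zero this
  obtain ⟨π, -, hπ, -, -, -, -, hlast⟩ := pivot N (phiM M) (fun k => G k) m hmono hb hli
  have hN3 : (0:ℝ) < 2 * 3 ^ N := by positivity
  have key : ∀ x : Fin N → ℤ, x ≠ 0 → ∃ i, m i / (2 * 3 ^ N) ≤ |phiM M x (π i)| := by
    intro x hx
    set Gr := G.map (Int.castRingHom ℝ) with hGrdef
    set xr : Fin N → ℝ := fun j => (x j : ℝ) with hxr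
    set a : Fin N → ℝ := Matrix.vecMul xr Gr⁻¹ with ha
    have hxa : xr = ∑ k, a k • Gr k := by
      have h1 : Matrix.vecMul a Gr = xr := by
        rw [ha, Matrix.vecMul_vecMul, Matrix.nonsing_inv_mul _ (isUnit_iff_ne_zero.2 hGr), Matrix.vecMul_one]
      rw [← h1]
      funext j
      simp [Matrix.vecMul, dotProduct, Finset.sum_apply]
    have ha0 : (univ.filter fun k => a k ≠ 0).Nonempty := by
      rw [Finset.nonempty_iff_ne_empty]
      intro h
      apply hx
      funext j
      have h1 : ∀ k, a k = 0 := by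
        intro k
        by_contra hk
        have : k ∈ (univ.filter fun k => a k ≠ 0) := by simp [hk]
        rw [h] at this; simp at this
      have h2 := congrFun hxa j
      simp only [h1, zero_smul, Finset.sum_const_zero, Pi.zero_apply, hxr] at h2
      simpa using h2
    set k := (univ.filter fun k => a k ≠ 0).max' ha0 with hk
    have hak : a k ≠ 0 := by
      have := Finset.max'_mem _ ha0
      rw [Finset.mem_filter] at this
      exact this.2
    have hgt : ∀ i, k < i → a i = 0 := by
      intro i hi
      by_contra h
      have := Finset.le_max' (univ.filter fun k => a k ≠ 0) i (by simp [h])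
      rw [← hk] at this
      exact absurd hi (not_lt.2 this)
    have hφx : phiM M x = ∑ i, a i • phiM M (G i) := by
      funext i
      simp only [phiM_apply, Finset.sum_apply, Pi.smul_apply, smul_eq_mul]
      have h1 : ∀ j, (x j : ℝ) = ∑ k, a k * (G k j : ℝ) := by
        intro j
        have h2 := congrFun hxa j
        simp only [Finset.sum_apply, Pi.smul_apply, smul_eq_mul] at h2
        exact h2
      simp only [h1, Finset.mul_sum]
      rw [Finset.sum_comm]
      exact Finset.sum_congr rfl fun k _ => Finset.sum_congr rfl fun j _ => by ring
    have hspan : phiM M x ∈ Submodule.span ℝ ((fun k => phiM M (G k)) '' Set.Iic k) := by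
      rw [hφx]
      apply Submodule.sum_mem
      intro i _
      by_cases hi : i ≤ k
      · exact Submodule.smul_mem _ _ (Submodule.subset_span ⟨i, hi, rfl⟩)
      · rw [hgt i (not_le.1 hi), zero_smul]; exact Submodule.zero_mem _
    -- replacement
    have hrep : m k / 2 < ‖phiM M x‖ := by
      have hd : (G.updateRow k x).det ≠ 0 := by
        have e : (G.updateRow k x).map (Int.castRingHom ℝ) = Gr.updateRow k (∑ k, a k • Gr k) := by
          rw [← hxa]
          ext i j
          simp only [Matrix.map_apply, Matrix.updateRow_apply]
          split_ifs <;> simp [hxr, hGrdef]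
        have : ((G.updateRow k x).det : ℝ) ≠ 0 := by
          rw [← det_map_ne, e, Matrix.det_updateRow_sum]
          exact mul_ne_zero hak hGr
        exact_mod_cast this
      have h1 : t0 ≤ ∏ i, ‖phiM M ((G.updateRow k x) i)‖ := csInf_le hbdd ⟨_, hd, rfl⟩
      rw [← Finset.mul_prod_erase _ _ (mem_univ k), Matrix.updateRow_self] at h1
      have h2 : ∏ i ∈ univ.erase k, ‖phiM M ((G.updateRow k x) i)‖ = ∏ i ∈ univ.erase k, m i := by
        refine Finset.prod_congr rfl fun i hi => ?_
        rw [Matrix.updateRow_ne (Finset.ne_of_mem_erase hi)]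
      rw [h2] at h1
      rw [← Finset.mul_prod_erase _ _ (mem_univ k)] at hprod
      have h3 : 0 < ∏ i ∈ univ.erase k, m i := Finset.prod_pos fun i _ => hmpos i
      by_contra hcon
      push Not at hcon
      nlinarith
    by_contra! hcon
    have h4 := hlast k (phiM M x) hspan (m k / (2 * 3 ^ N)) (by
      intro i hi
      refine (hcon i).le.trans ?_
      exact div_le_div_of_nonneg_right (hmono hi) hN3.le)
    have h5 : ‖phiM M x‖ ≤ m k / 2 := by
      rw [pi_norm_le_iff_of_nonneg (by linarith [hmpos k])]
      intro i
      refine (h4 i).trans (le_of_eq ?_)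
      field_simp
    linarith
  refine ⟨G, m, hGd, hmono, hmpos, hb, ?_⟩
  by_contra hcon
  push Not at hcon
  have hbij : Function.Bijective π := Finite.injective_iff_bijective.1 hπ
  let e := Equiv.ofBijective π hbij
  obtain ⟨x, hx0, hx⟩ := minkowski_forms M hM (fun j => m (e.symm j) / (2 * 3 ^ N))
    (fun j => div_pos (hmpos _) hN3) (by
      rw [Equiv.prod_comp e.symm (fun j => m j / (2 * 3 ^ N)), Finset.prod_div_distrib, Finset.prod_const,
        Finset.card_univ, Fintype.card_fin, lt_div_iff₀ (by positivity), mul_comm]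
      exact hcon)
  obtain ⟨i, hi⟩ := key x hx0
  have h1 := hx (π i)
  have h2 : e.symm (π i) = i := by
    rw [Equiv.symm_apply_eq]; rfl
  simp only [h2] at h1
  rw [phiM_apply] at hi
  linarith
end Minima2
end SubsThm
end

set_option linter.unusedSectionVars false
noncomputable section
namespace SubsThm
open Finset

section Compound

/-- the six pairs -/
def pr : Fin 6 → Fin 4 × Fin 4 := ![(0,1),(0,2),(0,3),(1,2),(1,3),(2,3)]

/-- second compound matrix -/
def C2 {R : Type*} [CommRing R] (X : Matrix (Fin 4) (Fin 4) R) : Matrix (Fin 6) (Fin 6) R :=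
  Matrix.of fun p q => X (pr p).1 (pr q).1 * X (pr p).2 (pr q).2 - X (pr p).1 (pr q).2 * X (pr p).2 (pr q).1

lemma C2_apply {R : Type*} [CommRing R] (X : Matrix (Fin 4) (Fin 4) R) (p q : Fin 6) : C2 X p q =
    X (pr p).1 (pr q).1 * X (pr p).2 (pr q).2 - X (pr p).1 (pr q).2 * X (pr p).2 (pr q).1 := rfl

lemma cb {R : Type*} [CommRing R] (b b' a a' : Fin 4 → R) :
    ∑ q : Fin 6, (b (pr q).1 * b' (pr q).2 - b (pr q).2 * b' (pr q).1) * (a (pr q).1 * a' (pr q).2 - a' (pr q).1 * a (pr q).2)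
      = (∑ i, b i * a i) * (∑ i, b' i * a' i) - (∑ i, b i * a' i) * (∑ i, b' i * a i) := by
  simp [Fin.sum_univ_succ, pr]
  ring

lemma C2_mul {R : Type*} [CommRing R] (X Y : Matrix (Fin 4) (Fin 4) R) : C2 (X * Y) = C2 X * C2 Y := by
  ext p q
  rw [Matrix.mul_apply, C2_apply]
  simp only [Matrix.mul_apply]
  rw [← cb (X (pr p).1) (X (pr p).2) (fun j => Y j (pr q).1) (fun j => Y j (pr q).2)]
  rfl

lemma C2_transpose {R : Type*} [CommRing R] (X : Matrix (Fin 4) (Fin 4) R) : C2 X.transpose = (C2 X).transpose := by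
  ext p q
  simp only [C2_apply, Matrix.transpose_apply]
  ring

lemma C2_one {R : Type*} [CommRing R] : C2 (1 : Matrix (Fin 4) (Fin 4) R) = 1 := by
  ext p q
  fin_cases p <;> fin_cases q <;> simp [C2_apply, pr, Matrix.one_apply]

lemma C2_smul {R : Type*} [CommRing R] (d : R) (X : Matrix (Fin 4) (Fin 4) R) : C2 (d • X) = (d ^ 2) • C2 X := by
  ext p q
  simp only [C2_apply, Matrix.smul_apply, smul_eq_mul]
  ring

lemma C2_map (X : Matrix (Fin 4) (Fin 4) ℤ) (p q : Fin 6) : ((C2 X p q : ℤ) : ℝ) = C2 (X.map (Int.castRingHom ℝ)) p q := by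
  simp [C2_apply]

lemma C2_bound (X : Matrix (Fin 4) (Fin 4) ℝ) (a b : Fin 4 → ℝ) (K : ℝ) (hK : 0 ≤ K)
    (h : ∀ i k, |X i k| ≤ K * Real.exp (a i + b k)) (p q : Fin 6) :
    |C2 X p q| ≤ 2 * K ^ 2 * Real.exp (a (pr p).1 + a (pr p).2 + (b (pr q).1 + b (pr q).2)) := by
  rw [C2_apply]
  have h1 : ∀ i i' k k', |X i k * X i' k'| ≤ K ^ 2 * Real.exp (a i + a i' + (b k + b k')) := by
    intro i i' k k'
    rw [abs_mul]
    refine (mul_le_mul (h i k) (h i' k') (abs_nonneg _) (by positivity)).trans (le_of_eq ?_)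
    have : a i + a i' + (b k + b k') = (a i + b k) + (a i' + b k') := by ring
    rw [this, Real.exp_add (a i + b k)]
    ring
  refine (abs_sub _ _).trans ?_
  have := h1 (pr p).1 (pr p).2 (pr q).1 (pr q).2
  have h2 := h1 (pr p).1 (pr p).2 (pr q).2 (pr q).1
  rw [add_comm (b (pr q).2)] at h2
  linarith
end Compound

section Forms
variable (α : ℝ)
/-- the four forms -/
def fA : Matrix (Fin 4) (Fin 4) ℝ := !![1,0,0,0; -α,1,0,0; -α,0,1,0; α^2,-α,-α,1]
/-- the inverse -/
def fB : Matrix (Fin 4) (Fin 4) ℝ := !![1,0,0,0; α,1,0,0; α,0,1,0; α^2,α,α,1]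

lemma fBA : fB α * fA α = 1 := by
  ext i j
  fin_cases i <;> fin_cases j <;> simp [fA, fB, Matrix.mul_apply, Fin.sum_univ_succ] <;> ring

lemma fAB : fA α * fB α = 1 := by
  ext i j
  fin_cases i <;> fin_cases j <;> simp [fA, fB, Matrix.mul_apply, Fin.sum_univ_succ] <;> ring

lemma fA_det : (fA α).det = 1 := by
  have : (fA α).BlockTriangular OrderDual.toDual := by
    intro i j hij
    have hij' : i < j := hij
    fin_cases i <;> fin_cases j <;> simp [fA] at hij' ⊢
  rw [Matrix.det_of_lowerTriangular _ this]
  simp [Fin.prod_univ_succ, fA]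

lemma fA_adj : (fA α).adjugate = fB α := by
  have h : fA α * (fA α).adjugate = 1 := by rw [Matrix.mul_adjugate, fA_det, one_smul]
  calc (fA α).adjugate = (fB α * fA α) * (fA α).adjugate := by rw [fBA, Matrix.one_mul]
    _ = fB α := by rw [Matrix.mul_assoc, h, Matrix.mul_one]

lemma fA_alg (h : IsAlgebraic ℤ α) (i j : Fin 4) : IsAlgebraic ℤ (fA α i j) := by
  have h0 : IsAlgebraic ℤ (0:ℝ) := isAlgebraic_zero
  have h1 : IsAlgebraic ℤ (1:ℝ) := isAlgebraic_one
  fin_cases i <;> fin_cases j <;> simp [fA] <;> first | exact h0 | exact h1 | exact h | exact h.neg | exact h.pow 2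

lemma fB_alg (h : IsAlgebraic ℤ α) (i j : Fin 4) : IsAlgebraic ℤ (fB α i j) := by
  have h0 : IsAlgebraic ℤ (0:ℝ) := isAlgebraic_zero
  have h1 : IsAlgebraic ℤ (1:ℝ) := isAlgebraic_one
  fin_cases i <;> fin_cases j <;> simp [fB] <;> first | exact h0 | exact h1 | exact h | exact h.neg | exact h.pow 2

lemma C2_alg (X : Matrix (Fin 4) (Fin 4) ℝ) (h : ∀ i j, IsAlgebraic ℤ (X i j)) (p q : Fin 6) : IsAlgebraic ℤ (C2 X p q) := by
  rw [C2_apply]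
  exact ((h _ _).mul (h _ _)).sub ((h _ _).mul (h _ _))

lemma forms_mul (G : Matrix (Fin 4) (Fin 4) ℤ) (k i : Fin 4) :
    ((G.map (Int.castRingHom ℝ)) * (fA α).transpose) k i = ∑ j, fA α i j * (G k j : ℝ) := by
  rw [phiM_mul]; rfl

/-- dual bound -/
lemma dual_bound (G : Matrix (Fin 4) (Fin 4) ℤ) (c l : Fin 4 → ℝ) (lq : ℝ)
    (h : ∀ k i, |∑ j, fA α i j * (G k j : ℝ)| ≤ Real.exp ((c i + l k) * lq)) (hc : ∑ i, c i = 0) (i k : Fin 4) :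
    |((fB α).transpose * (G.adjugate.map (Int.castRingHom ℝ))) i k| ≤ 24 * Real.exp ((-c i + (∑ k, l k - l k)) * lq) := by
  have h1 := adj_exp_le ((G.map (Int.castRingHom ℝ)) * (fA α).transpose) (fun i => c i * lq) (fun k => l k * lq) 1 le_rfl (by
    intro k i
    rw [forms_mul, one_mul, ← add_mul]
    exact h k i) i k
  rw [Matrix.adjugate_mul_distrib, ← Matrix.adjugate_transpose, fA_adj] at h1
  have e : (G.map (Int.castRingHom ℝ)).adjugate = G.adjugate.map (Int.castRingHom ℝ) := by
    have := (Int.castRingHom ℝ).map_adjugate G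
    rw [← RingHom.mapMatrix_apply, ← this]; rfl
  rw [e, ← Finset.sum_mul, ← Finset.sum_mul, hc] at h1
  refine h1.trans (le_of_eq ?_)
  have : (Nat.factorial (Fintype.card (Fin 4)) : ℝ) * 1 ^ Fintype.card (Fin 4) = 24 := by
    simp [Fintype.card_fin, Nat.factorial]
  rw [this]
  congr 2
  ring
end Forms
end SubsThm
end

set_option linter.unusedSectionVars false
noncomputable section
namespace SubsThm
open Finset

section Cases

/-- data coming from the successive minima -/
structure Dat (α K1 κ0 κ' lq : ℝ) (c l : Fin 4 → ℝ) (G : Matrix (Fin 4) (Fin 4) ℤ) : Prop where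
  hlq : 0 < lq
  csum : ∑ i, c i = 0
  cb : ∀ i, |c i| ≤ K1
  lb : ∀ i, |l i| ≤ K1
  c0 : κ0 ≤ c 0
  c2 : κ0 ≤ c 2
  c1 : c 1 ≤ -κ0
  c3 : c 3 ≤ -κ0
  c01 : κ0 ≤ c 0 + c 1
  det : G.det ≠ 0
  bd : ∀ k i, |∑ j, fA α i j * (G k j : ℝ)| ≤ Real.exp ((c i + l k) * lq)
  mono : Monotone l
  lsum : ∑ i, l i ≤ κ'

lemma int_zero_of_lt (x : ℤ) (h : |(x : ℝ)| < 1) : x = 0 := by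
  rw [← Int.cast_abs] at h
  have : |x| < 1 := by exact_mod_cast h
  exact Int.abs_lt_one_iff.1 this

lemma exp_small (K c : ℝ) (hc : 0 < c) : ∃ X0 : ℝ, ∀ lq, X0 ≤ lq → K * Real.exp (-c * lq) < 1 := by
  have h1 : Tendsto (fun x : ℝ => K * Real.exp (-(c * x))) atTop (𝓝 (K * 0)) := by
    apply Tendsto.const_mul
    exact Real.tendsto_exp_neg_atTop_nhds_zero.comp (tendsto_id.const_mul_atTop hc)
  rw [mul_zero] at h1
  obtain ⟨X0, h⟩ := eventually_atTop.1 (h1.eventually (gt_mem_nhds one_pos))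
  refine ⟨X0, fun lq hl => ?_⟩
  rw [neg_mul]; exact h lq hl

variable (α : ℝ) (hα : IsAlgebraic ℤ α)
  (hquad : ∀ x y z : ℤ, (x : ℝ) + y * α + z * α ^ 2 = 0 → x = 0 ∧ y = 0 ∧ z = 0)
  (K1 κ0 η κ' : ℝ) (hκ0 : 0 < κ0) (hη : 0 < η) (hκ' : 0 < κ') (h1 : κ' ≤ η / 8) (h2 : κ' ≤ κ0 / 8)
include hα hquad hκ0 hη hκ' h1 h2

theorem case3 : ∃ X0 : ℝ, ∀ (lq : ℝ) (c l : Fin 4 → ℝ) (G : Matrix (Fin 4) (Fin 4) ℤ), X0 ≤ lq →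
    Dat α K1 κ0 κ' lq c l G → η ≤ l 3 - l 2 → False := by
  obtain ⟨X1, hX1⟩ := exp_small 24 (κ0 / 2) (by positivity)
  obtain ⟨X2, hX2⟩ := engine3 (fA α) (fB α) (fBA α) (fB_alg α hα) 3 (fun (_ : Fin 1) i => fB α i 0)
    (fun _ i => fB_alg α hα i 0) 24 K1 (η / 2) (κ0 / 2) (by norm_num) (by positivity) (by positivity)
  refine ⟨max X1 X2, fun lq c l G hlq D hgap => ?_⟩
  have hs1 := hX1 lq ((le_max_left _ _).trans hlq)
  have hls := D.lsum
  have hm1 : l 0 ≤ l 3 := D.mono (by decide)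
  have hm2 : l 1 ≤ l 3 := D.mono (by decide)
  have hm3 : l 2 ≤ l 3 := D.mono (by decide)
  have hsum4 : ∑ i, l i = l 0 + l 1 + l 2 + l 3 := Fin.sum_univ_four l
  have hdual : ∀ i, κ0 ≤ c i → |∑ j, (G.adjugate j 3 : ℝ) * fB α j i| ≤ 24 * Real.exp (-(κ0 / 2) * lq) := by
    intro i hi
    have h := dual_bound α G c l lq D.bd D.csum i 3
    rw [Matrix.mul_apply] at h
    have e : ∑ j, (fB α).transpose i j * (G.adjugate.map (Int.castRingHom ℝ)) j 3 = ∑ j, (G.adjugate j 3 : ℝ) * fB α j i :=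
      Finset.sum_congr rfl fun j _ => by rw [mul_comm]; rfl
    rw [e] at h
    refine h.trans ?_
    apply mul_le_mul_of_nonneg_left _ (by norm_num)
    apply Real.exp_le_exp.2
    apply mul_le_mul_of_nonneg_right _ D.hlq.le
    linarith
  refine hX2 lq ((le_max_right _ _).trans hlq) G G.adjugate G.det c l (l 2) D.det (Matrix.mul_adjugate G) ?_ ?_ D.cb D.lb
    (D.lb 2) ?_ ⟨0, ?_, hdual 0 D.c0⟩
  · intro k i
    refine (D.bd k i).trans ?_
    linarith [Real.exp_pos ((c i + l k) * lq)]
  · intro k hk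
    apply D.mono
    fin_cases k <;> simp at hk ⊢
  · have : ∑ k ∈ univ.erase 3, l k = ∑ k, l k - l 3 := by
      rw [← Finset.add_sum_erase _ _ (mem_univ (3 : Fin 4))]; ring
    rw [D.csum, this]
    linarith
  · intro h0
    have e0 : ((G.adjugate 0 3 : ℤ) : ℝ) + ((G.adjugate 1 3 + G.adjugate 2 3 : ℤ) : ℝ) * α + (G.adjugate 3 3 : ℤ) * α ^ 2 = 0 := by
      rw [← h0]; simp [Fin.sum_univ_four, fB]; ring
    obtain ⟨z0, z1, z3⟩ := hquad _ _ _ e0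
    have e2 := hdual 2 D.c2
    have e3 : ∑ j, (G.adjugate j 3 : ℝ) * fB α j 2 = (G.adjugate 2 3 : ℤ) := by
      simp [Fin.sum_univ_four, fB, z3]
    rw [e3] at e2
    have z2 := int_zero_of_lt _ (lt_of_le_of_lt e2 hs1)
    have z1' : G.adjugate 1 3 = 0 := by omega
    have hG := congrFun (congrFun (Matrix.mul_adjugate G) 3) 3
    rw [Matrix.mul_apply, Fin.sum_univ_four, z0, z1', z2, z3] at hG
    simp at hG
    exact D.det hG.symm

theorem case1 : ∃ X0 : ℝ, ∀ (lq : ℝ) (c l : Fin 4 → ℝ) (G : Matrix (Fin 4) (Fin 4) ℤ), X0 ≤ lq →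
    Dat α K1 κ0 κ' lq c l G → η ≤ l 1 - l 0 → False := by
  obtain ⟨X1, hX1⟩ := exp_small 24 (κ0 / 2) (by positivity)
  obtain ⟨X2, hX2⟩ := engine3 (fB α).transpose (fA α).transpose (by
      rw [← Matrix.transpose_mul, fBA, Matrix.transpose_one]) (fun i j => fA_alg α hα j i) 0 (fun (_ : Fin 1) i => fA α 3 i)
    (fun _ i => fA_alg α hα 3 i) 24 (5 * K1) (η / 2) (κ0 / 2) (by norm_num) (by positivity) (by positivity)
  refine ⟨max X1 X2, fun lq c l G hlq D hgap => ?_⟩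
  have hs1 := hX1 lq ((le_max_left _ _).trans hlq)
  have hls := D.lsum
  have hm1 : l 0 ≤ l 1 := D.mono (by decide)
  have hm2 : l 0 ≤ l 2 := D.mono (by decide)
  have hm3 : l 0 ≤ l 3 := D.mono (by decide)
  have hsum4 : ∑ i, l i = l 0 + l 1 + l 2 + l 3 := Fin.sum_univ_four l
  have hK1 : 0 ≤ K1 := (abs_nonneg _).trans (D.cb 0)
  have hb1 : ∀ k, |∑ i, l i - l k| ≤ 5 * K1 := by
    intro k
    have a0 := abs_le.1 (D.lb 0)
    have a1 := abs_le.1 (D.lb 1)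
    have a2 := abs_le.1 (D.lb 2)
    have a3 := abs_le.1 (D.lb 3)
    have ak := abs_le.1 (D.lb k)
    rw [abs_le]; constructor <;> linarith
  have hprim : ∀ i, c i ≤ -κ0 → |∑ j, (G 0 j : ℝ) * fA α i j| ≤ 24 * Real.exp (-(κ0 / 2) * lq) := by
    intro i hi
    have h := D.bd 0 i
    have e : ∑ j, fA α i j * (G 0 j : ℝ) = ∑ j, (G 0 j : ℝ) * fA α i j :=
      Finset.sum_congr rfl fun j _ => mul_comm _ _
    rw [e] at h
    refine h.trans ?_
    have : Real.exp ((c i + l 0) * lq) ≤ Real.exp (-(κ0 / 2) * lq) := by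
      apply Real.exp_le_exp.2
      apply mul_le_mul_of_nonneg_right _ D.hlq.le
      linarith
    linarith [Real.exp_pos (-(κ0 / 2) * lq)]
  refine hX2 lq ((le_max_right _ _).trans hlq) G.adjugate.transpose G.transpose G.det (fun i => -c i)
    (fun k => ∑ i, l i - l k) (∑ i, l i - l 1) D.det ?_ ?_ ?_ ?_ hb1
    (hb1 1) ?_ ⟨0, ?_, hprim 3 D.c3⟩
  · rw [← Matrix.transpose_mul, Matrix.mul_adjugate, Matrix.transpose_smul, Matrix.transpose_one]
  · intro k i
    have h := dual_bound α G c l lq D.bd D.csum i k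
    rw [Matrix.mul_apply] at h
    exact h
  · intro k hk
    have : l 1 ≤ l k := by
      apply D.mono
      fin_cases k <;> simp at hk ⊢ <;> decide
    linarith
  · intro i
    rw [abs_neg]
    linarith [D.cb i]
  · rw [Finset.sum_neg_distrib, D.csum]
    have : ∑ k ∈ univ.erase 0, (∑ i, l i - l k) = 3 * ∑ i, l i - (∑ k, l k - l 0) := by
      have : ∑ k ∈ univ.erase (0 : Fin 4), (∑ i, l i - l k) = ∑ k, (∑ i, l i - l k) - (∑ i, l i - l 0) :=
        Finset.sum_erase_eq_sub (mem_univ (0 : Fin 4))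
      rw [this, Finset.sum_sub_distrib, Finset.sum_const]
      simp
      ring
    rw [this]
    linarith
  · intro h0
    have e0 : ((G 0 3 : ℤ) : ℝ) + ((-(G 0 1 + G 0 2) : ℤ) : ℝ) * α + (G 0 0 : ℤ) * α ^ 2 = 0 := by
      rw [← h0]; simp [Fin.sum_univ_four, fA]; ring
    obtain ⟨z3, z1, z0⟩ := hquad _ _ _ e0
    have e2 := hprim 1 D.c1
    have e3 : ∑ j, (G 0 j : ℝ) * fA α 1 j = (G 0 1 : ℤ) := by
      simp [Fin.sum_univ_four, fA, z0]
    rw [e3] at e2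
    have z2 := int_zero_of_lt _ (lt_of_le_of_lt e2 hs1)
    have z1' : G 0 2 = 0 := by omega
    apply D.det
    apply Matrix.det_eq_zero_of_row_eq_zero 0
    intro j
    fin_cases j
    · exact z0
    · exact z2
    · exact z1'
    · exact z3

theorem case2 : ∃ X0 : ℝ, ∀ (lq : ℝ) (c l : Fin 4 → ℝ) (G : Matrix (Fin 4) (Fin 4) ℤ), X0 ≤ lq →
    Dat α K1 κ0 κ' lq c l G → η ≤ l 2 - l 1 → False := by
  obtain ⟨X2, hX2⟩ := engine3 (C2 (fA α)) (C2 (fB α)) (by rw [← C2_mul, fBA, C2_one]) (C2_alg _ (fB_alg α hα)) 5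
    (fun (s : Fin 2) i => C2 (fB α) i (![0, 1] s))
    (fun s i => C2_alg _ (fB_alg α hα) _ _) (2 * 24 ^ 2) (2 * K1) (η / 2) (κ0 / 2) (by norm_num) (by positivity) (by positivity)
  refine ⟨X2, fun lq c l G hlq D hgap => ?_⟩
  have hls := D.lsum
  have hm1 : l 0 ≤ l 1 := D.mono (by decide)
  have hm2 : l 1 ≤ l 2 := D.mono (by decide)
  have hm3 : l 2 ≤ l 3 := D.mono (by decide)
  have hsum4 : ∑ i, l i = l 0 + l 1 + l 2 + l 3 := Fin.sum_univ_four l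
  have hc4 : ∑ i, c i = c 0 + c 1 + c 2 + c 3 := Fin.sum_univ_four c
  have hb1 : ∀ i k, |l i + l k| ≤ 2 * K1 := fun i k => (abs_add_le _ _).trans (by linarith [D.lb i, D.lb k])
  have hdual : ∀ p, κ0 ≤ c (pr p).1 + c (pr p).2 →
      |∑ j, ((C2 G.adjugate j 5 : ℤ) : ℝ) * C2 (fB α) j p| ≤ 2 * 24 ^ 2 * Real.exp (-(κ0 / 2) * lq) := by
    intro p hp
    have h := C2_bound ((fB α).transpose * (G.adjugate.map (Int.castRingHom ℝ))) (fun i => -c i * lq)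
      (fun k => (∑ i, l i - l k) * lq) 24 (by norm_num) (by
        intro i k
        rw [← add_mul]
        exact dual_bound α G c l lq D.bd D.csum i k) p 5
    rw [C2_mul, Matrix.mul_apply, C2_transpose] at h
    have e : ∑ j, (C2 (fB α)).transpose p j * C2 (G.adjugate.map (Int.castRingHom ℝ)) j 5 =
        ∑ j, ((C2 G.adjugate j 5 : ℤ) : ℝ) * C2 (fB α) j p :=
      Finset.sum_congr rfl fun j _ => by rw [mul_comm, C2_map]; rfl
    rw [e] at h
    refine h.trans ?_
    apply mul_le_mul_of_nonneg_left _ (by norm_num)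
    apply Real.exp_le_exp.2
    have e5 : (pr 5).1 = 2 ∧ (pr 5).2 = 3 := ⟨rfl, rfl⟩
    rw [e5.1, e5.2, ← add_mul, ← add_mul, ← add_mul]
    apply mul_le_mul_of_nonneg_right _ D.hlq.le
    linarith
  refine hX2 lq hlq (C2 G) (C2 G.adjugate) (G.det ^ 2) (fun p => c (pr p).1 + c (pr p).2)
    (fun p => l (pr p).1 + l (pr p).2) (l 1 + l 3) (pow_ne_zero _ D.det) ?_ ?_ ?_ ?_ (fun p => hb1 _ _) (hb1 1 3) ?_ ?_
  · rw [← C2_mul, Matrix.mul_adjugate, C2_smul, C2_one]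
  · intro k i
    have h := C2_bound (fA α * (G.map (Int.castRingHom ℝ)).transpose) (fun i => c i * lq)
      (fun k => l k * lq) 1 (by norm_num) (by
        intro i k
        rw [← add_mul, one_mul]
        refine le_trans (le_of_eq ?_) (D.bd k i)
        rw [← forms_mul]
        rw [show (fA α * (G.map (Int.castRingHom ℝ)).transpose) i k = (fA α * (G.map (Int.castRingHom ℝ)).transpose).transpose k i from rfl,
          Matrix.transpose_mul, Matrix.transpose_transpose]) i k
    rw [C2_mul, Matrix.mul_apply, C2_transpose] at h
    have e : ∑ j, C2 (fA α) i j * (C2 (G.map (Int.castRingHom ℝ))).transpose j k = ∑ j, C2 (fA α) i j * ((C2 G k j : ℤ) : ℝ) :=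
      Finset.sum_congr rfl fun j _ => by rw [C2_map]; rfl
    rw [e, ← add_mul, ← add_mul, ← add_mul] at h
    refine h.trans ?_
    apply mul_le_mul_of_nonneg_right _ (Real.exp_pos _).le
    norm_num
  · intro p hp
    fin_cases p <;> simp [pr] at hp ⊢ <;> linarith
  · intro p
    exact (abs_add_le _ _).trans (by linarith [D.cb (pr p).1, D.cb (pr p).2])
  · have e1 : ∑ p : Fin 6, (c (pr p).1 + c (pr p).2) = 3 * ∑ i, c i := by
      rw [hc4]; simp [Fin.sum_univ_succ, pr]; ring
    have e2 : ∑ p ∈ univ.erase (5 : Fin 6), (l (pr p).1 + l (pr p).2) = 3 * ∑ i, l i - (l 2 + l 3) := by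
      have : ∑ p ∈ univ.erase (5 : Fin 6), (l (pr p).1 + l (pr p).2) = ∑ p, (l (pr p).1 + l (pr p).2) - (l 2 + l 3) := by
        rw [← Finset.add_sum_erase _ _ (mem_univ (5 : Fin 6))]; simp [pr]
      rw [this, hsum4]; simp [Fin.sum_univ_succ, pr]; ring
    rw [e1, e2, D.csum]
    linarith
  · have hc02 : κ0 ≤ c 0 + c 2 := by linarith [D.c0, D.c2]
    by_cases z : ∑ j, ((C2 G.adjugate j 5 : ℤ) : ℝ) * C2 (fB α) j 0 = 0
    · by_cases z' : ∑ j, ((C2 G.adjugate j 5 : ℤ) : ℝ) * C2 (fB α) j 1 = 0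
      · exfalso
        set M : Fin 6 → ℤ := fun j => C2 G.adjugate j 5 with hM
        have e0 : ((M 0 : ℤ) : ℝ) + ((M 2 - M 3 : ℤ) : ℝ) * α + (M 5 : ℤ) * α ^ 2 = 0 := by
          rw [← z]; rw [Fin.sum_univ_six]; simp only [C2_apply (fB α)]; simp [pr, fB, hM]; ring
        have e1 : ((M 1 : ℤ) : ℝ) + ((M 2 + M 3 : ℤ) : ℝ) * α + (M 4 : ℤ) * α ^ 2 = 0 := by
          rw [← z']; rw [Fin.sum_univ_six]; simp only [C2_apply (fB α)]; simp [pr, fB, hM]; ring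
        obtain ⟨y0, y1, y2⟩ := hquad _ _ _ e0
        obtain ⟨x0, x1, x2⟩ := hquad _ _ _ e1
        have y3 : M 2 = 0 := by omega
        have y4 : M 3 = 0 := by omega
        have hG : C2 G * C2 G.adjugate = G.det ^ 2 • (1 : Matrix (Fin 6) (Fin 6) ℤ) := by
          rw [← C2_mul, Matrix.mul_adjugate, C2_smul, C2_one]
        have hG5 := congrFun (congrFun hG 5) 5
        rw [Matrix.mul_apply, Fin.sum_univ_six] at hG5
        change C2 G 5 0 * M 0 + C2 G 5 1 * M 1 + C2 G 5 2 * M 2 + C2 G 5 3 * M 3 + C2 G 5 4 * M 4 + C2 G 5 5 * M 5 = _ at hG5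
        rw [y0, x0, y3, y4, x2, y2] at hG5
        simp at hG5
        exact pow_ne_zero 2 D.det hG5.symm
      · exact ⟨1, z', hdual 1 hc02⟩
    · exact ⟨0, z, hdual 0 D.c01⟩
end Cases
end SubsThm
end

set_option linter.unusedSectionVars false
noncomputable section
namespace SubsThm
open Finset

section Gap

lemma B_cancel (α : ℝ) (x : Fin 4 → ℝ) (j : Fin 4) : x j = ∑ i, fB α j i * ∑ k, fA α i k * x k := by
  have h : (fB α).mulVec ((fA α).mulVec x) = x := by
    rw [Matrix.mulVec_mulVec, fBA, Matrix.one_mulVec]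
  conv_lhs => rw [← h]
  rfl

theorem gap_contra (α : ℝ) (hα : IsAlgebraic ℤ α)
    (hquad : ∀ x y z : ℤ, (x : ℝ) + y * α + z * α ^ 2 = 0 → x = 0 ∧ y = 0 ∧ z = 0)
    (Kb K D κ0 : ℝ) (hKb : 0 ≤ Kb) (hK : 0 ≤ K) (hD : 0 < D) (hκ0 : 0 < κ0) :
    ∃ X0 : ℝ, ∀ (lq : ℝ), X0 ≤ lq → ∀ (c : Fin 4 → ℝ) (h : Fin 4 → ℤ), ∑ i, c i = 0 → (∀ i, |c i| ≤ Kb) →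
      κ0 ≤ c 0 → κ0 ≤ c 2 → c 1 ≤ -κ0 → c 3 ≤ -κ0 → κ0 ≤ c 0 + c 1 → h ≠ 0 →
      (∀ i, |∑ j, (h j : ℝ) * fB α j i| ≤ K * Real.exp ((-c i - D) * lq)) → False := by
  set η : ℝ := D / 6 with hη
  have hη0 : 0 < η := by positivity
  set κ' : ℝ := min 1 (min (η / 8) (κ0 / 8)) with hκ'
  have hκ'0 : 0 < κ' := lt_min one_pos (lt_min (by positivity) (by positivity))
  have k1 : κ' ≤ 1 := min_le_left _ _
  have k2 : κ' ≤ η / 8 := (min_le_right _ _).trans (min_le_left _ _)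
  have k3 : κ' ≤ κ0 / 8 := (min_le_right _ _).trans (min_le_right _ _)
  set K1 : ℝ := 4 * (Kb + 1) with hK1
  obtain ⟨X1, hX1⟩ := case1 α hα hquad K1 κ0 η κ' hκ0 hη0 hκ'0 k2 k3
  obtain ⟨X2, hX2⟩ := case2 α hα hquad K1 κ0 η κ' hκ0 hη0 hκ'0 k2 k3
  obtain ⟨X3, hX3⟩ := case3 α hα hquad K1 κ0 η κ' hκ0 hη0 hκ'0 k2 k3
  obtain ⟨X4, hX4⟩ := exp_small (4 * K) (D / 2) (by positivity)
  set CB : ℝ := ∑ j, ∑ i, |fB α j i| + 1 with hCB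
  have hCB1 : 1 ≤ CB := by
    rw [hCB]; linarith [show (0:ℝ) ≤ ∑ j, ∑ i, |fB α j i| by positivity]
  set C4 : ℝ := (2 * 3 ^ 4) ^ 4 with hC4
  refine ⟨max (max (max X1 X2) (max X3 X4)) (max 1 (max (Real.log CB) (Real.log C4 / κ'))), ?_⟩
  intro lq hlq c h hc hcb hc0 hc2 hc1 hc3 hc01 hh hhb
  simp only [max_le_iff] at hlq
  obtain ⟨⟨⟨g1, g2⟩, g3, g4⟩, g5, g6, g7⟩ := hlq
  have hlq0 : 0 < lq := by linarith
  set M : Matrix (Fin 4) (Fin 4) ℝ := Matrix.diagonal (fun i => Real.exp (-(c i * lq))) * fA α with hM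
  have hMdet : M.det = 1 := by
    rw [hM, Matrix.det_mul, Matrix.det_diagonal, fA_det, mul_one, ← Real.exp_sum, Finset.sum_neg_distrib,
      ← Finset.sum_mul, hc]
    simp
  obtain ⟨G, m, hG, hmono, hmpos, hbd, hprod⟩ := minima M (by rw [hMdet]; norm_num)
  rw [hMdet, abs_one, mul_one] at hprod
  set l : Fin 4 → ℝ := fun k => Real.log (m k) / lq with hl
  have hml : ∀ k, m k = Real.exp (l k * lq) := by
    intro k
    rw [hl]; simp only
    rw [div_mul_cancel₀ _ hlq0.ne', Real.exp_log (hmpos k)]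
  have hlmono : Monotone l := by
    intro i j hij
    exact div_le_div_of_nonneg_right (Real.log_le_log (hmpos i) (hmono hij)) hlq0.le
  have hbd' : ∀ k i, |∑ j, fA α i j * (G k j : ℝ)| ≤ Real.exp ((c i + l k) * lq) := by
    intro k i
    have h1 := hbd k i
    have e : ∑ j, M i j * (G k j : ℝ) = Real.exp (-(c i * lq)) * ∑ j, fA α i j * (G k j : ℝ) := by
      rw [Finset.mul_sum]
      refine Finset.sum_congr rfl fun j _ => ?_
      rw [hM, Matrix.diagonal_mul, mul_assoc]
    rw [e, abs_mul, abs_of_pos (Real.exp_pos _), hml] at h1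
    rw [add_mul, Real.exp_add]
    calc |∑ j, fA α i j * (G k j : ℝ)| = Real.exp (c i * lq) * (Real.exp (-(c i * lq)) * |∑ j, fA α i j * (G k j : ℝ)|) := by
          rw [← mul_assoc, ← Real.exp_add]; simp
      _ ≤ _ := mul_le_mul_of_nonneg_left h1 (Real.exp_pos _).le
  have hlsum : ∑ k, l k ≤ κ' := by
    have h1 : Real.exp ((∑ k, l k) * lq) ≤ C4 := by
      rw [Finset.sum_mul, Real.exp_sum]
      refine le_trans (le_of_eq ?_) hprod
      exact Finset.prod_congr rfl fun k _ => (hml k).symm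
    have h2 : (∑ k, l k) * lq ≤ Real.log C4 := (Real.le_log_iff_exp_le (by positivity)).2 h1
    have h3 : Real.log C4 ≤ lq * κ' := (div_le_iff₀ hκ'0).1 g7
    nlinarith
  have hsum4 : ∑ i, l i = l 0 + l 1 + l 2 + l 3 := Fin.sum_univ_four l
  have hm1 : l 0 ≤ l 1 := hlmono (by decide)
  have hm2 : l 1 ≤ l 2 := hlmono (by decide)
  have hm3 : l 2 ≤ l 3 := hlmono (by decide)
  have hl0 : -(Kb + 1) ≤ l 0 := by
    obtain ⟨j, hj⟩ : ∃ j, G 0 j ≠ 0 := by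
      by_contra! h0
      exact hG (Matrix.det_eq_zero_of_row_eq_zero 0 h0)
    have h1 : (1:ℝ) ≤ |(G 0 j : ℝ)| := by
      rw [← Int.cast_abs]; exact_mod_cast Int.one_le_abs hj
    rw [B_cancel α (fun k => (G 0 k : ℝ)) j] at h1
    have h2 : |∑ i, fB α j i * ∑ k, fA α i k * (G 0 k : ℝ)| ≤ CB * Real.exp ((Kb + l 0) * lq) := by
      refine (Finset.abs_sum_le_sum_abs _ _).trans ?_
      calc ∑ i, |fB α j i * ∑ k, fA α i k * (G 0 k : ℝ)| ≤ ∑ i, |fB α j i| * Real.exp ((Kb + l 0) * lq) := by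
            refine Finset.sum_le_sum fun i _ => ?_
            rw [abs_mul]
            apply mul_le_mul_of_nonneg_left _ (abs_nonneg _)
            refine (hbd' 0 i).trans (Real.exp_le_exp.2 ?_)
            apply mul_le_mul_of_nonneg_right _ hlq0.le
            linarith [(abs_le.1 (hcb i)).2]
        _ ≤ _ := by
            rw [← Finset.sum_mul]
            apply mul_le_mul_of_nonneg_right _ (Real.exp_pos _).le
            rw [hCB]
            have := Finset.single_le_sum (f := fun j => ∑ i, |fB α j i|) (fun j _ => by positivity) (mem_univ j)
            exact this.trans (by linarith)
    have h3 : (1:ℝ) ≤ Real.exp ((Kb + 1 + l 0) * lq) := by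
      refine (h1.trans h2).trans ?_
      have : CB ≤ Real.exp lq := (Real.log_le_iff_le_exp (by linarith)).1 g6
      refine (mul_le_mul_of_nonneg_right this (Real.exp_pos _).le).trans (le_of_eq ?_)
      rw [← Real.exp_add]; congr 1; ring
    have h4 : 0 ≤ (Kb + 1 + l 0) * lq := by
      by_contra! hn
      have : Real.exp ((Kb + 1 + l 0) * lq) < 1 := (Real.exp_lt_exp.2 hn).trans_eq Real.exp_zero
      linarith
    have h5 : 0 ≤ Kb + 1 + l 0 := nonneg_of_mul_nonneg_left h4 hlq0
    linarith
  have hlb : ∀ k, |l k| ≤ K1 := by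
    intro k
    have a1 : l 0 ≤ l k := hlmono (Fin.zero_le k)
    have a2 : l k ≤ l 3 := hlmono (Fin.le_last k)
    rw [abs_le, hK1]
    constructor <;> linarith
  have hl3 : D / 2 ≤ l 3 := by
    obtain ⟨k, hk⟩ : ∃ k, ∑ j, h j * G k j ≠ 0 := by
      by_contra! h0
      have : G.mulVec h = 0 := by
        funext k
        rw [Matrix.mulVec, dotProduct]
        exact (Finset.sum_congr rfl fun j _ => mul_comm _ _).trans (h0 k)
      exact hh (Matrix.eq_zero_of_mulVec_eq_zero hG this)
    have h1 : (1:ℝ) ≤ |((∑ j, h j * G k j : ℤ) : ℝ)| := by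
      rw [← Int.cast_abs]; exact_mod_cast Int.one_le_abs hk
    have e : ((∑ j, h j * G k j : ℤ) : ℝ) = ∑ i, (∑ j, (h j : ℝ) * fB α j i) * ∑ j, fA α i j * (G k j : ℝ) := by
      push_cast
      have : ∀ j, (h j : ℝ) * (G k j : ℝ) = ∑ i, (h j : ℝ) * fB α j i * ∑ j, fA α i j * (G k j : ℝ) := by
        intro j
        conv_lhs => rw [B_cancel α (fun j => (G k j : ℝ)) j]
        rw [Finset.mul_sum]
        exact Finset.sum_congr rfl fun i _ => by ring
      simp only [this, Finset.sum_mul]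
      rw [Finset.sum_comm]
    rw [e] at h1
    have h2 : |∑ i, (∑ j, (h j : ℝ) * fB α j i) * ∑ j, fA α i j * (G k j : ℝ)| ≤ 4 * K * Real.exp ((l 3 - D) * lq) := by
      refine (Finset.abs_sum_le_sum_abs _ _).trans ?_
      have : ∀ i ∈ (univ : Finset (Fin 4)), |(∑ j, (h j : ℝ) * fB α j i) * ∑ j, fA α i j * (G k j : ℝ)| ≤ K * Real.exp ((l 3 - D) * lq) := by
        intro i _
        rw [abs_mul]
        refine (mul_le_mul (hhb i) (hbd' k i) (abs_nonneg _) (by positivity)).trans ?_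
        rw [mul_assoc, ← Real.exp_add, ← add_mul]
        apply mul_le_mul_of_nonneg_left _ hK
        apply Real.exp_le_exp.2
        apply mul_le_mul_of_nonneg_right _ hlq0.le
        have : l k ≤ l 3 := hlmono (Fin.le_last k)
        linarith
      refine (Finset.sum_le_sum this).trans (le_of_eq ?_)
      simp; ring
    by_contra! hcon
    have h3 := hX4 lq g4
    have h4 : 4 * K * Real.exp ((l 3 - D) * lq) ≤ 4 * K * Real.exp (-(D / 2) * lq) := by
      apply mul_le_mul_of_nonneg_left _ (by positivity)
      apply Real.exp_le_exp.2
      apply mul_le_mul_of_nonneg_right _ hlq0.le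
      linarith
    linarith
  have hDat : Dat α K1 κ0 κ' lq c l G := ⟨hlq0, hc, fun i => (hcb i).trans (by rw [hK1]; linarith), hlb, hc0, hc2, hc1, hc3, hc01, hG,
    hbd', hlmono, hlsum⟩
  by_cases q1 : η ≤ l 1 - l 0
  · exact hX1 lq c l G g1 hDat q1
  by_cases q2 : η ≤ l 2 - l 1
  · exact hX2 lq c l G g2 hDat q2
  by_cases q3 : η ≤ l 3 - l 2
  · exact hX3 lq c l G g3 hDat q3
  push Not at q1 q2 q3
  linarith
end Gap
end SubsThm
end

set_option linter.unusedSectionVars false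
noncomputable section
namespace SubsThm
open Finset

/-- real denominators -/
def rq (a : ℕ → ℕ) (l : ℕ) : ℝ := cfQ a l
/-- real numerators -/
def rp (a : ℕ → ℕ) (l : ℕ) : ℝ := cfP a l

lemma rq_step (a : ℕ → ℕ) (l : ℕ) : rq a (l+2) = a (l+1) * rq a (l+1) + rq a l := by
  simp [rq, cfQ]
lemma rp_step (a : ℕ → ℕ) (l : ℕ) : rp a (l+2) = a (l+1) * rp a (l+1) + rp a l := by
  simp [rp, cfP]

lemma rpq_det (a : ℕ → ℕ) (l : ℕ) : rp a (l+1) * rq a l - rp a l * rq a (l+1) = (-1)^l := by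
  induction l with
  | zero => simp [rp, rq, cfP, cfQ]
  | succ l ih =>
    rw [rq_step, rp_step, pow_succ, ← ih]; ring

lemma cfQ_pos (a : ℕ → ℕ) (ha : ∀ i, 0 < a i) (l : ℕ) : 0 < cfQ a l ∧ 0 < cfQ a (l+1) := by
  induction l with
  | zero => exact ⟨by simp [cfQ], by simpa [cfQ] using ha 0⟩
  | succ l ih =>
    refine ⟨ih.2, ?_⟩
    show 0 < a (l+1) * cfQ a (l+1) + cfQ a l
    have := ih.1
    omega

lemma rq_one_le (a : ℕ → ℕ) (ha : ∀ i, 0 < a i) (l : ℕ) : 1 ≤ rq a l := by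
  have := (cfQ_pos a ha l).1
  unfold rq
  exact_mod_cast this

lemma rq_pos (a : ℕ → ℕ) (ha : ∀ i, 0 < a i) (l : ℕ) : 0 < rq a l :=
  lt_of_lt_of_le one_pos (rq_one_le a ha l)

lemma rq_mono (a : ℕ → ℕ) (ha : ∀ i, 0 < a i) : Monotone (rq a) := by
  apply monotone_nat_of_le_succ
  intro l
  cases l with
  | zero =>
    have : (1:ℝ) ≤ a 0 := by exact_mod_cast ha 0
    simpa [rq, cfQ] using this
  | succ l =>
    rw [rq_step]
    have h1 : (1:ℝ) ≤ a (l+1) := by exact_mod_cast ha (l+1)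
    nlinarith [rq_pos a ha (l+1), rq_pos a ha l]

lemma rq_two (a : ℕ → ℕ) (ha : ∀ i, 0 < a i) (l : ℕ) : 2 * rq a l ≤ rq a (l+2) := by
  rw [rq_step]
  have h1 : (1:ℝ) ≤ a (l+1) := by exact_mod_cast ha (l+1)
  have h2 := rq_mono a ha (Nat.le_succ l)
  have h3 := rq_pos a ha (l+1)
  simp only [Nat.succ_eq_add_one] at h2
  nlinarith

lemma rq_log_lb (a : ℕ → ℕ) (ha : ∀ i, 0 < a i) (l : ℕ) :
    ((l:ℝ) - 1) / 2 * Real.log 2 ≤ Real.log (rq a l) ∧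
    ((l:ℝ) ) / 2 * Real.log 2 ≤ Real.log (rq a (l+1)) := by
  induction l with
  | zero =>
    refine ⟨?_, ?_⟩
    · have h1 := Real.log_nonneg (rq_one_le a ha 0)
      have h2 := Real.log_nonneg (one_le_two : (1:ℝ) ≤ 2)
      push_cast; linarith
    · have h1 := Real.log_nonneg (rq_one_le a ha 1)
      simpa using h1
  | succ l ih =>
    refine ⟨?_, ?_⟩
    · have := ih.2
      push_cast
      simpa using this
    · have h1 := Real.log_le_log (by have := rq_pos a ha l; positivity) (rq_two a ha l)
      rw [Real.log_mul two_ne_zero (rq_pos a ha l).ne'] at h1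
      have := ih.1
      push_cast
      show _ ≤ Real.log (rq a (l+2))
      linarith

/-- signed error, positive -/
def er (a : ℕ → ℕ) (α : ℝ) (l : ℕ) : ℝ := (-1)^l * (α * rq a l - rp a l)

lemma er_step (a : ℕ → ℕ) (α : ℝ) (l : ℕ) : er a α l = a (l+1) * er a α (l+1) + er a α (l+2) := by
  unfold er
  rw [rq_step, rp_step, pow_succ, pow_succ]; ring

lemma neg_one_sq_pow (l : ℕ) : ((-1:ℝ)^l) * (-1)^l = 1 := by
  rw [← mul_pow]; simp

lemma er_det (a : ℕ → ℕ) (α : ℝ) (l : ℕ) :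
    er a α (l+1) * rq a l + er a α l * rq a (l+1) = 1 := by
  unfold er
  have h := rpq_det a l
  have h2 := neg_one_sq_pow l
  rw [pow_succ]
  calc _ = (-1)^l * (rp a (l+1) * rq a l - rp a l * rq a (l+1)) := by ring
    _ = 1 := by rw [h, h2]

lemma er_pos (a : ℕ → ℕ) (ha : ∀ i, 0 < a i) (α : ℝ)
    (hα : Tendsto (fun ℓ => (cfP a ℓ : ℝ) / (cfQ a ℓ : ℝ)) atTop (𝓝 α)) (l : ℕ) :
    0 < er a α l := by
  set f : ℕ → ℝ := fun k => (-1)^l * (rp a (l+2*k) / rq a (l+2*k)) with hf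
  have hmono : StrictMono f := by
    apply strictMono_nat_of_lt_succ
    intro k
    simp only [hf]
    have q0 := rq_pos a ha (l+2*k)
    have q2 := rq_pos a ha (l+2*k+2)
    have e : rp a (l+2*k+2) / rq a (l+2*k+2) - rp a (l+2*k) / rq a (l+2*k)
        = a (l+2*k+1) * (-1)^l / (rq a (l+2*k) * rq a (l+2*k+2)) := by
      rw [div_sub_div _ _ q2.ne' q0.ne', mul_comm (rq a (l+2*k)) (rq a (l+2*k+2))]
      congr 1
      have h := rpq_det a (l+2*k)
      rw [pow_add, pow_mul] at h
      rw [rp_step, rq_step]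
      have h' : ((-1:ℝ)^l) = rp a (l + 2 * k + 1) * rq a (l + 2 * k) - rp a (l + 2 * k) * rq a (l + 2 * k + 1) := by
        rw [h]; simp
      rw [h']; ring
    have e2 : (-1)^l * (rp a (l+2*k+2) / rq a (l+2*k+2)) - (-1)^l * (rp a (l+2*k) / rq a (l+2*k))
        = a (l+2*k+1) / (rq a (l+2*k) * rq a (l+2*k+2)) := by
      rw [← mul_sub, e]
      calc _ = ((-1:ℝ)^l * (-1)^l) * (a (l+2*k+1) / (rq a (l+2*k) * rq a (l+2*k+2))) := by ring
        _ = _ := by rw [neg_one_sq_pow, one_mul]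
    have h1 : (0:ℝ) < a (l+2*k+1) := by exact_mod_cast ha (l+2*k+1)
    have : 0 < (a (l+2*k+1) : ℝ) / (rq a (l+2*k) * rq a (l+2*k+2)) := by positivity
    rw [show l + 2 * (k+1) = l+2*k+2 by ring]
    linarith
  have hlim : Tendsto f atTop (𝓝 ((-1)^l * α)) := by
    apply Tendsto.const_mul
    have : Tendsto (fun k : ℕ => l + 2 * k) atTop atTop :=
      tendsto_atTop_mono (fun k => by simp only [id]; omega) tendsto_id
    exact hα.comp this
  have h1 : f 0 < f 1 := hmono (by norm_num)
  have h2 : f 1 ≤ (-1)^l * α := hmono.monotone.ge_of_tendsto hlim 1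
  have h3 : f 0 = (-1)^l * (rp a l / rq a l) := by simp [hf]
  have hq := rq_pos a ha l
  unfold er
  have : (-1)^l * (α * rq a l - rp a l) = ((-1)^l * α - (-1)^l * (rp a l / rq a l)) * rq a l := by
    field_simp
  rw [this]
  apply mul_pos _ hq
  rw [← h3]; linarith

end SubsThm
end

set_option linter.unusedSectionVars false
noncomputable section
namespace SubsThm
open Finset

lemma quad_finite (r s t : ℝ) (h : ¬ (r = 0 ∧ s = 0 ∧ t = 0)) :
    {u : ℝ | r + s * u + t * u^2 = 0}.Finite := by
  set p : Polynomial ℝ := Polynomial.C r + Polynomial.C s * Polynomial.X + Polynomial.C t * Polynomial.X^2 with hp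
  have hp0 : p ≠ 0 := by
    intro hz
    apply h
    have c0 : p.coeff 0 = 0 := by rw [hz]; simp
    have c1 : p.coeff 1 = 0 := by rw [hz]; simp
    have c2 : p.coeff 2 = 0 := by rw [hz]; simp
    simp [hp, Polynomial.coeff_X, Polynomial.coeff_C] at c0 c1 c2
    exact ⟨c0, c1, c2⟩
  refine (Polynomial.finite_setOfPred_isRoot hp0).subset ?_
  intro u hu
  have hu' : r + s * u + t * u^2 = 0 := hu
  show p.eval u = 0
  simp [hp, hu']

section
variable (a : ℕ → ℕ) (ha : ∀ i, 0 < a i) (α : ℝ)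
  (hpos : ∀ l, 0 < er a α l)
include ha hpos

lemma er_anti (l : ℕ) : er a α (l+1) < er a α l := by
  rw [er_step a α l]
  have h1 : (1:ℝ) ≤ a (l+1) := by exact_mod_cast ha (l+1)
  nlinarith [hpos (l+1), hpos (l+2)]

lemma er_le (l : ℕ) : er a α l * rq a (l+1) ≤ 1 := by
  have := er_det a α l
  have h2 := mul_pos (hpos (l+1)) (rq_pos a ha l)
  linarith

lemma er_le_one (l : ℕ) : er a α l ≤ 1 := by
  have h1 := er_le a ha α hpos l
  have h2 := rq_one_le a ha (l+1)
  nlinarith [hpos l]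

lemma er_le' (l : ℕ) : er a α l * rq a l ≤ 1 := by
  have h1 := er_le a ha α hpos l
  have h2 := rq_mono a ha (Nat.le_succ l)
  exact (mul_le_mul_of_nonneg_left h2 (hpos l).le).trans h1

lemma er_le_inv (l : ℕ) : er a α l ≤ 1 / rq a l := by
  rw [le_div_iff₀ (rq_pos a ha l)]; exact er_le' a ha α hpos l

lemma tails_eq (l l' : ℕ) (h : er a α l / er a α (l+1) = er a α l' / er a α (l'+1)) (k : ℕ) :
    er a α (l+k) / er a α (l+k+1) = er a α (l'+k) / er a α (l'+k+1) ∧ a (l+k+1) = a (l'+k+1) := by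
  have key : ∀ l l', er a α l / er a α (l+1) = er a α l' / er a α (l'+1) →
      a (l+1) = a (l'+1) ∧ er a α (l+1) / er a α (l+1+1) = er a α (l'+1) / er a α (l'+1+1) := by
    intro l l' h
    have e : ∀ l, er a α l / er a α (l+1) = a (l+1) + er a α (l+2) / er a α (l+1) := by
      intro l
      have := (hpos (l+1)).ne'
      rw [er_step a α l]; field_simp
    have b : ∀ l, 0 < er a α (l+2) / er a α (l+1) ∧ er a α (l+2) / er a α (l+1) < 1 := by
      intro l
      refine ⟨div_pos (hpos _) (hpos _), ?_⟩
      rw [div_lt_one (hpos _)]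
      exact er_anti a ha α hpos (l+1)
    rw [e, e] at h
    have b1 := b l
    have b2 := b l'
    have h1 : a (l+1) = a (l'+1) := by
      have c1 : (a (l+1) : ℝ) < a (l'+1) + 1 := by linarith
      have c2 : (a (l'+1) : ℝ) < a (l+1) + 1 := by linarith
      have c1' : a (l+1) < a (l'+1) + 1 := by exact_mod_cast c1
      have c2' : a (l'+1) < a (l+1) + 1 := by exact_mod_cast c2
      omega
    refine ⟨h1, ?_⟩
    rw [h1] at h
    have h2 := add_left_cancel h
    have := congrArg (fun x => x⁻¹) h2
    simpa using this
  have main : er a α (l+k) / er a α (l+k+1) = er a α (l'+k) / er a α (l'+k+1) := by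
    induction k with
    | zero => simpa using h
    | succ k ih => exact (key _ _ ih).2
  exact ⟨main, (key _ _ main).1⟩

lemma lagrange (hnp : ¬ EventuallyPeriodic a) (x y z : ℤ) (h0 : (x:ℝ) + y * α + z * α^2 = 0) :
    x = 0 ∧ y = 0 ∧ z = 0 := by
  by_contra hne
  apply hnp
  set P : ℕ → ℤ := fun l => (cfP a l : ℤ) with hP
  set Q : ℕ → ℤ := fun l => (cfQ a l : ℤ) with hQ
  have hPr : ∀ l, ((P l : ℤ) : ℝ) = rp a l := fun l => by simp [hP, rp]
  have hQr : ∀ l, ((Q l : ℤ) : ℝ) = rq a l := fun l => by simp [hQ, rq]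
  set A : ℕ → ℤ := fun l => z * P l ^2 + y * P l * Q l + x * Q l ^2 with hA
  set B : ℕ → ℤ := fun l => 2 * z * P l * P (l+1) + y * (P l * Q (l+1) + P (l+1) * Q l) + 2 * x * Q l * Q (l+1) with hB
  obtain ⟨M, hM⟩ : ∃ M : ℕ, 2 * |2 * z * α + y| + 2 * |(z:ℝ)| ≤ M := exists_nat_ge _
  have hrp : ∀ l, rp a l = α * rq a l - (-1)^l * er a α l := by
    intro l
    unfold er
    rw [← mul_assoc, neg_one_sq_pow]; ring
  have hs : ∀ l, |((-1:ℝ)^l)| = 1 := fun l => by simp [abs_pow]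
  have hAr : ∀ l, (A l : ℝ) = -(2 * z * α + y) * (-1)^l * (er a α l * rq a l) + z * (er a α l)^2 := by
    intro l
    simp only [hA]; push_cast
    rw [hPr, hQr, hrp]
    have hx : (x:ℝ) = - y * α - z * α^2 := by linarith
    have h2 := neg_one_sq_pow l
    rw [hx]
    linear_combination z * (er a α l)^2 * h2
  have hAM : ∀ l, |A l| ≤ M := by
    intro l
    have : |(A l : ℝ)| ≤ M := by
      rw [hAr]
      refine (abs_add_le _ _).trans (le_trans ?_ hM)
      rw [abs_mul, abs_mul (-(2*(z:ℝ)*α+y)), abs_neg, hs, mul_one, abs_mul (z:ℝ)]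
      have e1 : |er a α l * rq a l| ≤ 1 := by
        rw [abs_of_pos (mul_pos (hpos l) (rq_pos a ha l))]; exact er_le' a ha α hpos l
      have e2 : |er a α l ^2| ≤ 1 := by
        rw [abs_of_nonneg (by positivity)]
        exact pow_le_one₀ (hpos l).le (er_le_one a ha α hpos l)
      have := mul_le_mul_of_nonneg_left e1 (abs_nonneg (2*z*α+y))
      have := mul_le_mul_of_nonneg_left e2 (abs_nonneg (z:ℝ))
      linarith [abs_nonneg (2*z*α+y), abs_nonneg (z:ℝ)]
    rw [← Int.cast_abs] at this
    exact_mod_cast this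
  have hBr : ∀ l, (B l : ℝ) = (2 * z * α + y) * (-1)^l * (er a α (l+1) * rq a l - er a α l * rq a (l+1)) - 2 * z * (er a α l * er a α (l+1)) := by
    intro l
    simp only [hB]; push_cast
    rw [hPr, hQr, hPr, hQr, hrp, hrp (l+1)]
    have hx : (x:ℝ) = - y * α - z * α^2 := by linarith
    have h2 := neg_one_sq_pow l
    rw [hx, pow_succ]
    linear_combination -2 * z * (er a α l * er a α (l+1)) * h2
  have hBM : ∀ l, |B l| ≤ M := by
    intro l
    have : |(B l : ℝ)| ≤ M := by
      rw [hBr]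
      refine (abs_sub _ _).trans (le_trans ?_ hM)
      rw [abs_mul, abs_mul, abs_mul, abs_mul, hs, mul_one, abs_two]
      have p1 := mul_pos (hpos (l+1)) (rq_pos a ha l)
      have p2 := mul_pos (hpos l) (rq_pos a ha (l+1))
      have e1 : |er a α (l+1) * rq a l - er a α l * rq a (l+1)| ≤ 1 := by
        have := er_det a α l
        rw [abs_le]; constructor <;> linarith
      have e2 : |er a α l * er a α (l+1)| ≤ 1 := by
        rw [abs_of_pos (mul_pos (hpos l) (hpos (l+1)))]
        exact mul_le_one₀ (er_le_one a ha α hpos l) (hpos (l+1)).le (er_le_one a ha α hpos (l+1))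
      have := mul_le_mul_of_nonneg_left e1 (abs_nonneg (2*z*α+y))
      have := mul_le_mul_of_nonneg_left e2 (abs_nonneg (z:ℝ))
      linarith [abs_nonneg (2*z*α+y), abs_nonneg (z:ℝ)]
    rw [← Int.cast_abs] at this
    exact_mod_cast this
  have hdet : ∀ l, (P (l+1) * Q l - P l * Q (l+1))^2 = 1 := by
    intro l
    have h := rpq_det a l
    have : ((P (l+1) * Q l - P l * Q (l+1) : ℤ):ℝ)^2 = 1 := by
      push_cast
      rw [hPr, hPr, hQr, hQr, h, ← pow_mul, mul_comm, pow_mul]; simp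
    exact_mod_cast this
  have hnz : ∀ l, ¬ (A l = 0 ∧ B l = 0 ∧ A (l+1) = 0) := by
    rintro l ⟨h1, h2, h3⟩
    apply hne
    have d := hdet l
    simp only [hA] at h1 h3
    simp only [hB] at h2
    refine ⟨?_, ?_, ?_⟩
    · linear_combination (P (l+1))^2 * h1 - (P l * P (l+1)) * h2 + (P l)^2 * h3 - x * d
    · linear_combination -2 * P (l+1) * Q (l+1) * h1 + (P l * Q (l+1) + P (l+1) * Q l) * h2 - 2 * P l * Q l * h3 - y * d
    · linear_combination (Q (l+1))^2 * h1 - (Q l * Q (l+1)) * h2 + (Q l)^2 * h3 - z * d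
  -- finite set of roots
  set S : Set ℝ := ⋃ t ∈ ((Set.Icc (-(M:ℤ)) M ×ˢ Set.Icc (-(M:ℤ)) M ×ˢ Set.Icc (-(M:ℤ)) M) \ {(0,0,0)} : Set (ℤ × ℤ × ℤ)),
    {u : ℝ | (t.1 : ℝ) + t.2.1 * u + t.2.2 * u^2 = 0} with hS
  have hSfin : S.Finite := by
    rw [hS]
    apply Set.Finite.biUnion
    · exact Set.Finite.subset (((Set.finite_Icc _ _).prod ((Set.finite_Icc _ _).prod (Set.finite_Icc _ _)))) Set.sdiff_subset
    · rintro ⟨t1, t2, t3⟩ ⟨-, ht⟩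
      apply quad_finite
      rintro ⟨h1, h2, h3⟩
      apply ht
      simp only [Int.cast_eq_zero] at h1 h2 h3
      simp [h1, h2, h3]
  have hmem : ∀ l, er a α l / er a α (l+1) ∈ S := by
    intro l
    rw [hS]
    simp only [Set.mem_iUnion]
    refine ⟨(A l, B l, A (l+1)), ?_, ?_⟩
    · refine ⟨?_, ?_⟩
      · simp only [Set.mem_prod, Set.mem_Icc]
        exact ⟨abs_le.1 (hAM l), abs_le.1 (hBM l), abs_le.1 (hAM (l+1))⟩
      · intro h
        simp only [Set.mem_singleton_iff, Prod.mk.injEq] at h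
        exact hnz l h
    · simp only [Set.mem_ofPred_eq]
      have hp := (hpos (l+1)).ne'
      have : (A l : ℝ) * er a α (l+1)^2 + B l * er a α l * er a α (l+1) + A (l+1) * er a α l ^2 = 0 := by
        rw [hAr, hBr, hAr, pow_succ]
        ring
      field_simp
      linarith
  have : Finite S := hSfin
  obtain ⟨l, l', hll, he⟩ := Finite.exists_ne_map_eq_of_infinite (fun l : ℕ => (⟨_, hmem l⟩ : S))
  have he' := congrArg Subtype.val he
  simp only at he'
  have fin : ∀ l l' : ℕ, l < l' → er a α l / er a α (l+1) = er a α l' / er a α (l'+1) → EventuallyPeriodic a := by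
    intro l l' hlt h
    refine ⟨l+1, l' - l, by omega, fun n hn => ?_⟩
    have := (tails_eq a ha α hpos l l' h (n - l - 1)).2
    rw [show l + (n-l-1) + 1 = n by omega, show l' + (n-l-1)+1 = n + (l'-l) by omega] at this
    exact this.symm
  rcases lt_or_gt_of_ne hll with h | h
  · exact fin _ _ h he'
  · exact fin _ _ h he'.symm
end
end SubsThm
end

set_option linter.unusedSectionVars false
noncomputable section
namespace SubsThm
open Finset

lemma growth (a : ℕ → ℕ) (ha : ∀ i, 0 < a i)
    (hconv : ∃ L : ℝ, Tendsto (fun ℓ : ℕ => (cfQ a ℓ : ℝ) ^ (1 / (ℓ : ℝ))) atTop (𝓝 L)) :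
    ∃ lam : ℝ, 0 < lam ∧ ∀ ε > 0, ∃ C : ℝ, 0 ≤ C ∧ ∀ l : ℕ,
      (lam - ε) * l - C ≤ Real.log (rq a l) ∧ Real.log (rq a l) ≤ (lam + ε) * l + C := by
  obtain ⟨L, hL⟩ := hconv
  have hL1 : 1 ≤ L := by
    apply ge_of_tendsto' hL
    intro l
    exact Real.one_le_rpow (rq_one_le a ha l) (by positivity)
  have hlog : Tendsto (fun l : ℕ => Real.log (rq a l) / l) atTop (𝓝 (Real.log L)) := by
    have := (Real.continuousAt_log (by linarith : L ≠ 0)).tendsto.comp hL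
    refine this.congr ?_
    intro l
    simp only [Function.comp]
    have hq : (0:ℝ) < cfQ a l := rq_pos a ha l
    rw [Real.log_rpow hq]
    unfold rq
    ring
  have hl2 : 0 < Real.log 2 := Real.log_pos one_lt_two
  refine ⟨Real.log L, ?_, ?_⟩
  · have : Real.log 2 / 4 ≤ Real.log L := by
      apply ge_of_tendsto hlog
      filter_upwards [eventually_ge_atTop 2] with l hl
      have hl' : (2:ℝ) ≤ l := by exact_mod_cast hl
      rw [le_div_iff₀ (by linarith)]
      have := (rq_log_lb a ha l).1
      nlinarith
    linarith
  · intro ε hε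
    obtain ⟨N, hN⟩ := (Metric.tendsto_atTop.1 hlog) ε hε
    set S := ∑ k ∈ Finset.range (N+1), (|Real.log L| * k + ε * k + Real.log (rq a k)) with hS
    have hlognn : ∀ k, 0 ≤ Real.log (rq a k) := fun k => Real.log_nonneg (rq_one_le a ha k)
    have hnn : ∀ k, 0 ≤ (|Real.log L| * k + ε * k + Real.log (rq a k)) := fun k => by
      have := hlognn k
      positivity
    refine ⟨S, Finset.sum_nonneg fun k _ => hnn k, fun l => ?_⟩
    by_cases h : l ≤ N
    · have h1 := Finset.single_le_sum (f := fun k : ℕ => (|Real.log L| * k + ε * k + Real.log (rq a k)))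
        (fun k _ => hnn k) (Finset.mem_range.2 (Nat.lt_succ_of_le h))
      have h1' : |Real.log L| * l + ε * l + Real.log (rq a l) ≤ S := h1
      have h2 := hlognn l
      have hl0 : (0:ℝ) ≤ l := Nat.cast_nonneg l
      have h3 : Real.log L * l ≤ |Real.log L| * l := mul_le_mul_of_nonneg_right (le_abs_self _) hl0
      have h4 : 0 ≤ Real.log L * l := mul_nonneg (Real.log_nonneg hL1) hl0
      have h5 : 0 ≤ ε * l := by positivity
      constructor <;> nlinarith
    · push Not at h
      have h1 := hN l h.le
      rw [Real.dist_eq, abs_lt] at h1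
      have hl0 : (0:ℝ) < l := by exact_mod_cast (Nat.zero_le N).trans_lt h
      have hSn : 0 ≤ S := Finset.sum_nonneg fun k _ => hnn k
      have e : Real.log (rq a l) = Real.log (rq a l) / l * l := by field_simp
      rw [e]
      constructor <;> nlinarith

/-- The functional attached to a repetition. -/
def hfun (a : ℕ → ℕ) (r R : ℕ) : Fin 4 → ℤ :=
  ![(cfP a r : ℤ) * cfP a (R+1) - cfP a (r+1) * cfP a R,
    -((cfP a r : ℤ) * cfQ a (R+1) - cfP a (r+1) * cfQ a R),
    -((cfQ a r : ℤ) * cfP a (R+1) - cfQ a (r+1) * cfP a R),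
    (cfQ a r : ℤ) * cfQ a (R+1) - cfQ a (r+1) * cfQ a R]

lemma hfun_ne (a : ℕ → ℕ) (r R : ℕ) : hfun a r R ≠ 0 := by
  intro h
  have h0 := congrFun h 0
  have h1 := congrFun h 1
  have h2 := congrFun h 2
  have h3 := congrFun h 3
  simp only [hfun, Matrix.cons_val, Pi.zero_apply] at h0 h1 h2 h3
  have dr : ∀ l, ((cfP a (l+1) : ℤ) * cfQ a l - cfP a l * cfQ a (l+1)) = (-1)^l := by
    intro l
    have := rpq_det a l
    unfold rp rq at this
    exact_mod_cast this
  have key : ((cfP a (r+1) : ℤ) * cfQ a r - cfP a r * cfQ a (r+1)) * ((cfP a (R+1) : ℤ) * cfQ a R - cfP a R * cfQ a (R+1)) = 0 := by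
    linear_combination -(cfQ a (r+1) : ℤ) * cfQ a R * h0 - (cfQ a (r+1) : ℤ) * cfP a R * h1 - (cfP a (r+1) : ℤ) * cfQ a R * h2 - (cfP a (r+1) : ℤ) * cfP a R * h3
  rw [dr, dr] at key
  have := mul_eq_zero.1 key
  rcases this with h | h <;> exact (pow_ne_zero _ (by norm_num)) h

section
variable (a : ℕ → ℕ) (ha : ∀ i, 0 < a i) (α : ℝ)
  (hpos : ∀ l, 0 < er a α l)
include ha hpos

lemma T_inv (r R m : ℕ) (hm : ∀ i < m, a (r+i+1) = a (R+i+1)) :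
    |er a α r * er a α (R+1) - er a α (r+1) * er a α R| =
    |er a α (r+m) * er a α (R+m+1) - er a α (r+m+1) * er a α (R+m)| := by
  induction m with
  | zero => simp
  | succ m ih =>
    rw [ih fun i hi => hm i (by omega)]
    have h := hm m (by omega)
    have e1 := er_step a α (r+m)
    have e2 := er_step a α (R+m)
    rw [h] at e1
    rw [← abs_neg]
    congr 1
    show _ = er a α (r+m+1) * er a α (R+m+2) - er a α (r+m+2) * er a α (R+m+1)
    rw [e1, e2]; ring

lemma hf_bounds (r R m : ℕ) (hm : ∀ i < m, a (r+i+1) = a (R+i+1)) :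
    |∑ j, (hfun a r R j : ℝ) * fB α j 0| ≤ 2 * (1 / rq a (r+m) * (1 / rq a (R+m))) ∧
    |∑ j, (hfun a r R j : ℝ) * fB α j 1| ≤ 2 * (1 / rq a r * rq a (R+1)) ∧
    |∑ j, (hfun a r R j : ℝ) * fB α j 2| ≤ 2 * (rq a (r+1) * (1 / rq a R)) ∧
    |∑ j, (hfun a r R j : ℝ) * fB α j 3| ≤ 2 * (rq a (r+1) * rq a (R+1)) := by
  have hrp : ∀ l, (cfP a l : ℝ) = α * rq a l - (-1)^l * er a α l := by
    intro l
    unfold er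
    rw [← mul_assoc, neg_one_sq_pow]; unfold rp; ring
  have hrq : ∀ l, (cfQ a l : ℝ) = rq a l := fun l => rfl
  have hs : ∀ l, |((-1:ℝ)^l)| = 1 := fun l => by simp [abs_pow]
  have q := fun l => rq_pos a ha l
  have anti := fun l => (er_anti a ha α hpos l).le
  have inv := fun l => er_le_inv a ha α hpos l
  have mon := fun l => rq_mono a ha (Nat.le_succ l)
  have qi : ∀ l, 0 < 1 / rq a l := fun l => by have := q l; positivity
  refine ⟨?_, ?_, ?_, ?_⟩
  · have e : ∑ j, (hfun a r R j : ℝ) * fB α j 0 = (-1)^r * (-1)^(R+1) * (er a α r * er a α (R+1) - er a α (r+1) * er a α R) := by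
      simp only [Fin.sum_univ_four, hfun, fB, Matrix.cons_val, Matrix.of_apply]
      push_cast
      simp only [hrp, hrq, pow_succ]
      ring
    rw [e, abs_mul, abs_mul, hs, hs, one_mul, one_mul, T_inv a ha α hpos r R m hm]
    refine (abs_sub _ _).trans ?_
    rw [abs_of_pos (mul_pos (hpos _) (hpos _)), abs_of_pos (mul_pos (hpos _) (hpos _))]
    have b1 : er a α (r+m) * er a α (R+m+1) ≤ 1 / rq a (r+m) * (1 / rq a (R+m)) :=
      mul_le_mul (inv _) ((anti _).trans (inv _)) (hpos _).le (qi _).le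
    have b2 : er a α (r+m+1) * er a α (R+m) ≤ 1 / rq a (r+m) * (1 / rq a (R+m)) :=
      mul_le_mul ((anti _).trans (inv _)) (inv _) (hpos _).le (qi _).le
    linarith
  · have e : ∑ j, (hfun a r R j : ℝ) * fB α j 1 = (-1)^r * (er a α r * rq a (R+1) + er a α (r+1) * rq a R) := by
      simp only [Fin.sum_univ_four, hfun, fB, Matrix.cons_val, Matrix.of_apply]
      push_cast
      simp only [hrp, hrq, pow_succ]
      ring
    rw [e, abs_mul, hs, one_mul, abs_of_pos (add_pos (mul_pos (hpos _) (q _)) (mul_pos (hpos _) (q _)))]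
    have b1 : er a α r * rq a (R+1) ≤ 1 / rq a r * rq a (R+1) :=
      mul_le_mul_of_nonneg_right (inv _) (q _).le
    have b2 : er a α (r+1) * rq a R ≤ 1 / rq a r * rq a (R+1) :=
      mul_le_mul ((anti _).trans (inv _)) (mon _) (q _).le (qi _).le
    linarith
  · have e : ∑ j, (hfun a r R j : ℝ) * fB α j 2 = (-1)^(R+1) * (rq a r * er a α (R+1) + rq a (r+1) * er a α R) := by
      simp only [Fin.sum_univ_four, hfun, fB, Matrix.cons_val, Matrix.of_apply]
      push_cast
      simp only [hrp, hrq, pow_succ]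
      ring
    rw [e, abs_mul, hs, one_mul, abs_of_pos (add_pos (mul_pos (q _) (hpos _)) (mul_pos (q _) (hpos _)))]
    have b1 : rq a r * er a α (R+1) ≤ rq a (r+1) * (1 / rq a R) :=
      mul_le_mul (mon _) ((anti _).trans (inv _)) (hpos _).le (q _).le
    have b2 : rq a (r+1) * er a α R ≤ rq a (r+1) * (1 / rq a R) :=
      mul_le_mul_of_nonneg_left (inv _) (q _).le
    linarith
  · have e : ∑ j, (hfun a r R j : ℝ) * fB α j 3 = rq a r * rq a (R+1) - rq a (r+1) * rq a R := by
      simp only [Fin.sum_univ_four, hfun, fB, Matrix.cons_val, Matrix.of_apply]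
      push_cast
      simp only [hrq]
      ring
    rw [e]
    refine (abs_sub _ _).trans ?_
    rw [abs_of_pos (mul_pos (q _) (q _)), abs_of_pos (mul_pos (q _) (q _))]
    have b1 : rq a r * rq a (R+1) ≤ rq a (r+1) * rq a (R+1) := mul_le_mul_of_nonneg_right (mon _) (q _).le
    have b2 : rq a (r+1) * rq a R ≤ rq a (r+1) * rq a (R+1) := mul_le_mul_of_nonneg_left (mon _) (q _).le
    linarith
end
end SubsThm
end

set_option linter.unusedSectionVars false
noncomputable section
namespace SubsThm
open Finset

lemma matching {x : ℕ → ℕ} {V : List ℕ} {w : ℝ} (h : BeginsWithPow x V w) (i : ℕ)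
    (hi : ((i + V.length : ℕ) : ℝ) < w * V.length) : x i = x (i + V.length) := by
  have h2 := h (i + V.length) (Nat.lt_ceil.2 hi)
  have h1 := h i (lt_of_le_of_lt (Nat.le_add_right _ _) (Nat.lt_ceil.2 hi))
  rw [Nat.add_mod_right, h1] at h2
  exact Option.some.inj h2

theorem main_contra (a : ℕ → ℕ) (ha : ∀ i, 0 < a i) (α : ℝ)
    (hα : Tendsto (fun ℓ => (cfP a ℓ : ℝ) / (cfQ a ℓ : ℝ)) atTop (𝓝 α))
    (hconv : ∃ L : ℝ, Tendsto (fun ℓ : ℕ => (cfQ a ℓ : ℝ) ^ (1 / (ℓ : ℝ))) atTop (𝓝 L))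
    (w w' : ℝ) (hw' : 0 ≤ w') (hw : 1 < w)
    (hcond : ConditionStarStar a w w') (halg : IsAlgebraic ℤ α) : False := by
  obtain ⟨hnp, U, V, hV, hmono, hU, hUV⟩ := hcond
  have hpos := er_pos a ha α hα
  have hquad := lagrange a ha α hpos hnp
  obtain ⟨lam, hlam, hgr⟩ := growth a ha hconv
  set D : ℝ := min ((w-1)/2) (1/2) with hD
  have hD0 : 0 < D := lt_min (by linarith) (by norm_num)
  have hD1 : D ≤ (w-1)/2 := min_le_left _ _
  have hD2 : D ≤ 1/2 := min_le_right _ _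
  set ε : ℝ := D * lam / (2 * (2 * w' + 5)) with hε
  have hε0 : 0 < ε := by positivity
  have hεe : ε * (2 * w' + 5) = D * lam / 2 := by rw [hε]; field_simp
  obtain ⟨C, hC, hg⟩ := hgr ε hε0
  set K : ℝ := 2 * Real.exp (2 * C + 2 * lam) with hK
  obtain ⟨X0, hX0⟩ := gap_contra α halg hquad (2*w'+4) K (D/2) D (by linarith) (by positivity) (by linarith) hD0
  obtain ⟨n, hn⟩ := exists_nat_ge (X0 / lam)
  set s : ℕ := (V n).length with hs
  set r : ℕ := (U n).length with hr
  have hs1 : 1 ≤ s := List.length_pos_iff.2 (hV n)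
  have hs1' : (1:ℝ) ≤ s := by exact_mod_cast hs1
  have hns : n ≤ s := hmono.id_le n
  have hlq : X0 ≤ lam * s := by
    rw [div_le_iff₀ hlam] at hn
    have : (n:ℝ) ≤ s := by exact_mod_cast hns
    nlinarith
  have hr0 : (0:ℝ) ≤ r := Nat.cast_nonneg r
  have hrw : (r:ℝ) ≤ w' * s := hU n
  set ρ : ℝ := r / s with hρ
  have hρs : ρ * s = r := by rw [hρ]; field_simp
  have hρ0 : 0 ≤ ρ := by positivity
  have hρ1 : ρ ≤ w' := by rw [hρ, div_le_iff₀ (by linarith)]; exact hrw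
  set m : ℕ := ⌈2 * D * s⌉₊ - 1 with hm
  have hDs : 0 < 2 * D * s := by positivity
  have hc1 : 1 ≤ ⌈2 * D * (s:ℝ)⌉₊ := Nat.one_le_ceil_iff.2 hDs
  have hmc : (m:ℝ) + 1 = (⌈2 * D * (s:ℝ)⌉₊ : ℝ) := by
    have : m + 1 = ⌈2 * D * (s:ℝ)⌉₊ := by omega
    exact_mod_cast this
  have hm1 : 2 * D * s - 1 ≤ m := by have := Nat.le_ceil (2 * D * (s:ℝ)); linarith
  have hm2 : (m:ℝ) < 2 * D * s := by have := Nat.ceil_lt_add_one hDs.le; linarith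
  have hmatch : ∀ i < m, a (r+i+1) = a (r+s+i+1) := by
    intro i hi
    have h1 := matching (hUV n).2 (i+1) (by
      have : ((i+1:ℕ):ℝ) ≤ m := by exact_mod_cast hi
      rw [Nat.cast_add]
      show ((i+1:ℕ):ℝ) + (s:ℝ) < w * s
      nlinarith)
    beta_reduce at h1
    rw [← hr, ← hs] at h1
    rw [show r+i+1 = r + (i+1) by ring, show r+s+i+1 = r + (i+1+s) by ring]
    exact h1
  obtain ⟨b0, b1, b2, b3⟩ := hf_bounds a ha α hpos r (r+s) m hmatch
  have q := fun l => rq_pos a ha l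
  have qu : ∀ l : ℕ, rq a l ≤ Real.exp ((lam + ε) * l + C) := fun l =>
    (Real.log_le_iff_le_exp (q l)).1 (hg l).2
  have ql : ∀ l : ℕ, 1 / rq a l ≤ Real.exp (-((lam - ε) * l - C)) := fun l => by
    rw [Real.exp_neg, one_div]
    apply inv_anti₀ (Real.exp_pos _)
    exact (Real.le_log_iff_exp_le (q l)).1 (hg l).1
  have qi : ∀ l, 0 < 1 / rq a l := fun l => by have := q l; positivity
  have fin : ∀ X Y x y E : ℝ, 0 ≤ X → 0 ≤ Y → X ≤ Real.exp x → Y ≤ Real.exp y → x + y ≤ 2 * C + 2 * lam + E →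
      2 * (X * Y) ≤ K * Real.exp E := by
    intro X Y x y E hX hY hx hy h
    have h1 : X * Y ≤ Real.exp (2 * C + 2 * lam) * Real.exp E := by
      rw [← Real.exp_add]
      refine (mul_le_mul hx hy hY (Real.exp_pos _).le).trans ?_
      rw [← Real.exp_add]
      exact Real.exp_le_exp.2 h
    rw [hK]; linarith
  have hls : 0 < lam * s := by positivity
  -- slack facts
  have sl : ε * (2 * r + s + 2 * m + 2) ≤ D * lam / 2 * s := by
    have h1 : (2 * r + s + 2 * m + 2 : ℝ) ≤ (2 * w' + 5) * s := by nlinarith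
    calc _ ≤ ε * ((2 * w' + 5) * s) := mul_le_mul_of_nonneg_left h1 hε0.le
      _ = _ := by rw [← mul_assoc, hεe]
  have hm0 : (0:ℝ) ≤ m := Nat.cast_nonneg m
  have eR : ε * r ≥ 0 := by positivity
  have eS : ε * s ≥ 0 := by positivity
  have eM : ε * m ≥ 0 := by positivity
  have lm : lam * (2 * D * s - 1) ≤ lam * m := mul_le_mul_of_nonneg_left hm1 hlam.le
  have lr : lam * (ρ * s) = lam * r := by rw [hρs]
  refine hX0 (lam * s) hlq ![2*ρ+1+3*D, -1-D, 1-D, -(2*ρ+1)-D] (hfun a r (r+s)) ?_ ?_ ?_ ?_ ?_ ?_ ?_ (hfun_ne _ _ _) ?_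
  · simp [Fin.sum_univ_four]; ring
  · intro i
    fin_cases i <;> simp [abs_le] <;> constructor <;> linarith
  · simp; linarith
  · simp; linarith
  · simp
  · simp; linarith
  · simp; linarith
  · intro i
    fin_cases i
    · refine b0.trans (fin _ _ _ _ _ (qi _).le (qi _).le (ql _) (ql _) ?_)
      simp; linarith
    · refine b1.trans (fin _ _ _ _ _ (qi _).le (q _).le (ql _) (qu _) ?_)
      simp; linarith
    · refine b2.trans (fin _ _ _ _ _ (q _).le (qi _).le (qu _) (ql _) ?_)
      simp; linarith
    · refine b3.trans (fin _ _ _ _ _ (q _).le (q _).le (qu _) (qu _) ?_)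
      simp; linarith

end SubsThm
end


/-- Corollary 1 of Theorem 2: let `α = [0; a_1, a_2, …]` with convergents
`p_ℓ/q_ℓ`, assume the sequence `(q_ℓ^{1/ℓ})` converges, and let `w, w' ≥ 0`
with `w > w' + 1`.  If the partial quotients satisfy Condition `(**)_{w,w'}`,
then `α` is transcendental. -/
theorem statement3 (a : ℕ → ℕ) (hpos : ∀ i, 0 < a i) (α : ℝ)
    (hα : Tendsto (fun ℓ => (cfP a ℓ : ℝ) / (cfQ a ℓ : ℝ)) atTop (𝓝 α))
    (hconv : ∃ L : ℝ, Tendsto (fun ℓ : ℕ => (cfQ a ℓ : ℝ) ^ (1 / (ℓ : ℝ))) atTop (𝓝 L))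
    (w w' : ℝ) (hw : 0 ≤ w) (hw' : 0 ≤ w')
    (hineq : w > w' + 1)
    (hcond : ConditionStarStar a w w') :
    Transcendental ℚ α := by
  intro halg
  have : IsAlgebraic ℤ α := (IsFractionRing.isAlgebraic_iff ℤ ℚ ℝ).2 halg
  exact SubsThm.main_contra a hpos α hα hconv w w' hw' (by linarith) hcond this
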